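/- Let q be a square prime power and let s be an integer with 2 ≤ s ≤ √q − 1. Then R_q(s) ≥ 1/s − 1/(√q − 1) + (1 − 2·log_q s)/(s·(√q − 1)). (This is the instance of the bound R_q(s) ≥ 1/s − 1/A(q) + (1 − 2 log_q s)/(s·A(q)) for square q, where Ihara's constant satisfies A(q) = √q − 1.) -/

import Mathlib

open Filter

/-- The set of descendants of a set `A ⊆ S^n` of words: all words agreeing in each
coordinate with some word of `A`. -/
def descSet {S : Type*} {n : ℕ} (A : Set (Fin n → S)) : Set (Fin n → S) :=
  {x | ∀ i, ∃ a ∈ A, x i = a i}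

/-- A `q`-ary `s`-frameproof code of length `n`: for every `A ⊆ C` with `|A| ≤ s`,
`desc(A) ∩ C = A`. -/
def IsFrameproof {S : Type*} {n : ℕ} (s : ℕ) (C : Set (Fin n → S)) : Prop :=
  ∀ A ⊆ C, A.ncard ≤ s → descSet A ∩ C = A

/-- `M_q(n,s)`: the maximal size of a `q`-ary `s`-frameproof code of length `n`. -/
noncomputable def Mfp (q n s : ℕ) : ℕ :=
  sSup {M | ∃ C : Set (Fin n → Fin q), IsFrameproof s C ∧ C.ncard = M}

/-- `R_q(s) = limsup_{n→∞} log_q M_q(n,s) / n`. -/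
noncomputable def Rfp (q s : ℕ) : ℝ :=
  limsup (fun n => Real.logb q (Mfp q n s) / (n : ℝ)) atTop

namespace GS

/-- The additive polynomial `x ^ r + x`. -/
def T {R : Type*} [Semiring R] (r : ℕ) (x : R) : R := x ^ r + x

/-- The data of the Garcia and Stichtenoth tower over a field `F` with `r ^ 2` elements, realised
inside an extension `L` of the rational function field. -/
structure Tower (F L : Type*) [Field F] [Fintype F] [Field L] [Algebra F L]
    [Algebra (RatFunc F) L] (r : ℕ) where
  x : ℕ → L
  x_zero : x 0 = algebraMap (RatFunc F) L RatFunc.X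
  rel : ∀ i, T r (x (i + 1)) * T r (x i) = x i ^ (r + 1)
  T_ne : ∀ i, T r (x i) ≠ 0
  add_pow : ∀ a b : L, (a + b) ^ r = a ^ r + b ^ r
  card : Fintype.card F = r ^ 2
  two_le : 2 ≤ r

section Existence

variable {L : Type*} [Field L] [IsAlgClosed L]

lemma exists_T_eq {r : ℕ} (hr : 2 ≤ r) (c : L) : ∃ y : L, T r y = c := by
  have hd : (Polynomial.X ^ r + Polynomial.X - Polynomial.C c : Polynomial L).degree ≠ 0 := by
    have : (Polynomial.X ^ r + Polynomial.X - Polynomial.C c : Polynomial L).degree = r := by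
      compute_degree!
      · simp [show r ≠ 0 by omega, show 1 ≠ r by omega]
      · exact max_eq_left (Nat.one_le_cast.2 (by omega))
    rw [this]
    exact_mod_cast (by omega : r ≠ 0)
  obtain ⟨y, hy⟩ := IsAlgClosed.exists_root _ hd
  refine ⟨y, ?_⟩
  simp only [Polynomial.IsRoot, Polynomial.eval_sub, Polynomial.eval_add, Polynomial.eval_pow,
    Polynomial.eval_X, Polynomial.eval_C] at hy
  exact sub_eq_zero.mp hy

lemma exists_sequence {r : ℕ} (hr : 2 ≤ r) (x₀ : L) (h0 : T r x₀ ≠ 0) :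
    ∃ x : ℕ → L, x 0 = x₀ ∧ (∀ i, T r (x (i + 1)) * T r (x i) = x i ^ (r + 1)) ∧
      ∀ i, T r (x i) ≠ 0 := by
  choose pick hpick using exists_T_eq (L := L) hr
  let x : ℕ → L := fun n => Nat.rec x₀ (fun _ y => pick (y ^ (r + 1) / T r y)) n
  have hx : ∀ i, T r (x (i + 1)) = x i ^ (r + 1) / T r (x i) := fun i => hpick _
  have hT : ∀ i, T r (x i) ≠ 0 := by
    intro i
    induction i with
    | zero => exact h0
    | succ i ih =>
      rw [hx]
      refine div_ne_zero (pow_ne_zero _ fun h => ih ?_) ih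
      rw [h, T, zero_pow (by omega), add_zero]
  exact ⟨x, rfl, fun i => by rw [hx, div_mul_cancel₀ _ (hT i)], hT⟩

lemma exists_tower (F : Type*) [Field F] [Fintype F] {r : ℕ} (hr : IsPrimePow r)
    (hF : Fintype.card F = r ^ 2) :
    Nonempty (Tower F (AlgebraicClosure (RatFunc F)) r) := by
  obtain ⟨p, a, hp, ha, rfl⟩ := hr
  have hp' : p.Prime := hp.nat_prime
  have hr2 : 2 ≤ p ^ a := hp'.two_le.trans (Nat.le_self_pow ha.ne' p)
  have : Fact p.Prime := ⟨hp'⟩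
  have hchar : CharP F p := by
    obtain ⟨n, hcp, hcard⟩ := FiniteField.card F (ringChar F)
    have h : p ∣ ringChar F ^ (n : ℕ) := by
      rw [← hcard, hF]
      exact dvd_pow (dvd_pow_self p ha.ne') two_ne_zero
    have h2 := (Nat.prime_dvd_prime_iff_eq hp' hcp).1 (hp'.dvd_of_dvd_pow h)
    exact (ringChar.of_eq h2.symm)
  have : CharP (AlgebraicClosure (RatFunc F)) p :=
    charP_of_injective_algebraMap (algebraMap F (AlgebraicClosure (RatFunc F))).injective p
  have h0 : T (p ^ a) (algebraMap (RatFunc F) (AlgebraicClosure (RatFunc F)) RatFunc.X) ≠ 0 := by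
    have h1 : (Polynomial.X ^ (p ^ a) + Polynomial.X : Polynomial F) ≠ 0 := by
      intro h
      have := congrArg (fun f => Polynomial.coeff f 1) h
      rw [Polynomial.coeff_add, Polynomial.coeff_X_pow, if_neg (by omega)] at this
      simp at this
    unfold T
    rw [← map_pow, ← map_add, Ne, FaithfulSMul.algebraMap_eq_zero_iff,
      ← RatFunc.algebraMap_X, ← map_pow, ← map_add, FaithfulSMul.algebraMap_eq_zero_iff]
    exact h1
  obtain ⟨x, hx0, hrel, hT⟩ := exists_sequence hr2 _ h0
  exact ⟨⟨x, hx0, hrel, hT, fun b c => add_pow_char_pow b c p a, hF, hr2⟩⟩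

end Existence

section Valuation

variable {F L Γ : Type*} [Field F] [Fintype F] [Field L] [Algebra F L]
  [LinearOrderedCommGroupWithZero Γ] (v : Valuation L Γ)

lemma val_const {c : F} (hc : c ≠ 0) : v (algebraMap F L c) = 1 := by
  classical
  have h1 : c ^ (Fintype.card F - 1) = 1 := FiniteField.pow_card_sub_one_eq_one c hc
  have h2 : v (algebraMap F L c) ^ (Fintype.card F - 1) = 1 := by
    rw [← map_pow, ← map_pow, h1, map_one, map_one]
  have h3 : 1 < Fintype.card F := Fintype.one_lt_card
  exact (pow_eq_one_iff_left (by omega)).1 h2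

lemma val_const_le (c : F) : v (algebraMap F L c) ≤ 1 := by
  by_cases hc : c = 0
  · simp [hc]
  · exact (val_const v hc).le

lemma const_mem (V : ValuationSubring L) (c : F) : algebraMap F L c ∈ V :=
  (V.valuation_le_one_iff _).1 (val_const_le _ c)

omit [Fintype F] in
lemma val_T_of_one_lt {r : ℕ} (hr : 2 ≤ r) {y : L} (hy : 1 < v y) : v (T r y) = v y ^ r := by
  unfold T
  rw [Valuation.map_add_eq_of_lt_left, map_pow]
  rw [map_pow]
  exact lt_self_pow₀ hy (by omega)

omit [Fintype F] in
lemma mul_lt_one_val {a b : Γ} (ha : a ≤ 1) (hb : b < 1) : a * b < 1 :=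
  (mul_le_mul_left ha b).trans_lt (by rwa [one_mul])

omit [Fintype F] in
lemma val_T_of_lt_one {r : ℕ} (hr : 2 ≤ r) {y : L} (hy : v y < 1) : v (T r y) = v y := by
  unfold T
  rcases eq_or_ne y 0 with rfl | h0
  · simp [zero_pow (show r ≠ 0 by omega)]
  rw [Valuation.map_add_eq_of_lt_right]
  rw [map_pow]
  have h1 : 0 < v y := (Valuation.pos_iff v).2 h0
  exact pow_lt_self_of_lt_one₀ h1 hy (by omega)

omit [Fintype F] in
lemma val_le_one_of_T {r : ℕ} (hr : 2 ≤ r) {y : L} (hy : v (T r y) ≤ 1) : v y ≤ 1 := by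
  by_contra! h
  rw [val_T_of_one_lt v hr h] at hy
  exact absurd hy (not_le.2 (one_lt_pow₀ h (by omega)))

omit [Fintype F] in
lemma val_T_le {r : ℕ} {y : L} (hy : v y ≤ 1) : v (T r y) ≤ 1 := by
  unfold T
  refine (v.map_add _ _).trans (max_le ?_ hy)
  rw [map_pow]; exact pow_le_one' hy r

end Valuation

section Lam
variable {F : Type*} [Field F] [Fintype F] {r : ℕ}

open Classical in
/-- The kernel of `T` on the finite field. -/
noncomputable def Lam (F : Type*) [Field F] [Fintype F] (r : ℕ) : Finset F :=
  Finset.univ.filter fun a => T r a = 0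

lemma mem_Lam {a : F} : a ∈ Lam F r ↔ T r a = 0 := by simp [Lam]

variable (hadd : ∀ a b : F, (a + b) ^ r = a ^ r + b ^ r) (hcard : Fintype.card F = r ^ 2)
  (hr : 2 ≤ r)
include hadd hcard hr

open Polynomial in
lemma Lam_card_and_surj : (Lam F r).card = r ∧ ∀ c : F, c ^ r = c → ∃ a, T r a = c := by
  classical
  let f : F →+ F := AddMonoidHom.mk' (T r) fun a b => by
    simp only [T, hadd]; ring
  have hf : ∀ a, f a = T r a := fun a => rfl
  have hd1 : (X ^ r + X : F[X]).natDegree = r := by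
    compute_degree!
    · simp [show 1 ≠ r by omega]
    · omega
  have hd2 : (X ^ r - X : F[X]).natDegree = r := by
    compute_degree!
    · simp [show 1 ≠ r by omega]
    · omega
  have hne1 : (X ^ r + X : F[X]) ≠ 0 := fun h => by rw [h] at hd1; simp at hd1; omega
  have hne2 : (X ^ r - X : F[X]) ≠ 0 := fun h => by rw [h] at hd2; simp at hd2; omega
  have hL : (Lam F r).card ≤ r := by
    have : Lam F r ⊆ (X ^ r + X : F[X]).roots.toFinset := by
      intro a ha
      rw [mem_Lam] at ha
      simp only [Multiset.mem_toFinset, mem_roots hne1, IsRoot, eval_add, eval_pow, eval_X]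
      exact ha
    calc _ ≤ _ := Finset.card_le_card this
      _ ≤ _ := Multiset.toFinset_card_le _
      _ ≤ _ := card_roots' _
      _ = r := hd1
  let E : Finset F := Finset.univ.filter fun c => c ^ r = c
  have hE : E.card ≤ r := by
    have : E ⊆ (X ^ r - X : F[X]).roots.toFinset := by
      intro a ha
      simp only [E, Finset.mem_filter, Finset.mem_univ, true_and] at ha
      simp only [Multiset.mem_toFinset, mem_roots hne2, IsRoot, eval_sub, eval_pow, eval_X, ha,
        sub_self]
    calc _ ≤ _ := Finset.card_le_card this
      _ ≤ _ := Multiset.toFinset_card_le _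
      _ ≤ _ := card_roots' _
      _ = r := hd2
  have himg : (Finset.univ.image (T r) : Finset F) ⊆ E := by
    intro c hc
    simp only [Finset.mem_image, Finset.mem_univ, true_and] at hc
    obtain ⟨a, rfl⟩ := hc
    simp only [E, Finset.mem_filter, Finset.mem_univ, true_and, T, hadd]
    rw [← pow_mul, ← sq, ← hcard, FiniteField.pow_card, add_comm]
  have hcount : (Lam F r).card * (Finset.univ.image (T r) : Finset F).card = r ^ 2 := by
    have h1 := AddSubgroup.card_mul_index f.ker
    rw [AddSubgroup.index_ker, Nat.card_eq_fintype_card (α := F), hcard] at h1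
    rw [← h1]
    congr 1
    · rw [Nat.card_eq_fintype_card, Fintype.card_of_subtype]
      intro a
      rw [mem_Lam, AddMonoidHom.mem_ker, hf]
    · rw [Nat.card_eq_fintype_card, Fintype.card_of_subtype]
      intro c
      simp [hf, eq_comm]
  have h2 : (Finset.univ.image (T r) : Finset F).card ≤ r := (Finset.card_le_card himg).trans hE
  have h3 : (Lam F r).card = r := by nlinarith
  have h4 : (Finset.univ.image (T r) : Finset F).card = r := by
    rw [h3] at hcount; nlinarith
  refine ⟨h3, fun c hc => ?_⟩
  have h5 : Finset.univ.image (T r) = E := Finset.eq_of_subset_of_card_le himg (by omega)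
  have h6 : c ∈ E := by simp [E, hc]
  rw [← h5] at h6
  simpa using h6

lemma Lam_card : (Lam F r).card = r := (Lam_card_and_surj hadd hcard hr).1

lemma exists_T_eq_of_pow_eq {c : F} (hc : c ^ r = c) : ∃ a, T r a = c :=
  (Lam_card_and_surj hadd hcard hr).2 c hc

open Polynomial in
lemma prod_Lam : ∏ a ∈ Lam F r, (X - C a) = (X ^ r + X : F[X]) := by
  have hd1 : (X ^ r + X : F[X]).natDegree = r := by
    compute_degree!
    · simp [show 1 ≠ r by omega]
    · omega
  have hm : (X ^ r + X : F[X]).Monic := by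
    rw [Monic, leadingCoeff, hd1]
    simp [coeff_X, show 1 ≠ r by omega]
  have hne1 : (X ^ r + X : F[X]) ≠ 0 := hm.ne_zero
  have hsub : (Lam F r).val ≤ (X ^ r + X : F[X]).roots := by
    rw [Multiset.le_iff_subset (Lam F r).nodup]
    intro a ha
    rw [Finset.mem_val, mem_Lam] at ha
    simp only [mem_roots hne1, IsRoot, eval_add, eval_pow, eval_X]
    exact ha
  have hroots : (Lam F r).val = (X ^ r + X : F[X]).roots := by
    refine Multiset.eq_of_le_of_card_le hsub ?_
    calc _ ≤ _ := card_roots' _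
      _ = (Lam F r).val.card := by rw [hd1]; exact (Lam_card hadd hcard hr).symm
  rw [Finset.prod, hroots]
  refine prod_multiset_X_sub_C_of_monic_of_roots_card_eq hm ?_
  rw [← hroots, hd1]; exact Lam_card hadd hcard hr

lemma prod_Lam_apply {L : Type*} [Field L] [Algebra F L] (y : L) :
    ∏ a ∈ Lam F r, (y - algebraMap F L a) = T r y := by
  have := congrArg (Polynomial.aeval y) (prod_Lam hadd hcard hr)
  simpa [map_prod, T] using this

end Lam

namespace Tower

variable {F L : Type*} [Field F] [Fintype F] [Field L] [Algebra F L] [Algebra (RatFunc F) L]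
  {r : ℕ} (t : Tower F L r)
include t

lemma r_ne : r ≠ 0 := by have := t.two_le; omega

lemma zero_pow_r {R : Type*} [Semiring R] : (0 : R) ^ r = 0 := zero_pow t.r_ne

lemma T_zero {R : Type*} [Semiring R] : T r (0 : R) = 0 := by rw [T, t.zero_pow_r, add_zero]

lemma add_pow_base (a b : F) : (a + b) ^ r = a ^ r + b ^ r := by
  apply (algebraMap F L).injective
  simp only [map_pow, map_add, t.add_pow]

lemma neg_pow_r (a : L) : (-a) ^ r = -a ^ r := by
  have := t.add_pow a (-a)
  rw [add_neg_cancel, t.zero_pow_r] at this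
  exact (neg_eq_of_add_eq_zero_right this.symm).symm

lemma sub_pow_r (a b : L) : (a - b) ^ r = a ^ r - b ^ r := by
  rw [sub_eq_add_neg, t.add_pow, t.neg_pow_r, sub_eq_add_neg]

lemma T_add (a b : L) : T r (a + b) = T r a + T r b := by
  simp only [T, t.add_pow]; ring

lemma T_sub (a b : L) : T r (a - b) = T r a - T r b := by
  simp only [T, t.sub_pow_r]; ring

lemma card_Lam : (Lam F r).card = r := Lam_card t.add_pow_base t.card t.two_le

lemma exists_T_base {c : F} (hc : c ^ r = c) : ∃ a, T r a = c :=
  exists_T_eq_of_pow_eq t.add_pow_base t.card t.two_le hc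

lemma T_pow_base (a : F) : (T r a) ^ r = T r a := by
  rw [T, t.add_pow_base, ← pow_mul, ← sq, ← t.card, FiniteField.pow_card, add_comm]

lemma T_prod (y : L) : ∏ a ∈ Lam F r, (y - algebraMap F L a) = T r y :=
  prod_Lam_apply t.add_pow_base t.card t.two_le y

omit [Fintype F] [Algebra (RatFunc F) L] t in
lemma T_algebraMap (a : F) : T r (algebraMap F L a) = algebraMap F L (T r a) := by
  simp [T]

omit [Fintype F] [Algebra (RatFunc F) L] t in
lemma T_algebraMap_Lam [Fintype F] {a : F} (ha : a ∈ Lam F r) : T r (algebraMap F L a) = 0 := by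
  rw [T_algebraMap, mem_Lam.1 ha, map_zero]

lemma x_ne (i : ℕ) : t.x i ≠ 0 := fun h => t.T_ne i (by rw [h, t.T_zero])

lemma T_x_succ (i : ℕ) : T r (t.x (i + 1)) = t.x i ^ (r + 1) / T r (t.x i) := by
  rw [eq_div_iff (t.T_ne i), t.rel]

/-- The factor `x ^ (r - 1) + 1` of `T r x`. -/
noncomputable def w (i : ℕ) : L := t.x i ^ (r - 1) + 1

lemma T_eq_mul_w (i : ℕ) : T r (t.x i) = t.x i * t.w i := by
  have : r = r - 1 + 1 := by have := t.two_le; omega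
  rw [w, T, mul_add, mul_one, ← pow_succ', ← this]

lemma w_ne (i : ℕ) : t.w i ≠ 0 := fun h => t.T_ne i (by rw [T_eq_mul_w, h, mul_zero])

lemma T_x_succ_w (i : ℕ) : T r (t.x (i + 1)) = t.x i ^ r / t.w i := by
  rw [t.T_x_succ, T_eq_mul_w, pow_succ, mul_comm, mul_div_mul_left _ _ (t.x_ne i)]

end Tower
end GS

set_option linter.unusedSectionVars false

namespace GS

section General

variable {L Γ : Type*} [Field L] [LinearOrderedCommGroupWithZero Γ] (v : Valuation L Γ)

lemma val_sum_distinct {ι : Type*} (s : Finset ι) (g : ι → L)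
    (h : ∀ i ∈ s, ∀ j ∈ s, i ≠ j → g i ≠ 0 → v (g i) ≠ v (g j)) :
    (∀ i ∈ s, v (g i) ≤ v (∑ j ∈ s, g j)) ∧
      (∑ j ∈ s, g j ≠ 0 → ∃ i ∈ s, g i ≠ 0 ∧ v (∑ j ∈ s, g j) = v (g i)) := by
  classical
  induction s using Finset.induction_on with
  | empty => simp
  | insert a s ha ih =>
    have ih := ih fun i hi j hj => h i (Finset.mem_insert_of_mem hi) j (Finset.mem_insert_of_mem hj)
    rw [Finset.sum_insert ha]
    set S := ∑ j ∈ s, g j with hS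
    by_cases hS0 : S = 0
    · have hz : ∀ i ∈ s, v (g i) = 0 := fun i hi => by simpa [hS0] using ih.1 i hi
      rw [hS0, add_zero]
      refine ⟨fun i hi => ?_, fun h0 => ⟨a, Finset.mem_insert_self _ _, h0, rfl⟩⟩
      rcases Finset.mem_insert.1 hi with rfl | hi
      · exact le_rfl
      · rw [hz i hi]; exact zero_le
    · obtain ⟨i, hi, hi0, hvi⟩ := ih.2 hS0
      have hne : v (g a) ≠ v S := by
        rw [hvi]
        exact (h i (Finset.mem_insert_of_mem hi) a (Finset.mem_insert_self _ _)
          (fun hh => ha (hh ▸ hi)) hi0).symm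
      rcases lt_or_gt_of_ne hne with hlt | hlt
      · rw [v.map_add_eq_of_lt_right hlt]
        refine ⟨fun j hj => ?_, fun _ => ⟨i, Finset.mem_insert_of_mem hi, hi0, hvi⟩⟩
        rcases Finset.mem_insert.1 hj with rfl | hj
        · exact hlt.le
        · exact ih.1 j hj
      · rw [v.map_add_eq_of_lt_left hlt]
        refine ⟨fun j hj => ?_, fun _ => ⟨a, Finset.mem_insert_self _ _, ?_, rfl⟩⟩
        · rcases Finset.mem_insert.1 hj with rfl | hj
          · exact le_rfl
          · exact (ih.1 j hj).trans hlt.le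
        · intro h0
          rw [h0, map_zero] at hlt
          exact absurd hlt (not_lt.2 zero_le)

lemma val_aeval_of_one_lt {F : Type*} [Field F] [Fintype F] [Algebra F L] {y : L} (hy : 1 < v y)
    {p : Polynomial F} (hp : p ≠ 0) : v (Polynomial.aeval y p) = v y ^ p.natDegree := by
  rw [Polynomial.aeval_eq_sum_range, Finset.sum_range_succ, Valuation.map_add_eq_of_lt_right]
  · rw [Algebra.smul_def, map_mul, map_pow, val_const v, one_mul]
    exact Polynomial.leadingCoeff_ne_zero.2 hp
  · have h0 : (0 : Γ) < v y := zero_lt_one.trans hy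
    rw [Algebra.smul_def, map_mul, map_pow, Polynomial.coeff_natDegree,
      val_const v (Polynomial.leadingCoeff_ne_zero.2 hp), one_mul]
    refine v.map_sum_lt (pow_pos h0 _).ne' fun i hi => ?_
    rw [Algebra.smul_def, map_mul, map_pow]
    calc _ ≤ 1 * v y ^ i := mul_le_mul_left (val_const_le v _) _
      _ < _ := by
        rw [one_mul]
        exact pow_lt_pow_right₀ hy (Finset.mem_range.1 hi)

open Polynomial in
/-- Every element of a simple extension generated by a root of `T r y = c` is a polynomial of degree
less than `r` in the generator. -/
lemma exists_coeffs_of_T {K₀ : Type*} [Field K₀] [Algebra K₀ L] (E : IntermediateField K₀ L) {r : ℕ}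
    (hr : 2 ≤ r) {y : L} (hy : T r y ∈ E) {f : L} (hf : f ∈ IntermediateField.adjoin E {y}) :
    ∃ p : ℕ → L, (∀ e, p e ∈ E) ∧ f = ∑ e ∈ Finset.range r, p e * y ^ e := by
  set P : E[X] := X ^ r + X - C ⟨_, hy⟩ with hP
  have hd : P.natDegree = r := by
    rw [hP]
    compute_degree!
    · simp [show r ≠ 0 by omega, show 1 ≠ r by omega]
    · omega
  have hm : P.Monic := by
    rw [Monic, leadingCoeff, hd]
    simp [hP, coeff_X, coeff_C, show r ≠ 0 by omega, show 1 ≠ r by omega]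
  have hroot : aeval y P = 0 := by
    simp only [hP, map_sub, map_add, map_pow, aeval_X, aeval_C]
    exact sub_self _
  have halg : IsAlgebraic E y := ⟨P, hm.ne_zero, hroot⟩
  rw [← IntermediateField.mem_toSubalgebra,
    IntermediateField.adjoin_simple_toSubalgebra_of_isAlgebraic halg,
    Algebra.adjoin_singleton_eq_range_aeval] at hf
  obtain ⟨g, hg⟩ := hf
  have hg2 : aeval y (g %ₘ P) = f := by
    rw [← hg]
    conv_rhs => rw [← modByMonic_add_div g P]
    simp [hroot]
  have hdeg : (g %ₘ P).natDegree < r := by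
    have := natDegree_modByMonic_lt g hm (fun h => by rw [h] at hd; simp at hd; omega)
    omega
  refine ⟨fun e => (g %ₘ P).coeff e, fun e => Subtype.mem _, ?_⟩
  rw [← hg2, aeval_eq_sum_range' hdeg]
  rfl

end General

namespace Tower

variable {F L : Type*} [Field F] [Fintype F] [Field L] [Algebra F L] [Algebra (RatFunc F) L]
  {r : ℕ} (t : Tower F L r)

/-- The fields of the tower. -/
noncomputable def K : ℕ → IntermediateField (RatFunc F) L
  | 0 => ⊥
  | k + 1 => (IntermediateField.adjoin (K k) {t.x (k + 1)}).restrictScalars (RatFunc F)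

lemma mem_K_succ {k : ℕ} {f : L} :
    f ∈ t.K (k + 1) ↔ f ∈ IntermediateField.adjoin (t.K k) {t.x (k + 1)} := Iff.rfl

lemma K_le_succ (k : ℕ) : t.K k ≤ t.K (k + 1) := fun f hf =>
  (IntermediateField.adjoin (t.K k) {t.x (k + 1)}).algebraMap_mem ⟨f, hf⟩

lemma K_mono {i k : ℕ} (h : i ≤ k) : t.K i ≤ t.K k := monotone_nat_of_le_succ t.K_le_succ h

lemma x_mem_self (k : ℕ) : t.x k ∈ t.K k := by
  cases k with
  | zero => rw [t.x_zero]; exact IntermediateField.algebraMap_mem _ _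
  | succ k => exact t.mem_K_succ.2 (IntermediateField.mem_adjoin_simple_self _ _)

lemma x_mem {i k : ℕ} (h : i ≤ k) : t.x i ∈ t.K k := t.K_mono h (t.x_mem_self i)

lemma T_mem {k : ℕ} {y : L} (hy : y ∈ t.K k) : T r y ∈ t.K k :=
  add_mem (pow_mem hy _) hy

lemma T_x_succ_mem (k : ℕ) : T r (t.x (k + 1)) ∈ t.K k := by
  rw [t.T_x_succ]
  exact div_mem (pow_mem (t.x_mem_self k) _) (t.T_mem (t.x_mem_self k))

variable [IsScalarTower F (RatFunc F) L]

lemma const_mem_K (k : ℕ) (c : F) : algebraMap F L c ∈ t.K k := by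
  rw [IsScalarTower.algebraMap_apply F (RatFunc F) L]
  exact IntermediateField.algebraMap_mem _ _

lemma algebraMap_poly (p : Polynomial F) :
    algebraMap (RatFunc F) L (algebraMap (Polynomial F) (RatFunc F) p) =
      Polynomial.aeval (t.x 0) p := by
  rw [t.x_zero, Polynomial.aeval_algebraMap_apply, ← RatFunc.algebraMap_X,
    Polynomial.aeval_algebraMap_apply, Polynomial.aeval_X_left_apply]

lemma aeval_mem_K (k : ℕ) (p : Polynomial F) {y : L} (hy : y ∈ t.K k) :
    Polynomial.aeval y p ∈ t.K k := by
  rw [Polynomial.aeval_eq_sum_range]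
  refine sum_mem fun i _ => ?_
  rw [Algebra.smul_def]
  exact mul_mem (t.const_mem_K k _) (pow_mem hy _)

lemma aeval_x_zero_ne {p : Polynomial F} (hp : p ≠ 0) : Polynomial.aeval (t.x 0) p ≠ 0 := by
  rw [← algebraMap_poly, Ne, FaithfulSMul.algebraMap_eq_zero_iff,
    FaithfulSMul.algebraMap_eq_zero_iff]
  exact hp

lemma K_zero_repr {f : L} (hf : f ∈ t.K 0) : ∃ p q : Polynomial F, q ≠ 0 ∧ IsCoprime p q ∧
    f = Polynomial.aeval (t.x 0) p / Polynomial.aeval (t.x 0) q := by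
  obtain ⟨g, rfl⟩ := IntermediateField.mem_bot.1 hf
  refine ⟨g.num, g.denom, g.denom_ne_zero, g.isCoprime_num_denom, ?_⟩
  rw [← algebraMap_poly, ← algebraMap_poly, ← map_div₀, RatFunc.num_div_denom]

lemma exists_coeffs {k : ℕ} {z : L} (hz : t.x (k + 1) - z ∈ t.K k) {f : L}
    (hf : f ∈ t.K (k + 1)) :
    ∃ p : ℕ → L, (∀ e, p e ∈ t.K k) ∧ f = ∑ e ∈ Finset.range r, p e * z ^ e := by
  have hTz : T r z ∈ t.K k := by
    have : z = t.x (k + 1) - (t.x (k + 1) - z) := by ring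
    rw [this, t.T_sub]
    exact sub_mem (t.T_x_succ_mem k) (t.T_mem hz)
  refine exists_coeffs_of_T (t.K k) t.two_le hTz ?_
  have h1 : IntermediateField.adjoin (t.K k) {t.x (k + 1)} ≤ IntermediateField.adjoin (t.K k) {z} := by
    rw [IntermediateField.adjoin_simple_le_iff]
    have h2 := (IntermediateField.adjoin (t.K k) {z}).algebraMap_mem ⟨_, hz⟩
    have h3 := add_mem h2 (IntermediateField.mem_adjoin_simple_self (t.K k) z)
    change t.x (k + 1) - z + z ∈ _ at h3
    rwa [sub_add_cancel] at h3
  exact h1 (t.mem_K_succ.1 hf)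

section Infinity

variable {Γ : Type*} [LinearOrderedCommGroupWithZero Γ] {v : Valuation L Γ} (hv : 1 < v (t.x 0))
include hv

lemma inf_step (k : ℕ) : 1 < v (t.x k) ∧ v (t.x k) = v (t.x (k + 1)) ^ r := by
  have hr := t.two_le
  have key : ∀ k, 1 < v (t.x k) → 1 < v (t.x (k + 1)) ∧ v (t.x k) = v (t.x (k + 1)) ^ r := by
    intro k hk
    have h1 := congrArg v (t.rel k)
    rw [map_mul, val_T_of_one_lt v hr hk, map_pow, pow_succ', mul_left_inj'
      (pow_ne_zero _ (zero_lt_one.trans hk).ne')] at h1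
    have h2 : 1 < v (t.x (k + 1)) := by
      by_contra! h
      exact absurd hk (not_lt.2 (h1 ▸ val_T_le v h))
    rw [val_T_of_one_lt v hr h2] at h1
    exact ⟨h2, h1.symm⟩
  have h : 1 < v (t.x k) := by
    induction k with
    | zero => exact hv
    | succ k ih => exact (key k ih).1
  exact ⟨h, (key k h).2⟩

lemma inf_one_lt (k : ℕ) : 1 < v (t.x k) := (t.inf_step hv k).1

lemma inf_succ (k : ℕ) : v (t.x k) = v (t.x (k + 1)) ^ r := (t.inf_step hv k).2

lemma inf_pos (k : ℕ) : 0 < v (t.x k) := zero_lt_one.trans (t.inf_one_lt hv k)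

lemma inf_zpow_inj (k : ℕ) {m n : ℤ} : v (t.x k) ^ m = v (t.x k) ^ n ↔ m = n :=
  zpow_right_inj₀ (t.inf_pos hv k) (t.inf_one_lt hv k).ne'

lemma inf_terms {k : ℕ} (H : ∀ f ∈ t.K k, f ≠ 0 → ∃ n : ℤ, v f = v (t.x k) ^ n)
    {p : ℕ → L} (hp : ∀ e, p e ∈ t.K k) :
    (∀ e < r, v (p e * t.x (k + 1) ^ e) ≤ v (∑ e ∈ Finset.range r, p e * t.x (k + 1) ^ e)) ∧
      (∑ e ∈ Finset.range r, p e * t.x (k + 1) ^ e ≠ 0 → ∃ e < r, p e ≠ 0 ∧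
        v (∑ e ∈ Finset.range r, p e * t.x (k + 1) ^ e) = v (p e * t.x (k + 1) ^ e)) := by
  have hval : ∀ e, p e ≠ 0 → ∃ n : ℤ, v (p e * t.x (k + 1) ^ e) = v (t.x (k + 1)) ^ (r * n + e) := by
    intro e he
    obtain ⟨n, hn⟩ := H _ (hp e) he
    refine ⟨n, ?_⟩
    rw [map_mul, hn, t.inf_succ hv k, map_pow, zpow_add₀ (t.inf_pos hv _).ne', zpow_mul,
      zpow_natCast, zpow_natCast]
  have h := val_sum_distinct v (Finset.range r) (fun e => p e * t.x (k + 1) ^ e) (by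
    intro i hi j hj hij hi0 hEq
    rw [Finset.mem_range] at hi hj
    have hpi : p i ≠ 0 := left_ne_zero_of_mul hi0
    have hpj : p j ≠ 0 := by
      intro h0
      simp only [h0, zero_mul, map_zero] at hEq
      exact hi0 ((Valuation.zero_iff v).1 hEq)
    obtain ⟨n, hn⟩ := hval i hpi
    obtain ⟨m, hm⟩ := hval j hpj
    rw [hn, hm, t.inf_zpow_inj hv] at hEq
    apply hij
    have h1 : ((r : ℤ) * n + i) % r = i := by
      rw [Int.mul_add_emod_self_left]; exact Int.emod_eq_of_lt (by omega) (by omega)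
    have h2 : ((r : ℤ) * m + j) % r = j := by
      rw [Int.mul_add_emod_self_left]; exact Int.emod_eq_of_lt (by omega) (by omega)
    rw [hEq, h2] at h1
    exact_mod_cast h1.symm)
  refine ⟨fun e he => h.1 e (Finset.mem_range.2 he), fun h0 => ?_⟩
  obtain ⟨e, he, he0, hh⟩ := h.2 h0
  exact ⟨e, Finset.mem_range.1 he, left_ne_zero_of_mul he0, hh⟩

lemma inf_value (k : ℕ) : ∀ f ∈ t.K k, f ≠ 0 → ∃ n : ℤ, v f = v (t.x k) ^ n := by
  induction k with
  | zero =>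
    intro f hf hf0
    obtain ⟨p, q, hq, -, rfl⟩ := t.K_zero_repr hf
    have hp : p ≠ 0 := by rintro rfl; simp at hf0
    refine ⟨p.natDegree - q.natDegree, ?_⟩
    rw [map_div₀, val_aeval_of_one_lt v hv hp, val_aeval_of_one_lt v hv hq,
      zpow_sub₀ (t.inf_pos hv 0).ne', zpow_natCast, zpow_natCast]
  | succ k ih =>
    intro f hf hf0
    obtain ⟨p, hp, rfl⟩ := t.exists_coeffs (by rw [sub_self]; exact zero_mem _) hf
    obtain ⟨e, -, he0, he⟩ := (t.inf_terms hv ih hp).2 hf0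
    obtain ⟨n, hn⟩ := ih _ (hp e) he0
    refine ⟨r * n + e, ?_⟩
    rw [he, map_mul, hn, t.inf_succ hv k, map_pow, zpow_add₀ (t.inf_pos hv _).ne', zpow_mul,
      zpow_natCast, zpow_natCast]

lemma inf_coeff_le {k : ℕ} {p : ℕ → L} (hp : ∀ e, p e ∈ t.K k) {e : ℕ} (he : e < r) :
    v (p e) * v (t.x (k + 1)) ^ e ≤ v (∑ e ∈ Finset.range r, p e * t.x (k + 1) ^ e) := by
  rw [← map_pow, ← map_mul]
  exact (t.inf_terms hv (t.inf_value hv k) hp).1 e he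

lemma coeff_eq_zero {k : ℕ} {p : ℕ → L} (hp : ∀ e, p e ∈ t.K k)
    (h : ∑ e ∈ Finset.range r, p e * t.x (k + 1) ^ e = 0) {e : ℕ} (he : e < r) : p e = 0 := by
  have := t.inf_coeff_le hv hp he
  rw [h, map_zero] at this
  have h2 := le_antisymm this zero_le
  rcases mul_eq_zero.1 h2 with h3 | h3
  · exact (Valuation.zero_iff v).1 h3
  · exact absurd h3 (pow_ne_zero _ (t.inf_pos hv _).ne')

/-- An element of a field of the tower that is finite at infinity has a residue in `F`. -/
lemma inf_residue (k : ℕ) : ∀ f ∈ t.K k, v f ≤ 1 → ∃ c : F, v (f - algebraMap F L c) < 1 := by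
  induction k with
  | zero =>
    intro f hf hf1
    obtain ⟨p, q, hq, -, rfl⟩ := t.K_zero_repr hf
    have hQ := t.aeval_x_zero_ne hq
    have hvq := val_aeval_of_one_lt v hv hq
    rw [map_div₀, div_le_one₀ ((Valuation.pos_iff v).2 hQ)] at hf1
    refine ⟨p.coeff q.natDegree / q.leadingCoeff, ?_⟩
    set c := p.coeff q.natDegree / q.leadingCoeff
    have hsub : Polynomial.aeval (t.x 0) p / Polynomial.aeval (t.x 0) q - algebraMap F L c =
        Polynomial.aeval (t.x 0) (p - Polynomial.C c * q) / Polynomial.aeval (t.x 0) q := by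
      rw [map_sub, map_mul, Polynomial.aeval_C]
      field_simp
    rw [hsub, map_div₀, div_lt_one₀ ((Valuation.pos_iff v).2 hQ)]
    by_cases h0 : p - Polynomial.C c * q = 0
    · rw [h0, map_zero, map_zero]; exact (Valuation.pos_iff v).2 hQ
    have hpd : p.natDegree ≤ q.natDegree := by
      by_cases hp : p = 0
      · simp [hp]
      rw [val_aeval_of_one_lt v hv hp, hvq] at hf1
      exact (pow_le_pow_iff_right₀ hv).1 hf1
    rw [hvq, val_aeval_of_one_lt v hv h0]
    refine pow_lt_pow_right₀ hv ?_
    refine lt_of_le_of_ne ?_ ?_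
    · refine (Polynomial.natDegree_sub_le _ _).trans (max_le hpd (Polynomial.natDegree_C_mul_le _ _))
    · intro hd
      apply h0
      rw [← Polynomial.leadingCoeff_eq_zero, Polynomial.leadingCoeff, hd, Polynomial.coeff_sub,
        Polynomial.coeff_C_mul, sub_eq_zero]
      rw [Polynomial.coeff_natDegree, div_mul_cancel₀ _ (Polynomial.leadingCoeff_ne_zero.2 hq)]
  | succ k ih =>
    intro f hf hf1
    obtain ⟨p, hp, rfl⟩ := t.exists_coeffs (by rw [sub_self]; exact zero_mem _) hf
    have hr := t.two_le
    have hle : ∀ e < r, v (p e) * v (t.x (k + 1)) ^ e ≤ 1 := fun e he =>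
      (t.inf_coeff_le hv hp he).trans hf1
    have h0 : v (p 0) ≤ 1 := by simpa using hle 0 (by omega)
    obtain ⟨c, hc⟩ := ih _ (hp 0) h0
    refine ⟨c, ?_⟩
    rw [Finset.sum_range_eq_add_Ico _ (by omega : 0 < r), pow_zero, mul_one, add_sub_right_comm]
    refine v.map_add_lt hc (v.map_sum_lt one_ne_zero fun e he => ?_)
    rw [Finset.mem_Ico] at he
    by_cases hpe : p e = 0
    · simp [hpe]
    refine lt_of_le_of_ne (by rw [map_mul, map_pow]; exact hle e he.2) ?_
    obtain ⟨n, hn⟩ := t.inf_value hv k _ (hp e) hpe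
    rw [map_mul, hn, t.inf_succ hv k, map_pow, ← zpow_natCast (v (t.x (k + 1))) r, ← zpow_mul,
      ← zpow_natCast (v (t.x (k + 1))) e, ← zpow_add₀ (t.inf_pos hv _).ne',
      ← zpow_zero (v (t.x (k + 1))), Ne, t.inf_zpow_inj hv]
    intro h
    have h1 : ((r : ℤ) * n + e) % r = e := by
      rw [Int.mul_add_emod_self_left]; exact Int.emod_eq_of_lt (by omega) (by omega)
    rw [h] at h1
    simp at h1
    omega

end Infinity

end Tower

section General

variable {F L : Type*} [Field F] [Fintype F] [Field L] [Algebra F L]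

lemma exists_valuation_lt_one {y : L} (hy : Transcendental F y) :
    ∃ V : ValuationSubring L, V.valuation y < 1 := by
  let φ : Polynomial F →+* L := (Polynomial.aeval y : Polynomial F →ₐ[F] L).toRingHom
  let I : Ideal φ.range := Ideal.span {⟨y, Polynomial.X, by simp [φ]⟩}
  have hI : I ≠ ⊤ := by
    rw [Ne, Ideal.span_singleton_eq_top]
    rintro ⟨u, hu⟩
    obtain ⟨p, hp⟩ := (u⁻¹).1.2
    have h1 := congrArg Subtype.val u.mul_inv
    rw [hu] at h1
    simp only [Subring.coe_mul, Subring.coe_one, ← hp] at h1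
    have h2 : Polynomial.aeval y (Polynomial.X * p - 1 : Polynomial F) = 0 := by
      rw [map_sub, map_mul, Polynomial.aeval_X, map_one, sub_eq_zero]; exact h1
    have h3 : (Polynomial.X * p - 1 : Polynomial F) = 0 := by
      by_contra h
      exact hy ⟨_, h, h2⟩
    have := congrArg (Polynomial.eval 0) h3
    simp at this
  obtain ⟨V, -, hV⟩ := Ideal.image_subset_nonunits_valuationSubring I hI
  refine ⟨V, ?_⟩
  have : y ∈ V.nonunits := hV ⟨⟨y, Polynomial.X, by simp [φ]⟩, Ideal.subset_span rfl, rfl⟩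
  exact V.mem_nonunits_iff.1 this

/-- The Lagrange weights that extract the coefficient of degree `d`. -/
noncomputable def lw (F : Type*) [Field F] [Fintype F] (r d : ℕ) (a : F) : F := by
  classical
  exact (Lagrange.basis (Lam F r) id a).coeff d

lemma sum_lw {r : ℕ} (hc : (Lam F r).card = r) (d : ℕ) {i : ℕ} (hi : i < r) :
    ∑ a ∈ Lam F r, lw F r d a * a ^ i = if d = i then 1 else 0 := by
  classical
  have h := Lagrange.eq_interpolate (s := Lam F r) (v := id) (f := Polynomial.X ^ i)
    (fun _ _ _ _ h => h) (by rw [Polynomial.degree_X_pow, hc]; exact_mod_cast hi)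
  have h2 := congrArg (fun p => Polynomial.coeff p d) h
  simp only [Lagrange.interpolate_apply, Polynomial.finsetSum_coeff, Polynomial.coeff_C_mul,
    Polynomial.coeff_X_pow, Polynomial.eval_pow, Polynomial.eval_X] at h2
  rw [h2]
  exact Finset.sum_congr rfl fun a _ => by rw [lw, mul_comm]; rfl

lemma sum_lw_add_pow {r : ℕ} (hc : (Lam F r).card = r) (d : ℕ) {i : ℕ} (hi : i < r) (z : L) :
    ∑ a ∈ Lam F r, algebraMap F L (lw F r d a) * (z + algebraMap F L a) ^ i =
      i.choose d * z ^ (i - d) := by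
  simp only [add_comm z, add_pow, Finset.mul_sum]
  rw [Finset.sum_comm]
  calc _ = ∑ j ∈ Finset.range (i + 1), (if d = j then (1 : L) else 0) * (z ^ (i - j) * i.choose j) := by
        refine Finset.sum_congr rfl fun j hj => ?_
        rw [Finset.mem_range] at hj
        have := congrArg (algebraMap F L) (sum_lw (F := F) hc d (i := j) (by omega))
        rw [map_sum] at this
        rw [show (if d = j then (1 : L) else 0) = algebraMap F L (if d = j then 1 else 0) by
          split_ifs <;> simp, ← this, Finset.sum_mul]
        refine Finset.sum_congr rfl fun a _ => ?_
        rw [map_mul, map_pow]; ring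
    _ = _ := by
        by_cases hd : d ≤ i
        · rw [Finset.sum_eq_single d]
          · simp; ring
          · intro j _ hj; rw [if_neg (Ne.symm hj), zero_mul]
          · intro h; exact absurd (Finset.mem_range.2 (by omega)) h
        · rw [Nat.choose_eq_zero_of_lt (by omega), Nat.cast_zero, zero_mul]
          refine Finset.sum_eq_zero fun j hj => ?_
          rw [Finset.mem_range] at hj
          rw [if_neg (by omega), zero_mul]

/-- Extraction of coefficients from conjugates. -/
lemma sum_lw_conj {r : ℕ} (hc : (Lam F r).card = r) (d : ℕ) (p : ℕ → L) (z : L)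
    (g : F → L)
    (hg : ∀ a ∈ Lam F r, g a = ∑ i ∈ Finset.range r, p i * (z + algebraMap F L a) ^ i) :
    ∑ a ∈ Lam F r, algebraMap F L (lw F r d a) * g a =
      ∑ i ∈ Finset.range r, i.choose d * p i * z ^ (i - d) := by
  calc _ = ∑ i ∈ Finset.range r, p i *
      ∑ a ∈ Lam F r, algebraMap F L (lw F r d a) * (z + algebraMap F L a) ^ i := by
        simp only [Finset.mul_sum]
        rw [Finset.sum_comm]
        refine Finset.sum_congr rfl fun a ha => ?_
        rw [hg a ha, Finset.mul_sum]
        exact Finset.sum_congr rfl fun i _ => by ring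
    _ = _ := Finset.sum_congr rfl fun i hi => by
        rw [sum_lw_add_pow hc d (Finset.mem_range.1 hi)]; ring

/-- Bounding the coefficients of a polynomial in `z` by the values of its conjugates. -/
lemma coeff_le_of_conj {Γ : Type*} [LinearOrderedCommGroupWithZero Γ] (v : Valuation L Γ) {r : ℕ}
    (hc : (Lam F r).card = r) {γ Z : Γ} (p : ℕ → L) (z : L) (hZ1 : 1 ≤ Z) (hZ : v z ≤ Z)
    (hg : ∀ a ∈ Lam F r, v (∑ i ∈ Finset.range r, p i * (z + algebraMap F L a) ^ i) ≤ γ) :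
    ∀ e < r, v (p e) ≤ γ * Z ^ (r * r) := by
  have key : ∀ n e, e + n + 1 = r → v (p e) ≤ γ * Z ^ (r * n) := by
    intro n
    induction n using Nat.strong_induction_on with
    | _ n ih =>
    intro e he
    have h := sum_lw_conj hc e p z (fun a => ∑ i ∈ Finset.range r, p i * (z + algebraMap F L a) ^ i)
      (fun a _ => rfl)
    have hsplit : ∑ i ∈ Finset.range r, (i.choose e : L) * p i * z ^ (i - e) =
        p e + ∑ i ∈ Finset.Ico (e + 1) r, (i.choose e : L) * p i * z ^ (i - e) := by
      rw [← Finset.sum_range_add_sum_Ico _ (show e + 1 ≤ r by omega), Finset.sum_range_succ,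
        Finset.sum_eq_zero]
      · simp
      · intro i hi
        rw [Finset.mem_range] at hi
        rw [Nat.choose_eq_zero_of_lt hi]; simp
    rw [hsplit] at h
    have hpe : p e = ∑ a ∈ Lam F r, algebraMap F L (lw F r e a) *
        (∑ i ∈ Finset.range r, p i * (z + algebraMap F L a) ^ i) -
        ∑ i ∈ Finset.Ico (e + 1) r, (i.choose e : L) * p i * z ^ (i - e) := by
      rw [h]; ring
    have hγ : γ ≤ γ * Z ^ (r * n) := le_mul_of_one_le_right zero_le (one_le_pow₀ hZ1)
    rw [hpe]
    refine (v.map_sub _ _).trans (max_le ?_ ?_)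
    · refine v.map_sum_le fun a ha => ?_
      rw [map_mul]
      calc _ ≤ 1 * γ := mul_le_mul' (val_const_le v _) (hg a ha)
        _ ≤ _ := by rw [one_mul]; exact hγ
    · refine v.map_sum_le fun i hi => ?_
      rw [Finset.mem_Ico] at hi
      have h1 := ih (r - i - 1) (by omega) i (by omega)
      have hnat : v ((i.choose e : ℕ) : L) ≤ 1 := by
        rw [← map_natCast (algebraMap F L)]; exact val_const_le v _
      rw [map_mul, map_mul, map_pow]
      calc _ ≤ 1 * (γ * Z ^ (r * (r - i - 1))) * Z ^ (i - e) :=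
            mul_le_mul' (mul_le_mul' hnat h1) (pow_le_pow_left₀ zero_le hZ _)
        _ = γ * Z ^ (r * (r - i - 1) + (i - e)) := by rw [one_mul, mul_assoc, pow_add]
        _ ≤ _ := by
          refine mul_le_mul_right (pow_le_pow_right₀ hZ1 ?_) _
          have : n = (r - i - 1) + (i - e) := by omega
          rw [this, mul_add]
          have : i - e ≤ r * (i - e) := Nat.le_mul_of_pos_left _ (by omega)
          omega
  intro e he
  refine (key (r - e - 1) e (by omega)).trans ?_
  exact mul_le_mul_right (pow_le_pow_right₀ hZ1 (Nat.mul_le_mul_left _ (by omega))) _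

end General

namespace Tower

variable {F L : Type*} [Field F] [Fintype F] [Field L] [Algebra F L] [Algebra (RatFunc F) L]
  [IsScalarTower F (RatFunc F) L] {r : ℕ} (t : Tower F L r)
include t

lemma transcendental_x_zero : Transcendental F (t.x 0) := by
  rintro ⟨p, hp, h⟩
  exact t.aeval_x_zero_ne hp h

lemma exists_inf : ∃ V : ValuationSubring L, 1 < V.valuation (t.x 0) := by
  obtain ⟨V, hV⟩ := exists_valuation_lt_one (F := F) (y := (t.x 0)⁻¹) (fun h => by
    have := h.inv
    rw [inv_inv] at this
    exact t.transcendental_x_zero this)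
  refine ⟨V, ?_⟩
  rwa [map_inv₀, inv_lt_one₀ ((Valuation.pos_iff _).2 (t.x_ne 0))] at hV

lemma exists_val_sub (a : F) : ∃ V : ValuationSubring L, V.valuation (t.x 0 - algebraMap F L a) < 1 :=
  exists_valuation_lt_one (F := F) fun h => by
    have := h.add (isAlgebraic_algebraMap a)
    rw [sub_add_cancel] at this
    exact t.transcendental_x_zero this

variable [IsAlgClosed L] [Algebra.IsAlgebraic (RatFunc F) L]

open Polynomial in
lemma exists_aut (k : ℕ) {a : F} (ha : a ∈ Lam F r) : ∃ σ : L ≃+* L, (∀ f ∈ t.K k, σ f = f) ∧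
    σ (t.x (k + 1)) = t.x (k + 1) + algebraMap F L a := by
  have hr := t.two_le
  set y := t.x (k + 1) with hy
  set P : (t.K k)[X] := X ^ r + X - C ⟨_, t.T_x_succ_mem k⟩ with hP
  have hd : P.natDegree = r := by
    rw [hP]
    compute_degree!
    · simp [show r ≠ 0 by omega, show 1 ≠ r by omega]
    · omega
  have hm : P.Monic := by
    rw [Monic, leadingCoeff, hd]
    simp [hP, coeff_X, coeff_C, show r ≠ 0 by omega, show 1 ≠ r by omega]
  have hev : ∀ z, aeval z P = T r z - T r y := fun z => by
    simp only [hP, map_sub, map_add, map_pow, aeval_X, aeval_C]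
    rfl
  have hroot : aeval y P = 0 := by rw [hev, sub_self]
  have hreg : IsIntegral (t.K k) y := ⟨P, hm, hroot⟩
  have hmin : minpoly (t.K k) y = P := by
    refine (Polynomial.eq_of_monic_of_dvd_of_natDegree_le (minpoly.monic hreg) hm
      (minpoly.dvd _ _ hroot) ?_).symm
    by_contra! hlt
    rw [hd] at hlt
    obtain ⟨V, hV⟩ := t.exists_inf
    have h0 := minpoly.aeval (t.K k) y
    rw [aeval_eq_sum_range' hlt] at h0
    have h1 := t.coeff_eq_zero hV (k := k) (p := fun e => ((minpoly (t.K k) y).coeff e : L))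
      (fun e => Subtype.mem _) h0 hlt
    have h2 := minpoly.monic hreg
    rw [Monic, leadingCoeff] at h2
    simp [h2] at h1
  have hconj : IsConjRoot (t.K k) y (y + algebraMap F L a) := by
    rw [isConjRoot_iff_aeval_eq_zero hreg, hmin, hev, t.T_add, T_algebraMap_Lam ha, add_zero,
      sub_self]
  have : Algebra.IsAlgebraic (t.K k) L := Algebra.IsAlgebraic.tower_top (K := RatFunc F) (t.K k)
  have : IsAlgClosure (t.K k) L := ⟨inferInstance, inferInstance⟩
  have : Normal (t.K k) L := IsAlgClosure.normal _ _
  obtain ⟨σ, hσ⟩ := isConjRoot_iff_exists_algEquiv.1 hconj.symm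
  exact ⟨σ.toRingEquiv, fun f hf => σ.commutes ⟨f, hf⟩, hσ⟩

lemma aut_sum {k : ℕ} {a : F} {σ : L ≃+* L} (h1 : ∀ f ∈ t.K k, σ f = f)
    (h2 : σ (t.x (k + 1)) = t.x (k + 1) + algebraMap F L a) {p : ℕ → L} (hp : ∀ e, p e ∈ t.K k)
    {z : L} (hz : t.x (k + 1) - z ∈ t.K k) :
    σ (∑ e ∈ Finset.range r, p e * z ^ e) =
      ∑ e ∈ Finset.range r, p e * (z + algebraMap F L a) ^ e := by
  have hσz : σ z = z + algebraMap F L a := by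
    have := h1 _ hz
    rw [map_sub, h2] at this
    rw [sub_eq_iff_eq_add] at this
    linear_combination -this
  rw [map_sum]
  refine Finset.sum_congr rfl fun e _ => ?_
  rw [map_mul, map_pow, hσz, h1 _ (hp e)]

end Tower

section General

variable {L : Type*} [Field L]

lemma val_le_iff_div_mem (V : ValuationSubring L) {a b : L} (hb : b ≠ 0) :
    V.valuation a ≤ V.valuation b ↔ a / b ∈ V := by
  rw [← V.valuation_le_one_iff, map_div₀, div_le_one₀ ((Valuation.pos_iff _).2 hb)]

/-- The pullback of a valuation ring along an automorphism. -/
def pull (σ : L ≃+* L) (V : ValuationSubring L) : ValuationSubring L := V.comap (σ : L →+* L)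

lemma mem_pull {σ : L ≃+* L} {V : ValuationSubring L} {a : L} : a ∈ pull σ V ↔ σ a ∈ V := Iff.rfl

lemma pull_le_iff {σ : L ≃+* L} {V : ValuationSubring L} {a b : L} :
    (pull σ V).valuation a ≤ (pull σ V).valuation b ↔
      V.valuation (σ a) ≤ V.valuation (σ b) := by
  by_cases hb : b = 0
  · simp [hb]
  · rw [val_le_iff_div_mem _ hb, val_le_iff_div_mem _ ((map_ne_zero σ).2 hb), mem_pull, map_div₀]

lemma pull_lt_iff {σ : L ≃+* L} {V : ValuationSubring L} {a b : L} :
    (pull σ V).valuation a < (pull σ V).valuation b ↔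
      V.valuation (σ a) < V.valuation (σ b) := by
  rw [← not_le, pull_le_iff, not_le]

lemma pull_lt_one_iff {σ : L ≃+* L} {V : ValuationSubring L} {a : L} :
    (pull σ V).valuation a < 1 ↔ V.valuation (σ a) < 1 := by
  have := pull_lt_iff (σ := σ) (V := V) (a := a) (b := 1)
  simpa using this

end General

namespace Tower

variable {F L : Type*} [Field F] [Fintype F] [Field L] [Algebra F L] [Algebra (RatFunc F) L]
  {r : ℕ} (t : Tower F L r)

/-- Valuation rings that contain `x 0`. -/
def Pos : Set (ValuationSubring L) := {V | t.x 0 ∈ V}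

/-- Valuation rings above a ramified zero of type `j`. -/
def Ty (j : ℕ) : Set (ValuationSubring L) :=
  {V | (∀ i < j, V.valuation (t.x i) < 1) ∧ V.valuation (t.w j) < 1}

/-- Valuation rings above the common zero of `x 0, …, x i`. -/
def Zs (i : ℕ) : Set (ValuationSubring L) := {V | ∀ l ≤ i, V.valuation (t.x l) < 1}

/-- The automorphism fixes the `k`-th field of the tower pointwise. -/
def Fixes (k : ℕ) (σ : L ≃+* L) : Prop := ∀ f ∈ t.K k, σ f = f

/-- Stability of a family of valuation rings under automorphisms over the `k`-th field. -/
def Stable (k : ℕ) (S : Set (ValuationSubring L)) : Prop :=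
  ∀ σ, t.Fixes k σ → ∀ V ∈ S, pull σ V ∈ S

variable {t}

lemma w_mem {i k : ℕ} (h : i ≤ k) : t.w i ∈ t.K k := add_mem (pow_mem (t.x_mem h) _) (one_mem _)

lemma stable_Pos (k : ℕ) : t.Stable k t.Pos := fun σ hσ V hV => by
  change t.x 0 ∈ V at hV
  change σ (t.x 0) ∈ V
  rwa [hσ _ (t.x_mem (Nat.zero_le k))]

lemma stable_Ty {j k : ℕ} (h : j ≤ k) : t.Stable k (t.Ty j) := fun σ hσ V hV => by
  refine ⟨fun i hi => ?_, ?_⟩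
  · rw [pull_lt_one_iff, hσ _ (t.x_mem (by omega))]; exact hV.1 i hi
  · rw [pull_lt_one_iff, hσ _ (w_mem h)]; exact hV.2

lemma stable_Zs {i k : ℕ} (h : i ≤ k) : t.Stable k (t.Zs i) := fun σ hσ V hV l hl => by
  rw [pull_lt_one_iff, hσ _ (t.x_mem (by omega))]; exact hV l hl

section Values

variable {V : ValuationSubring L}

lemma mem_Pos_iff : V ∈ t.Pos ↔ V.valuation (t.x 0) ≤ 1 := (V.valuation_le_one_iff _).symm

lemma w_le_one {i : ℕ} (h : V.valuation (t.x i) ≤ 1) : V.valuation (t.w i) ≤ 1 := by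
  refine (V.valuation.map_add _ _).trans (max_le ?_ (by simp))
  rw [map_pow]; exact pow_le_one' h _

lemma x_eq_one_of_w {i : ℕ} (h : V.valuation (t.w i) < 1) : V.valuation (t.x i) = 1 := by
  have hr := t.two_le
  have h1 : V.valuation (t.x i ^ (r - 1)) = V.valuation 1 := by
    have : t.x i ^ (r - 1) = -1 + t.w i := by rw [w]; ring
    rw [this, Valuation.map_add_eq_of_lt_left, Valuation.map_neg]
    rw [Valuation.map_neg, map_one]; exact h
  rw [map_one, map_pow] at h1
  exact (pow_eq_one_iff_left (by omega)).1 h1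

lemma val_T_eq (i : ℕ) : V.valuation (T r (t.x i)) = V.valuation (t.x i) * V.valuation (t.w i) := by
  rw [t.T_eq_mul_w, map_mul]

lemma val_rel (i : ℕ) : V.valuation (T r (t.x (i + 1))) * V.valuation (T r (t.x i)) =
    V.valuation (t.x i) ^ (r + 1) := by
  rw [← map_mul, t.rel, map_pow]

lemma val_x_pos (i : ℕ) : 0 < V.valuation (t.x i) := (Valuation.pos_iff _).2 (t.x_ne i)

lemma val_T_pos (i : ℕ) : 0 < V.valuation (T r (t.x i)) := (Valuation.pos_iff _).2 (t.T_ne i)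

lemma val_T_succ_of_lt_one {i : ℕ} (h : V.valuation (t.x i) < 1) :
    V.valuation (T r (t.x (i + 1))) = V.valuation (t.x i) ^ r := by
  have h1 := t.val_rel (V := V) i
  rw [val_T_of_lt_one _ t.two_le h, pow_succ] at h1
  exact mul_right_cancel₀ (t.val_x_pos i).ne' h1

lemma x_zero_le_of_Ty {j : ℕ} (h : V ∈ t.Ty j) : V ∈ t.Pos := by
  rw [mem_Pos_iff]
  rcases Nat.eq_zero_or_pos j with rfl | hj
  · exact (x_eq_one_of_w h.2).le
  · exact (h.1 0 hj).le

lemma Zs_subset_Pos (i : ℕ) : t.Zs i ⊆ t.Pos := fun V hV => by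
  rw [mem_Pos_iff]; exact (hV 0 (Nat.zero_le _)).le

lemma Ty_subset_Zs {i j : ℕ} (h : i < j) : t.Ty j ⊆ t.Zs i := fun V hV l hl => hV.1 l (by omega)

lemma Zs_val {i : ℕ} (h : V ∈ t.Zs i) {l : ℕ} (hl : l ≤ i) :
    V.valuation (t.x l) = V.valuation (T r (t.x 0)) ^ (r ^ l) := by
  induction l with
  | zero => rw [pow_zero, pow_one, val_T_of_lt_one _ t.two_le (h 0 hl)]
  | succ l ih =>
    rw [← val_T_of_lt_one _ t.two_le (h (l + 1) hl), val_T_succ_of_lt_one (h l (by omega)),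
      ih (by omega), ← pow_mul, pow_succ]

lemma Ty_val_x {j : ℕ} (h : V ∈ t.Ty j) {i : ℕ} (hi : i < j) :
    V.valuation (t.x i) = V.valuation (T r (t.x 0)) ^ (r ^ i) :=
  Zs_val (t.Ty_subset_Zs hi h) le_rfl

lemma Ty_val_T {j : ℕ} (h : V ∈ t.Ty j) :
    V.valuation (T r (t.x j)) = V.valuation (T r (t.x 0)) ^ (r ^ j) := by
  cases j with
  | zero => simp
  | succ j =>
    rw [val_T_succ_of_lt_one (h.1 j (by omega)), Ty_val_x h (by omega), ← pow_mul, pow_succ]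

lemma Ty_val_w {j : ℕ} (h : V ∈ t.Ty j) :
    V.valuation (t.w j) = V.valuation (T r (t.x 0)) ^ (r ^ j) := by
  rw [← Ty_val_T h, t.val_T_eq, x_eq_one_of_w h.2, one_mul]

lemma tau_lt_one_of_Ty {j : ℕ} (h : V ∈ t.Ty j) : V.valuation (T r (t.x 0)) < 1 := by
  by_contra! h1
  have := Ty_val_w h
  exact absurd h.2 (not_lt.2 (this ▸ one_le_pow₀ h1))

lemma tau_lt_one_of_Zs {i : ℕ} (h : V ∈ t.Zs i) : V.valuation (T r (t.x 0)) < 1 := by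
  rw [val_T_of_lt_one _ t.two_le (h 0 (Nat.zero_le _))]; exact h 0 (Nat.zero_le _)

lemma big_succ {i : ℕ} (h : 1 < V.valuation (t.x i)) :
    1 < V.valuation (t.x (i + 1)) ∧ V.valuation (t.x i) = V.valuation (t.x (i + 1)) ^ r := by
  have hr := t.two_le
  have h1 := t.val_rel (V := V) i
  rw [val_T_of_one_lt _ hr h, pow_succ', mul_left_inj' (pow_ne_zero _ (t.val_x_pos i).ne')] at h1
  have h2 : 1 < V.valuation (t.x (i + 1)) := by
    by_contra! h3
    exact absurd h (not_lt.2 (h1 ▸ val_T_le _ h3))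
  rw [val_T_of_one_lt _ hr h2] at h1
  exact ⟨h2, h1.symm⟩

lemma Ty_val_T_succ {j : ℕ} (h : V ∈ t.Ty j) :
    V.valuation (T r (t.x (j + 1))) = (V.valuation (T r (t.x j)))⁻¹ := by
  have h1 := t.val_rel (V := V) j
  rw [x_eq_one_of_w h.2, one_pow] at h1
  exact eq_inv_of_mul_eq_one_left h1

lemma Ty_big {j : ℕ} (h : V ∈ t.Ty j) (i : ℕ) : 1 < V.valuation (t.x (j + i + 1)) ∧
    V.valuation (t.x (j + i + 1)) ^ (r ^ (i + 1)) = (V.valuation (T r (t.x j)))⁻¹ := by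
  induction i with
  | zero =>
    have h1 : 1 < V.valuation (T r (t.x (j + 1))) := by
      rw [Ty_val_T_succ h, one_lt_inv₀ (t.val_T_pos j), Ty_val_T h]
      exact pow_lt_one₀ zero_le (tau_lt_one_of_Ty h) (pow_ne_zero _ t.r_ne)
    have h2 : 1 < V.valuation (t.x (j + 1)) := by
      by_contra! h3
      exact absurd h1 (not_lt.2 (val_T_le _ h3))
    refine ⟨h2, ?_⟩
    rw [add_zero, zero_add, pow_one, ← val_T_of_one_lt _ t.two_le h2, Ty_val_T_succ h]
  | succ i ih =>
    obtain ⟨h1, h2⟩ := big_succ ih.1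
    refine ⟨h1, ?_⟩
    rw [← ih.2, h2, ← pow_mul, pow_succ']
    rfl

/-- The value of `1 / T (x (k + 1))` at a ring of type `j ≤ k`. -/
lemma Ty_val_t {j : ℕ} (h : V ∈ t.Ty j) (i : ℕ) :
    V.valuation (T r (t.x (j + i + 1)))⁻¹ ^ (r ^ i) = V.valuation (T r (t.x 0)) ^ (r ^ j) := by
  rw [map_inv₀, inv_pow, ← Ty_val_T h, val_T_of_one_lt _ t.two_le (Ty_big h i).1, ← pow_mul,
    ← pow_succ', (Ty_big h i).2, inv_inv]

lemma classify (h : V ∈ t.Pos) (hτ : V.valuation (T r (t.x 0)) < 1) (k : ℕ) :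
    (∃ j ≤ k, V ∈ t.Ty j) ∨ V ∈ t.Zs k := by
  have split : ∀ i, V.valuation (t.x i) ≤ 1 → V.valuation (T r (t.x i)) < 1 →
      V.valuation (t.x i) < 1 ∨ V.valuation (t.w i) < 1 := by
    intro i h1 h2
    rw [t.val_T_eq] at h2
    by_contra! h3
    rw [le_antisymm h1 h3.1, one_mul] at h2
    exact absurd h2 (not_lt.2 h3.2)
  induction k with
  | zero =>
    rcases split 0 (mem_Pos_iff.1 h) hτ with h1 | h1
    · right; intro l hl; obtain rfl : l = 0 := by omega
      exact h1
    · left; exact ⟨0, le_rfl, fun i hi => by omega, h1⟩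
  | succ k ih =>
    rcases ih with ⟨j, hj, h1⟩ | h1
    · exact Or.inl ⟨j, by omega, h1⟩
    · have h2 : V.valuation (T r (t.x (k + 1))) < 1 := by
        rw [val_T_succ_of_lt_one (h1 k le_rfl)]
        exact pow_lt_one₀ zero_le (h1 k le_rfl) t.r_ne
      rcases split (k + 1) (val_le_one_of_T _ t.two_le h2.le) h2 with h3 | h3
      · right; intro l hl
        rcases Nat.lt_or_ge k l with h4 | h4
        · obtain rfl : l = k + 1 := by omega
          exact h3
        · exact h1 l h4
      · exact Or.inl ⟨k + 1, le_rfl, fun i hi => h1 i (by omega), h3⟩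

lemma unit_val (h : V ∈ t.Pos) (hτ : ¬ V.valuation (T r (t.x 0)) < 1) (i : ℕ) :
    V.valuation (t.x i) = 1 ∧ V.valuation (T r (t.x i)) = 1 := by
  have split : ∀ i, V.valuation (T r (t.x i)) = 1 → V.valuation (t.x i) = 1 := by
    intro i h2
    have h1 := val_le_one_of_T _ t.two_le h2.le
    rw [t.val_T_eq] at h2
    by_contra h3
    have := mul_lt_one_of_lt_of_le (lt_of_le_of_ne h1 h3) (w_le_one h1)
    exact absurd h2 this.ne
  induction i with
  | zero =>
    have h1 : V.valuation (T r (t.x 0)) = 1 :=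
      le_antisymm (val_T_le _ (mem_Pos_iff.1 h)) (not_lt.1 hτ)
    exact ⟨split 0 h1, h1⟩
  | succ i ih =>
    have h1 := t.val_rel (V := V) i
    rw [ih.1, ih.2, mul_one, one_pow] at h1
    exact ⟨split _ h1, h1⟩

lemma tau_le_one (h : V ∈ t.Pos) : V.valuation (T r (t.x 0)) ≤ 1 := val_T_le _ (mem_Pos_iff.1 h)

end Values

variable [IsScalarTower F (RatFunc F) L]

/-- The elements of the `k`-th field that are regular at all valuation rings in `S`. -/
def O (t : Tower F L r) (S : Set (ValuationSubring L)) (k : ℕ) : Subring L where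
  carrier := {f | f ∈ t.K k ∧ ∀ V ∈ S, f ∈ V}
  mul_mem' h1 h2 := ⟨mul_mem h1.1 h2.1, fun V hV => mul_mem (h1.2 V hV) (h2.2 V hV)⟩
  add_mem' h1 h2 := ⟨add_mem h1.1 h2.1, fun V hV => add_mem (h1.2 V hV) (h2.2 V hV)⟩
  one_mem' := ⟨one_mem _, fun V _ => one_mem V⟩
  zero_mem' := ⟨zero_mem _, fun V _ => zero_mem V⟩
  neg_mem' h := ⟨neg_mem h.1, fun V hV => neg_mem (h.2 V hV)⟩

lemma O_mono_K {S : Set (ValuationSubring L)} {i k : ℕ} (h : i ≤ k) : t.O S i ≤ t.O S k :=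
  fun _ hf => ⟨t.K_mono h hf.1, hf.2⟩

lemma O_anti {S S' : Set (ValuationSubring L)} (h : S ⊆ S') (k : ℕ) : t.O S' k ≤ t.O S k :=
  fun _ hf => ⟨hf.1, fun V hV => hf.2 V (h hV)⟩

lemma aeval_mem (V : ValuationSubring L) {y : L} (hy : y ∈ V) (p : Polynomial F) :
    Polynomial.aeval y p ∈ V := by
  rw [Polynomial.aeval_eq_sum_range]
  refine sum_mem fun i _ => ?_
  rw [Algebra.smul_def]
  exact mul_mem (const_mem V _) (pow_mem hy _)

lemma aeval_mem_O {S : Set (ValuationSubring L)} {k : ℕ} {y : L} (hy : y ∈ t.O S k)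
    (p : Polynomial F) : Polynomial.aeval y p ∈ t.O S k :=
  ⟨t.aeval_mem_K k p hy.1, fun V hV => aeval_mem V (hy.2 V hV) p⟩

lemma exists_val_poly {q : Polynomial F} (hq : q.natDegree ≠ 0) : ∃ V ∈ t.Pos,
    V.valuation (Polynomial.aeval (t.x 0) q) < 1 := by
  have hq0 : q ≠ 0 := by rintro rfl; simp at hq
  obtain ⟨V, hV⟩ := exists_valuation_lt_one (F := F) (t.transcendental_x_zero.aeval q hq
    (mem_nonZeroDivisors_of_ne_zero (Polynomial.leadingCoeff_ne_zero.2 hq0)))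
  refine ⟨V, ?_, hV⟩
  rw [mem_Pos_iff]
  by_contra! h
  rw [val_aeval_of_one_lt _ h hq0] at hV
  exact absurd hV (not_lt.2 (one_le_pow₀ h.le))

lemma O_zero_repr {f : L} (hf : f ∈ t.O t.Pos 0) :
    ∃ p : Polynomial F, f = Polynomial.aeval (t.x 0) p := by
  obtain ⟨p, q, hq, hco, rfl⟩ := t.K_zero_repr hf.1
  by_cases hd : q.natDegree = 0
  · obtain ⟨c, hc⟩ := Polynomial.natDegree_eq_zero.1 hd
    have hc0 : c ≠ 0 := by rintro rfl; simp at hc; exact hq hc.symm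
    refine ⟨p * Polynomial.C c⁻¹, ?_⟩
    rw [map_mul, ← hc, Polynomial.aeval_C, Polynomial.aeval_C, map_inv₀, div_eq_mul_inv]
  · obtain ⟨V, hV, hlt⟩ := t.exists_val_poly hd
    exfalso
    obtain ⟨a, b, hab⟩ := hco
    have h1 := congrArg (Polynomial.aeval (t.x 0)) hab
    rw [map_add, map_mul, map_mul, map_one] at h1
    have h2 := hf.2 V hV
    rw [← V.valuation_le_one_iff, map_div₀,
      div_le_one₀ ((Valuation.pos_iff _).2 (t.aeval_x_zero_ne hq))] at h2
    have ha := (V.valuation_le_one_iff _).2 (aeval_mem V (y := t.x 0) hV a)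
    have hb := (V.valuation_le_one_iff _).2 (aeval_mem V (y := t.x 0) hV b)
    have h3 : V.valuation (1 : L) < 1 := by
      rw [← h1]
      refine Valuation.map_add_lt _ ?_ ?_
      · rw [map_mul]; exact mul_lt_one_val ha (h2.trans_lt hlt)
      · rw [map_mul]; exact mul_lt_one_val hb hlt
    simp at h3

variable [IsAlgClosed L] [Algebra.IsAlgebraic (RatFunc F) L]

/-- The top coefficient of an element, obtained from its conjugates. -/
lemma exists_top_coeff {Vi : ValuationSubring L} (hVi : 1 < Vi.valuation (t.x 0)) {k : ℕ} {f : L}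
    (hf : f ∈ t.K (k + 1)) (h0 : f ≠ 0) : ∃ g ∈ t.K k, g ≠ 0 ∧ Vi.valuation g ≤ Vi.valuation f ∧
      (∀ V : ValuationSubring L, (∀ σ, t.Fixes k σ → σ f ∈ V) → g ∈ V) ∧
      (∀ V : ValuationSubring L, (∀ σ, t.Fixes k σ → V.valuation (σ f) < 1) →
        V.valuation g < 1) := by
  classical
  have hz : t.x (k + 1) - t.x (k + 1) ∈ t.K k := by rw [sub_self]; exact zero_mem _
  obtain ⟨p, hp, rfl⟩ := t.exists_coeffs hz hf
  have hne : ((Finset.range r).filter fun e => p e ≠ 0).Nonempty := by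
    by_contra h
    rw [Finset.not_nonempty_iff_eq_empty, Finset.filter_eq_empty_iff] at h
    exact h0 (Finset.sum_eq_zero fun e he => by rw [not_not.1 (h he), zero_mul])
  obtain ⟨d, hd, hmax⟩ := Finset.exists_max_image _ id hne
  rw [Finset.mem_filter, Finset.mem_range] at hd
  have hz' : ∀ i < r, d < i → p i = 0 := by
    intro i hi hdi
    by_contra h
    have := hmax i (by simp [hi, h])
    simp only [id] at this
    omega
  choose! s hs using fun (a : F) (ha : a ∈ Lam F r) => t.exists_aut k ha
  set f := ∑ e ∈ Finset.range r, p e * t.x (k + 1) ^ e with hfdef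
  have hpd : p d = ∑ a ∈ Lam F r, algebraMap F L (lw F r d a) * s a f := by
    rw [sum_lw_conj t.card_Lam d p (t.x (k + 1)) (fun a => s a f)
      (fun a ha => t.aut_sum (hs a ha).1 (hs a ha).2 hp hz), Finset.sum_eq_single d]
    · simp
    · intro i hi hid
      rw [Finset.mem_range] at hi
      rcases Nat.lt_or_gt_of_ne hid with h | h
      · rw [Nat.choose_eq_zero_of_lt h]; simp
      · rw [hz' i hi h]; simp
    · intro h; exact absurd (Finset.mem_range.2 hd.1) h
  refine ⟨p d, hp d, hd.2, ?_, fun V hV => ?_, fun V hV => ?_⟩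
  · refine le_trans ?_ (t.inf_coeff_le hVi hp hd.1)
    exact le_mul_of_one_le_right zero_le (one_le_pow₀ (t.inf_one_lt hVi _).le)
  · rw [hpd]
    exact sum_mem fun a ha => mul_mem (const_mem V _) (hV _ (hs a ha).1)
  · rw [hpd]
    refine Valuation.map_sum_lt _ one_ne_zero fun a ha => ?_
    rw [map_mul]
    exact mul_lt_one_val (val_const_le _ _) (hV _ (hs a ha).1)

lemma conj_mem_of_stable {k : ℕ} {S : Set (ValuationSubring L)} (hS : t.Stable k S) {f : L}
    (hf : ∀ V ∈ S, f ∈ V) {σ : L ≃+* L} (hσ : t.Fixes k σ) {V : ValuationSubring L} (hV : V ∈ S) :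
    σ f ∈ V := mem_pull.1 (hf _ (hS σ hσ V hV))

variable {Vi : ValuationSubring L} (hVi : 1 < Vi.valuation (t.x 0))
include hVi

lemma inf_ge_one (k : ℕ) : ∀ f ∈ t.O t.Pos k, f ≠ 0 → 1 ≤ Vi.valuation f := by
  induction k with
  | zero =>
    intro f hf h0
    obtain ⟨p, rfl⟩ := O_zero_repr hf
    have hp : p ≠ 0 := by rintro rfl; simp at h0
    rw [val_aeval_of_one_lt _ hVi hp]
    exact one_le_pow₀ hVi.le
  | succ k ih =>
    intro f hf h0
    obtain ⟨g, hg, hg0, hle, hmem, -⟩ := exists_top_coeff hVi hf.1 h0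
    refine (ih g ⟨hg, fun V hV => hmem V fun σ hσ => ?_⟩ hg0).trans hle
    exact conj_mem_of_stable (stable_Pos k) hf.2 hσ hV

/-- A nonzero regular element vanishing at the rings of type `0` has a large value at infinity. -/
lemma inf_ge_of_vanishing (k : ℕ) : ∀ f ∈ t.O t.Pos k, f ≠ 0 →
    (∀ V ∈ t.Ty 0, V.valuation f < 1) →
    Vi.valuation (t.x k) ^ ((r - 1) * r ^ k) ≤ Vi.valuation f := by
  have hr := t.two_le
  induction k with
  | zero =>
    classical
    intro f hf h0 hvan
    obtain ⟨p, rfl⟩ := O_zero_repr hf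
    have hp : p ≠ 0 := by rintro rfl; simp at h0
    rw [val_aeval_of_one_lt _ hVi hp, pow_zero, mul_one]
    refine pow_le_pow_right₀ hVi.le ?_
    have hsub : (Lam F r).erase 0 ⊆ p.roots.toFinset := by
      intro b hb
      rw [Finset.mem_erase] at hb
      obtain ⟨V, hV⟩ := t.exists_val_sub b
      have hx : V.valuation (t.x 0) = 1 := by
        have : t.x 0 = algebraMap F L b + (t.x 0 - algebraMap F L b) := by ring
        rw [this, Valuation.map_add_eq_of_lt_left, val_const _ hb.1]
        rw [val_const _ hb.1]; exact hV
      have hT : V.valuation (T r (t.x 0)) < 1 := by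
        have : T r (t.x 0) = T r (t.x 0 - algebraMap F L b) := by
          rw [t.T_sub, T_algebraMap_Lam hb.2, sub_zero]
        rw [this, val_T_of_lt_one _ hr hV]; exact hV
      have hty : V ∈ t.Ty 0 := by
        refine ⟨fun i hi => by omega, ?_⟩
        rwa [t.val_T_eq, hx, one_mul] at hT
      have h1 := hvan V hty
      have h2 : V.valuation (Polynomial.aeval (t.x 0) p - algebraMap F L (p.eval b)) < 1 := by
        obtain ⟨q, hq⟩ := Polynomial.X_sub_C_dvd_sub_C_eval (a := b) (p := p)
        have := congrArg (Polynomial.aeval (t.x 0)) hq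
        rw [map_sub, Polynomial.aeval_C, map_mul, map_sub, Polynomial.aeval_X,
          Polynomial.aeval_C] at this
        rw [this, map_mul, mul_comm]
        exact mul_lt_one_val ((V.valuation_le_one_iff _).2
          (aeval_mem V ((V.valuation_le_one_iff _).1 hx.le) q)) hV
      rw [Multiset.mem_toFinset, Polynomial.mem_roots hp, Polynomial.IsRoot]
      by_contra hb0
      have h3 := val_const V.valuation (L := L) hb0
      have h4 : algebraMap F L (p.eval b) = Polynomial.aeval (t.x 0) p -
        (Polynomial.aeval (t.x 0) p - algebraMap F L (p.eval b)) := by ring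
      have h5 := (V.valuation.map_sub _ _).trans_lt (max_lt h1 h2)
      rw [← h4, h3] at h5
      exact lt_irrefl _ h5
    have h0mem : (0 : F) ∈ Lam F r := mem_Lam.2 t.T_zero
    calc r - 1 = ((Lam F r).erase 0).card := by rw [Finset.card_erase_of_mem h0mem, t.card_Lam]
      _ ≤ _ := Finset.card_le_card hsub
      _ ≤ _ := Multiset.toFinset_card_le _
      _ ≤ _ := p.card_roots'
  | succ k ih =>
    intro f hf h0 hvan
    obtain ⟨g, hg, hg0, hle, hmem, hlt⟩ := exists_top_coeff hVi hf.1 h0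
    have h1 := ih g ⟨hg, fun V hV => hmem V fun σ hσ =>
      conj_mem_of_stable (stable_Pos k) hf.2 hσ hV⟩ hg0 (fun V hV => hlt V fun σ hσ =>
        pull_lt_one_iff.1 (hvan _ (stable_Ty (Nat.zero_le k) σ hσ V hV)))
    refine le_trans (le_of_eq ?_) (h1.trans hle)
    rw [t.inf_succ hVi k, ← pow_mul]
    congr 1
    ring

end Tower

namespace Tower

variable {F L : Type*} [Field F] [Fintype F] [Field L] [Algebra F L] [Algebra (RatFunc F) L]
  [IsScalarTower F (RatFunc F) L] {r : ℕ} {t : Tower F L r} {V : ValuationSubring L}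

lemma pow_anti_val {a : V.ValueGroup} (ha : a ≤ 1) {m n : ℕ} (h : m ≤ n) : a ^ n ≤ a ^ m :=
  pow_le_pow_right_of_le_one' ha h

lemma exists_root_of_val_T {y : L} (h : V.valuation (T r y) < 1) (t : Tower F L r) :
    ∃ b ∈ Lam F r, V.valuation (y - algebraMap F L b) < 1 := by
  by_contra! h1
  rw [← t.T_prod, map_prod] at h
  refine absurd h (not_lt.2 ?_)
  exact Finset.one_le_prod' fun b hb => h1 b hb

lemma val_sub_Lam {y : L} {b : F} (hb : b ∈ Lam F r) (h : V.valuation (y - algebraMap F L b) < 1)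
    (t : Tower F L r) : V.valuation (y - algebraMap F L b) = V.valuation (T r y) := by
  rw [← val_T_of_lt_one _ t.two_le h, t.T_sub, T_algebraMap_Lam hb, sub_zero]

lemma val_aeval_sub {y : L} (hy : y ∈ V) (b : F) (p : Polynomial F) :
    V.valuation (Polynomial.aeval y p - algebraMap F L (p.eval b)) ≤
      V.valuation (y - algebraMap F L b) := by
  obtain ⟨q, hq⟩ := Polynomial.X_sub_C_dvd_sub_C_eval (a := b) (p := p)
  have := congrArg (Polynomial.aeval y) hq
  rw [map_sub, Polynomial.aeval_C, map_mul, map_sub, Polynomial.aeval_X, Polynomial.aeval_C] at this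
  rw [this, map_mul]
  exact mul_le_of_le_one_right zero_le ((V.valuation_le_one_iff _).2 (aeval_mem V hy q))

lemma val_poly_ge (hV : V ∈ t.Pos) {b : F} (hb : V.valuation (t.x 0 - algebraMap F L b) < 1) (n : ℕ) :
    ∀ q : Polynomial F, q.natDegree ≤ n → q ≠ 0 →
      V.valuation (t.x 0 - algebraMap F L b) ^ n ≤ V.valuation (Polynomial.aeval (t.x 0) q) := by
  have aux : ∀ q : Polynomial F, q.eval b ≠ 0 → V.valuation (Polynomial.aeval (t.x 0) q) = 1 := by
    intro q hq
    have h1 := val_aeval_sub (y := t.x 0) hV b q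
    have : Polynomial.aeval (t.x 0) q = algebraMap F L (q.eval b) +
      (Polynomial.aeval (t.x 0) q - algebraMap F L (q.eval b)) := by ring
    rw [this, Valuation.map_add_eq_of_lt_left, val_const _ hq]
    rw [val_const _ hq]; exact h1.trans_lt hb
  induction n with
  | zero =>
    intro q hd hq
    obtain ⟨c, rfl⟩ := Polynomial.natDegree_eq_zero.1 (Nat.le_zero.1 hd)
    rw [pow_zero, aux]
    intro h; apply hq; simpa using h
  | succ n ih =>
    intro q hd hq
    by_cases h : q.eval b = 0
    · obtain ⟨q', rfl⟩ := Polynomial.dvd_iff_isRoot.2 h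
      have hq' : q' ≠ 0 := right_ne_zero_of_mul hq
      have h2 := ih q' (by
        rw [Polynomial.natDegree_mul (Polynomial.X_sub_C_ne_zero _) hq',
          Polynomial.natDegree_X_sub_C] at hd
        omega) hq'
      have e : Polynomial.aeval (t.x 0) (Polynomial.X - Polynomial.C b) =
          t.x 0 - algebraMap F L b := by simp
      rw [map_mul, map_mul, e, pow_succ']
      exact mul_le_mul_right h2 _
    · rw [aux q h]
      exact pow_le_one' hb.le _

/-- Poles above the zeros of `T (x 0)` are bounded by a power of `T (x 0)`. -/
lemma exists_pole_bound (k : ℕ) : ∀ f ∈ t.K k, ∃ B : ℕ, ∀ V ∈ t.Pos, V.valuation (T r (t.x 0)) < 1 →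
    V.valuation f * V.valuation (T r (t.x 0)) ^ B ≤ 1 := by
  induction k with
  | zero =>
    intro f hf
    obtain ⟨p, q, hq, -, rfl⟩ := t.K_zero_repr hf
    refine ⟨q.natDegree, fun V hV hlt => ?_⟩
    obtain ⟨b, hb, hb1⟩ := exists_root_of_val_T hlt t
    have h1 := val_poly_ge hV hb1 _ q le_rfl hq
    rw [val_sub_Lam hb hb1 t] at h1
    have hpos : 0 < V.valuation (Polynomial.aeval (t.x 0) q) :=
      (Valuation.pos_iff _).2 (t.aeval_x_zero_ne hq)
    rw [map_div₀, div_mul_eq_mul_div, div_le_one₀ hpos]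
    exact (mul_le_of_le_one_left zero_le ((V.valuation_le_one_iff _).2 (aeval_mem V hV p))).trans h1
  | succ k ih =>
    intro f hf
    obtain ⟨p, hp, rfl⟩ := t.exists_coeffs (by rw [sub_self]; exact zero_mem _) hf
    choose! B hB using ih
    set B₁ := B (T r (t.x (k + 1))) with hB₁
    have hx : ∀ V ∈ t.Pos, V.valuation (T r (t.x 0)) < 1 →
        V.valuation (t.x (k + 1)) * V.valuation (T r (t.x 0)) ^ B₁ ≤ 1 := by
      intro V hV hlt
      rcases le_or_gt (V.valuation (t.x (k + 1))) 1 with h | h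
      · exact mul_le_one' h (pow_le_one' hlt.le _)
      · refine le_trans ?_ (hB _ (t.T_x_succ_mem k) V hV hlt)
        refine mul_le_mul_left ?_ _
        rw [val_T_of_one_lt _ t.two_le h]
        exact le_self_pow₀ h.le t.r_ne
    refine ⟨(∑ e ∈ Finset.range r, B (p e)) + B₁ * r, fun V hV hlt => ?_⟩
    rw [← map_pow, ← map_mul, Finset.sum_mul]
    refine Valuation.map_sum_le _ fun e he => ?_
    rw [map_mul, map_mul, map_pow, map_pow]
    set τ := V.valuation (T r (t.x 0))
    have h1 := hB _ (hp e) V hV hlt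
    have h2 := pow_le_one' (hx V hV hlt) e
    calc V.valuation (p e) * V.valuation (t.x (k + 1)) ^ e *
          τ ^ ((∑ e ∈ Finset.range r, B (p e)) + B₁ * r)
        ≤ V.valuation (p e) * V.valuation (t.x (k + 1)) ^ e * τ ^ (B (p e) + B₁ * e) := by
          refine mul_le_mul_right (pow_anti_val hlt.le ?_) _
          exact add_le_add (Finset.single_le_sum (f := fun e => B (p e)) (fun _ _ => Nat.zero_le _) he)
            (Nat.mul_le_mul_left _ (Finset.mem_range.1 he).le)
      _ = (V.valuation (p e) * τ ^ B (p e)) * (V.valuation (t.x (k + 1)) * τ ^ B₁) ^ e := by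
          rw [pow_add, mul_pow, pow_mul, mul_mul_mul_comm]
      _ ≤ 1 := mul_le_one' h1 h2

variable (F) in
lemma exists_sep_poly (r M : ℕ) (hr : 2 ≤ r) : ∃ g A B : Polynomial F,
    g = B * (Polynomial.X ^ (r - 1) + 1) ^ M ∧ g - 1 = A * Polynomial.X ^ M := by
  have h : IsCoprime (Polynomial.X : Polynomial F) (Polynomial.X ^ (r - 1) + 1) :=
    ⟨-Polynomial.X ^ (r - 2), 1, by
      have : r - 1 = r - 2 + 1 := by omega
      rw [this, pow_succ]; ring⟩
  obtain ⟨A, B, hAB⟩ := h.pow (m := M) (n := M)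
  exact ⟨B * (Polynomial.X ^ (r - 1) + 1) ^ M, -A, B, rfl, by linear_combination hAB⟩

/-- An element close to `1` on `Zs j` and close to `0` at the rings of type at most `j`. -/
lemma exists_separator (t : Tower F L r) (j : ℕ) : ∀ M : ℕ, ∃ φ ∈ t.K j, (∀ V ∈ t.Pos, φ ∈ V) ∧
    (∀ V ∈ t.Zs j, V.valuation (φ - 1) ≤ V.valuation (T r (t.x 0)) ^ M) ∧
    (∀ i ≤ j, ∀ V ∈ t.Ty i, V.valuation φ ≤ V.valuation (T r (t.x 0)) ^ M) := by
  have gen : ∀ (M i : ℕ), ∃ g : L, g ∈ t.K i ∧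
      (∀ V : ValuationSubring L, t.x i ∈ V → g ∈ V) ∧
      (∀ V ∈ t.Zs i, V.valuation (g - 1) ≤ V.valuation (T r (t.x 0)) ^ M) ∧
      (∀ V ∈ t.Ty i, V.valuation g ≤ V.valuation (T r (t.x 0)) ^ M) := by
    intro M i
    obtain ⟨g, A, B, h1, h2⟩ := exists_sep_poly F r M t.two_le
    refine ⟨Polynomial.aeval (t.x i) g, t.aeval_mem_K _ _ (t.x_mem_self i),
      fun V hV => aeval_mem V hV g, fun V hV => ?_, fun V hV => ?_⟩
    · have h3 := congrArg (Polynomial.aeval (t.x i)) h2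
      rw [map_sub, map_one, map_mul, map_pow, Polynomial.aeval_X] at h3
      rw [h3, map_mul, map_pow]
      refine (mul_le_of_le_one_left zero_le ((V.valuation_le_one_iff _).2 (aeval_mem V
        ((V.valuation_le_one_iff _).1 (hV i le_rfl).le) A))).trans ?_
      refine pow_le_pow_left₀ zero_le ?_ _
      rw [Zs_val hV le_rfl]
      exact pow_le_of_le_one zero_le (tau_lt_one_of_Zs hV).le (pow_ne_zero _ t.r_ne)
    · have h3 := congrArg (Polynomial.aeval (t.x i)) h1
      rw [map_mul, map_pow, map_add, map_pow, map_one, Polynomial.aeval_X] at h3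
      change _ = _ * t.w i ^ M at h3
      rw [h3, map_mul, map_pow]
      refine (mul_le_of_le_one_left zero_le ((V.valuation_le_one_iff _).2 (aeval_mem V
        ((V.valuation_le_one_iff _).1 (x_eq_one_of_w hV.2).le) B))).trans ?_
      refine pow_le_pow_left₀ zero_le ?_ _
      rw [Ty_val_w hV]
      exact pow_le_of_le_one zero_le (tau_lt_one_of_Ty hV).le (pow_ne_zero _ t.r_ne)
  induction j with
  | zero =>
    intro M
    obtain ⟨g, h1, h2, h3, h4⟩ := gen M 0
    refine ⟨g, h1, fun V hV => h2 V hV, h3, fun i hi => ?_⟩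
    obtain rfl : i = 0 := by omega
    exact h4
  | succ j ih =>
    intro M
    obtain ⟨g, hg1, hg2, hg3, hg4⟩ := gen M (j + 1)
    obtain ⟨B, hB⟩ := exists_pole_bound (j + 1) g hg1
    obtain ⟨φ, h1, h2, h3, h4⟩ := ih (M + B)
    have hty : ∀ i ≤ j, ∀ V ∈ t.Ty i, V.valuation (φ * g) ≤ V.valuation (T r (t.x 0)) ^ M := by
      intro i hi V hV
      rw [map_mul]
      have h5 := hB V (x_zero_le_of_Ty hV) (tau_lt_one_of_Ty hV)
      calc _ ≤ V.valuation (T r (t.x 0)) ^ (M + B) * V.valuation g := mul_le_mul_left (h4 i hi V hV) _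
        _ = V.valuation (T r (t.x 0)) ^ M * (V.valuation g * V.valuation (T r (t.x 0)) ^ B) := by
          rw [pow_add]; ac_rfl
        _ ≤ _ := mul_le_of_le_one_right zero_le h5
    refine ⟨φ * g, mul_mem (t.K_le_succ j h1) hg1, fun V hV => ?_, fun V hV => ?_, fun i hi V hV => ?_⟩
    · by_cases hτ : V.valuation (T r (t.x 0)) < 1
      · rcases classify hV hτ (j + 1) with ⟨i, hi, hVi⟩ | hVz
        · rcases Nat.lt_or_ge j i with hij | hij
          · obtain rfl : i = j + 1 := by omega
            exact mul_mem (h2 V hV) (hg2 V ((V.valuation_le_one_iff _).1 (x_eq_one_of_w hVi.2).le))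
          · rw [← V.valuation_le_one_iff]
            exact (hty i hij V hVi).trans (pow_le_one' hτ.le _)
        · exact mul_mem (h2 V hV) (hg2 V ((V.valuation_le_one_iff _).1 (hVz _ le_rfl).le))
      · exact mul_mem (h2 V hV) (hg2 V ((V.valuation_le_one_iff _).1 (unit_val hV hτ _).1.le))
    · have hVj : V ∈ t.Zs j := fun l hl => hV l (by omega)
      have : φ * g - 1 = (φ - 1) * g + (g - 1) := by ring
      rw [this]
      refine (Valuation.map_add _ _ _).trans (max_le ?_ (hg3 V hV))
      rw [map_mul]
      refine (mul_le_of_le_one_right zero_le ((V.valuation_le_one_iff _).2 (hg2 V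
        ((V.valuation_le_one_iff _).1 (hV _ le_rfl).le)))).trans ((h3 V hVj).trans ?_)
      exact pow_anti_val (tau_lt_one_of_Zs hV).le (by omega)
    · rcases Nat.lt_or_ge j i with hij | hij
      · obtain rfl : i = j + 1 := by omega
        rw [map_mul]
        exact (mul_le_of_le_one_left zero_le ((V.valuation_le_one_iff _).2
          (h2 V (x_zero_le_of_Ty hV)))).trans (hg4 V hV)
      · exact hty i hij V hV

lemma exists_base_point {j : ℕ} (hV : V ∈ t.Ty j) : ∃ b : F, b ∈ Lam F r ∧
    V.valuation (t.x j - algebraMap F L b) = V.valuation (T r (t.x j)) ∧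
    V.valuation (T r (t.x j)) < 1 := by
  have h : V.valuation (T r (t.x j)) < 1 := by
    rw [Ty_val_T hV]; exact pow_lt_one₀ zero_le (tau_lt_one_of_Ty hV) (pow_ne_zero _ t.r_ne)
  obtain ⟨b, hb, hb1⟩ := exists_root_of_val_T h t
  exact ⟨b, hb, val_sub_Lam hb hb1 t, h⟩

lemma val_pow_sub_le {j : ℕ} (hV : V ∈ t.Ty j) (b : F) (n : ℕ) :
    V.valuation (t.x j ^ n - algebraMap F L (b ^ n)) ≤
      V.valuation (t.x j - algebraMap F L b) := by
  have := val_aeval_sub (V := V) (y := t.x j)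
    ((V.valuation_le_one_iff _).1 (x_eq_one_of_w hV.2).le) b (Polynomial.X ^ n)
  simpa using this

lemma T_mul_const {β : F} (hβ : β ^ r = β) (y : L) :
    T r (algebraMap F L β * y) = algebraMap F L β * T r y := by
  rw [T, T, mul_pow, ← map_pow, hβ, mul_add]

lemma inv_T_succ (i : ℕ) : T r (t.x i)⁻¹ = (T r (t.x (i + 1)))⁻¹ := by
  have hr := t.two_le
  have h1 := t.x_ne i
  have h2 := t.w_ne i
  have h3 : t.x i ^ r = t.x i ^ (r - 1) * t.x i := by rw [← pow_succ]; congr 1; omega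
  rw [t.T_x_succ_w, T, inv_div, inv_pow, h3]
  unfold w at *
  field_simp
  ring

/-- Cancellation of the poles of `x (j + i)` at a ring of type `j` by `1 / x (j - i)`. -/
lemma cancel_pole {j : ℕ} (hV : V ∈ t.Ty j) {b : F}
    (hxb : V.valuation (t.x j - algebraMap F L b) = V.valuation (T r (t.x j))) :
    ∀ i, i + 1 ≤ j →
      t.x (j + (i + 1)) - algebraMap F L (b ^ (r + 1)) * (t.x (j - (i + 1)))⁻¹ ∈ V := by
  have hr := t.two_le
  set β := b ^ (r + 1) with hβdef
  have hβ : β ^ r = β := by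
    rw [hβdef, ← pow_mul, add_mul, one_mul, pow_add, pow_add, ← sq, ← t.card, FiniteField.pow_card,
      pow_one, mul_comm]
  intro i
  induction i with
  | zero =>
    intro hj
    rw [← V.valuation_le_one_iff]
    refine val_le_one_of_T _ hr ?_
    rw [t.T_sub, T_mul_const hβ, inv_T_succ, show j - (0 + 1) + 1 = j by omega, zero_add, t.T_x_succ,
      div_eq_mul_inv, ← sub_mul, ← div_eq_mul_inv, map_div₀,
      div_le_one₀ ((Valuation.pos_iff _).2 (t.T_ne j)), ← hxb]
    exact val_pow_sub_le hV b (r + 1)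
  | succ i ih =>
    intro hj
    have ih := ih (by omega)
    rw [← V.valuation_le_one_iff]
    refine val_le_one_of_T _ hr ?_
    rw [V.valuation_le_one_iff]
    set y := t.x (j - (i + 1)) with hy
    set X := t.x (j + (i + 1)) with hX
    have hyV : V.valuation y < 1 := hV.1 _ (by omega)
    have hXV : 1 < V.valuation X := (Ty_big hV i).1
    have hy0 : y ≠ 0 := t.x_ne _
    have hTy : T r y ≠ 0 := t.T_ne _
    have hTX : T r X ≠ 0 := t.T_ne _
    have e1 : T r (t.x (j + (i + 1 + 1))) = X - X ^ 2 / T r X := by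
      have h := t.rel (j + (i + 1))
      rw [← hX] at h
      rw [eq_sub_iff_add_eq, ← mul_left_inj' hTX, add_mul, div_mul_cancel₀ _ hTX]
      change T r (t.x (j + (i + 1) + 1)) * T r X + X ^ 2 = X * T r X
      rw [h, T]; ring
    have e2 : T r (t.x (j - (i + 1 + 1)))⁻¹ = y⁻¹ - y ^ (r - 1) / T r y := by
      rw [inv_T_succ, show j - (i + 1 + 1) + 1 = j - (i + 1) by omega, ← hy]
      field_simp
      rw [T]
      have : y ^ r = y ^ (r - 1) * y := by rw [← pow_succ]; congr 1; omega
      rw [this]; ring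
    rw [t.T_sub, T_mul_const hβ, e1, e2]
    have e3 : X - X ^ 2 / T r X - algebraMap F L β * (y⁻¹ - y ^ (r - 1) / T r y) =
      (X - algebraMap F L β * y⁻¹) - X ^ 2 / T r X + algebraMap F L β * (y ^ (r - 1) / T r y) := by
      ring
    rw [e3]
    refine add_mem (sub_mem ih ?_) (mul_mem (const_mem V _) ?_)
    · rw [← V.valuation_le_one_iff, map_div₀, div_le_one₀ ((Valuation.pos_iff _).2 hTX),
        val_T_of_one_lt _ hr hXV, map_pow]
      exact pow_le_pow_right₀ hXV.le hr
    · rw [← V.valuation_le_one_iff, map_div₀, div_le_one₀ ((Valuation.pos_iff _).2 hTy),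
        val_T_of_lt_one _ hr hyV, map_pow]
      exact pow_le_of_le_one zero_le hyV.le (by omega)

lemma Ty_disjoint {i j : ℕ} (h : i < j) (hi : V ∈ t.Ty i) (hj : V ∈ t.Ty j) : False := by
  have h1 := hj.1 i h
  rw [x_eq_one_of_w hi.2] at h1
  exact lt_irrefl _ h1

/-- The element of the `k`-th field that cancels the poles of `x (k + 1)` at the types `j` with
`k < 2 * j`. -/
lemma exists_center (t : Tower F L r) (k : ℕ) : ∃ c ∈ t.K k,
    (∀ V ∈ t.Pos, (∀ j ≤ k, k < 2 * j → V ∉ t.Ty j) → c ∈ V) ∧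
    ∀ j ≤ k, k < 2 * j → ∀ V ∈ t.Ty j, t.x (k + 1) - c ∈ V := by
  set f : ℕ → L := fun j => t.x j ^ (r + 1) / t.x (2 * j - k - 1) with hf
  have hfK : ∀ j ≤ k, f j ∈ t.K k := fun j hj =>
    div_mem (pow_mem (t.x_mem hj) _) (t.x_mem (by omega))
  choose! B hB using exists_pole_bound (t := t) k
  choose φ hφK hφ1 hφ2 hφ3 using fun j => t.exists_separator (j - 1) (B (f j))
  set J := (Finset.range (k + 1)).filter fun j => k < 2 * j with hJ
  have hmemJ : ∀ {j}, j ∈ J ↔ j ≤ k ∧ k < 2 * j := by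
    intro j; simp [hJ]
  have hreg : ∀ j ∈ J, ∀ V ∈ t.Pos, V ∉ t.Ty j → φ j * f j ∈ V := by
    intro j hj V hV hVj
    obtain ⟨hjk, hkj⟩ := hmemJ.1 hj
    have hmono : ∀ {a b : ℕ}, a ≤ b → V.valuation (T r (t.x 0)) < 1 →
        V.valuation (T r (t.x 0)) ^ (r ^ b) ≤ V.valuation (T r (t.x 0)) ^ (r ^ a) := fun hab hlt =>
      pow_anti_val hlt.le (Nat.pow_le_pow_right (by have := t.two_le; omega) hab)
    have hsmall : V.valuation (T r (t.x 0)) < 1 →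
        V.valuation (t.x j) = V.valuation (T r (t.x 0)) ^ (r ^ j) →
        V.valuation (t.x (2 * j - k - 1)) = V.valuation (T r (t.x 0)) ^ (r ^ (2 * j - k - 1)) →
        φ j * f j ∈ V := by
      intro hlt h1 h2
      refine mul_mem (hφ1 j V hV) ?_
      rw [hf, ← V.valuation_le_one_iff, map_div₀, div_le_one₀ (t.val_x_pos _), map_pow]
      have h3 : V.valuation (t.x j) ≤ 1 := h1 ▸ pow_le_one' hlt.le _
      refine (pow_le_of_le_one zero_le h3 (by omega)).trans ?_
      rw [h1, h2]
      exact hmono (by omega) hlt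
    by_cases hlt : V.valuation (T r (t.x 0)) < 1
    · rcases classify hV hlt k with ⟨i, hik, hVi⟩ | hVz
      · rcases lt_trichotomy i j with hij | rfl | hij
        · rw [← V.valuation_le_one_iff, map_mul, mul_comm]
          refine le_trans (mul_le_mul_right (hφ3 j i (by omega) V hVi) _) ?_
          exact hB _ (hfK j hjk) V hV hlt
        · exact absurd hVi hVj
        · exact hsmall hlt (Ty_val_x hVi hij) (Ty_val_x hVi (by omega))
      · exact hsmall hlt (Zs_val hVz hjk) (Zs_val hVz (by omega))
    · refine mul_mem (hφ1 j V hV) ?_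
      rw [hf, ← V.valuation_le_one_iff, map_div₀, map_pow, (unit_val hV hlt _).1,
        (unit_val hV hlt _).1]
      simp
  refine ⟨∑ j ∈ J, φ j * f j, sum_mem fun j hj => ?_, fun V hV hno => sum_mem fun j hj => ?_,
    fun j hjk hkj V hVj => ?_⟩
  · have := hmemJ.1 hj
    exact mul_mem (t.K_mono (by omega) (hφK j)) (hfK j this.1)
  · exact hreg j hj V hV (hno j (hmemJ.1 hj).1 (hmemJ.1 hj).2)
  · have hV := x_zero_le_of_Ty hVj
    have hjJ : j ∈ J := hmemJ.2 ⟨hjk, hkj⟩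
    have hlt := tau_lt_one_of_Ty hVj
    rw [← Finset.add_sum_erase J _ hjJ, ← sub_sub]
    refine sub_mem ?_ (sum_mem fun i hi => ?_)
    · obtain ⟨b, hb, hxb, -⟩ := exists_base_point hVj
      have h1 := cancel_pole hVj hxb (k - j) (by omega)
      rw [show j + (k - j + 1) = k + 1 by omega, show j - (k - j + 1) = 2 * j - k - 1 by omega] at h1
      set β := b ^ (r + 1)
      have e : t.x (k + 1) - φ j * f j = (t.x (k + 1) - algebraMap F L β * (t.x (2 * j - k - 1))⁻¹) -
          (t.x j ^ (r + 1) - algebraMap F L β) / t.x (2 * j - k - 1) - f j * (φ j - 1) := by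
        rw [hf]; ring
      rw [e]
      refine sub_mem (sub_mem h1 ?_) ?_
      · rw [← V.valuation_le_one_iff, map_div₀, div_le_one₀ (t.val_x_pos _)]
        refine (val_pow_sub_le hVj b (r + 1)).trans ?_
        rw [hxb, Ty_val_T hVj, Ty_val_x hVj (by omega)]
        exact pow_anti_val hlt.le
          (Nat.pow_le_pow_right (by have := t.two_le; omega) (by omega))
      · rw [← V.valuation_le_one_iff, map_mul]
        refine le_trans (mul_le_mul_right (hφ2 j V ?_) _) (hB _ (hfK j hjk) V hV hlt)
        exact t.Ty_subset_Zs (by omega) hVj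
    · rw [Finset.mem_erase] at hi
      refine hreg i hi.2 V hV fun hVi => ?_
      rcases lt_or_gt_of_ne hi.1 with h | h
      · exact Ty_disjoint h hVi hVj
      · exact Ty_disjoint h hVj hVi

end Tower

section Few

variable {L : Type*} [Field L]

/-- The elements of `K` lie in at most `n` cosets of `H`. -/
def Few (n : ℕ) (H K : AddSubgroup L) : Prop := ∃ φ : Fin n → L, ∀ f ∈ K, ∃ i, f - φ i ∈ H

lemma Few.of_fintype {ι : Type*} [Fintype ι] {n : ℕ} (hn : Fintype.card ι = n) {H K : AddSubgroup L}
    (φ : ι → L) (h : ∀ f ∈ K, ∃ i, f - φ i ∈ H) : Few n H K := by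
  refine ⟨fun i => φ ((Fintype.equivFinOfCardEq hn).symm i), fun f hf => ?_⟩
  obtain ⟨i, hi⟩ := h f hf
  exact ⟨Fintype.equivFinOfCardEq hn i, by simpa using hi⟩

lemma Few.anti {n : ℕ} {H K K' : AddSubgroup L} (h : Few n H K) (hK : K' ≤ K) : Few n H K' := by
  obtain ⟨φ, hφ⟩ := h
  exact ⟨φ, fun f hf => hφ f (hK hf)⟩

lemma few_iff {n : ℕ} {H K : AddSubgroup L} : Few n H K ↔ H.relIndex K ≠ 0 ∧ H.relIndex K ≤ n := by
  constructor
  · rintro ⟨φ, hφ⟩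
    have : Nonempty (Fin n) := ⟨(hφ 0 (zero_mem _)).choose⟩
    choose! i hi using hφ
    let ψ : (K ⧸ H.addSubgroupOf K) → Fin n := fun c => i (Quotient.out c : K)
    have hψ : Function.Injective ψ := by
      intro c d hcd
      have h1 := hi _ (Quotient.out c : K).2
      have h2 := hi _ (Quotient.out d : K).2
      change i _ = i _ at hcd
      rw [hcd] at h1
      rw [← Quotient.out_eq' c, ← Quotient.out_eq' d]
      refine QuotientAddGroup.eq.2 ?_
      rw [AddSubgroup.mem_addSubgroupOf]
      have := H.sub_mem h2 h1
      rw [sub_sub_sub_cancel_right] at this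
      simpa [sub_eq_neg_add] using this
    have hfin : Finite (K ⧸ H.addSubgroupOf K) := Finite.of_injective ψ hψ
    rw [AddSubgroup.relIndex, AddSubgroup.index]
    refine ⟨Nat.card_ne_zero.2 ⟨inferInstance, hfin⟩, ?_⟩
    simpa using Nat.card_le_card_of_injective ψ hψ
  · rintro ⟨h0, hn⟩
    rw [AddSubgroup.relIndex, AddSubgroup.index] at h0 hn
    have hfin : Finite (K ⧸ H.addSubgroupOf K) := (Nat.card_ne_zero.1 h0).2
    obtain ⟨e⟩ : Nonempty ((K ⧸ H.addSubgroupOf K) ↪ Fin n) := by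
      have := Fintype.ofFinite (K ⧸ H.addSubgroupOf K)
      rw [Nat.card_eq_fintype_card] at hn
      exact Function.Embedding.nonempty_of_card_le (by simpa using hn)
    have : Nonempty (K ⧸ H.addSubgroupOf K) := ⟨0⟩
    refine ⟨fun j => ((Quotient.out (Function.invFun e j : K ⧸ H.addSubgroupOf K) : K) : L),
      fun f hf => ⟨e (QuotientAddGroup.mk ⟨f, hf⟩), ?_⟩⟩
    dsimp only
    rw [Function.leftInverse_invFun e.injective (QuotientAddGroup.mk ⟨f, hf⟩)]
    have := QuotientAddGroup.eq.1 (Quotient.out_eq' (QuotientAddGroup.mk ⟨f, hf⟩ : K ⧸ H.addSubgroupOf K))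
    rw [AddSubgroup.mem_addSubgroupOf] at this
    simpa [sub_eq_neg_add] using this

lemma Few.inf_right {n : ℕ} {H K : AddSubgroup L} (h : Few n H K) : Few n (H ⊓ K) K := by
  rw [few_iff] at h ⊢
  rwa [AddSubgroup.inf_relIndex_right]

lemma Few.inf {n m : ℕ} {H H' K : AddSubgroup L} (h : Few n H K) (h' : Few m H' K) :
    Few (n * m) (H ⊓ H') K := by
  rw [few_iff] at *
  refine ⟨AddSubgroup.relIndex_inf_ne_zero h.1 h'.1, ?_⟩
  exact (AddSubgroup.relIndex_inf_le ..).trans (Nat.mul_le_mul h.2 h'.2)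

lemma Few.mono {n m : ℕ} {H K : AddSubgroup L} (h : Few n H K) (hnm : n ≤ m) : Few m H K :=
  few_iff.2 ⟨(few_iff.1 h).1, (few_iff.1 h).2.trans hnm⟩

lemma few_self (H : AddSubgroup L) : Few 1 H H := few_iff.2 (by simp)

lemma Few.card_le {n : ℕ} {H K : AddSubgroup L} (h : Few n H K) :
    Nat.card K ≤ n * Nat.card (H ⊓ K : AddSubgroup L) := by
  rw [few_iff, ← AddSubgroup.inf_relIndex_right] at h
  have := AddSubgroup.relIndex_mul_relIndex ⊥ (H ⊓ K) K bot_le inf_le_right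
  rw [AddSubgroup.relIndex_bot_left, AddSubgroup.relIndex_bot_left] at this
  rw [← this, mul_comm]
  exact Nat.mul_le_mul_right _ h.2

/-- The multiples of the elements of `H` by `y`. -/
def sm (y : L) (H : AddSubgroup L) : AddSubgroup L := H.comap (AddMonoidHom.mulLeft y⁻¹)

lemma mem_sm {y f : L} {H : AddSubgroup L} : f ∈ sm y H ↔ y⁻¹ * f ∈ H := Iff.rfl

lemma mul_mem_sm {y f : L} (hy : y ≠ 0) {H : AddSubgroup L} : y * f ∈ sm y H ↔ f ∈ H := by
  rw [mem_sm, inv_mul_cancel_left₀ hy]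

lemma sm_mul (a b : L) (H : AddSubgroup L) : sm (a * b) H = sm a (sm b H) := by
  ext f
  rw [mem_sm, mem_sm, mem_sm, mul_inv_rev, mul_assoc]

lemma sm_one (H : AddSubgroup L) : sm 1 H = H := by
  ext f
  rw [mem_sm, inv_one, one_mul]

lemma sm_mono (y : L) {H K : AddSubgroup L} (h : H ≤ K) : sm y H ≤ sm y K :=
  AddSubgroup.comap_mono h

lemma relIndex_sm {y : L} (hy : y ≠ 0) (H K : AddSubgroup L) :
    (sm y H).relIndex (sm y K) = H.relIndex K := by
  rw [sm, sm, AddSubgroup.relIndex_comap, AddSubgroup.map_comap_eq_self_of_surjective]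
  intro f
  exact ⟨y * f, by simp [hy]⟩

lemma Few.sm {n : ℕ} {y : L} (hy : y ≠ 0) {H K : AddSubgroup L} (h : Few n H K) :
    Few n (sm y H) (sm y K) := by
  rw [few_iff] at *
  rwa [relIndex_sm hy]

lemma sm_pow_le {y : L} {H : AddSubgroup L} (h : sm y H ≤ H) (n : ℕ) : sm (y ^ n) H ≤ H := by
  induction n with
  | zero => rw [pow_zero, sm_one]
  | succ n ih =>
    rw [pow_succ, sm_mul]
    exact (sm_mono _ h).trans ih

lemma relIndex_sm_pow {y : L} (hy : y ≠ 0) {H : AddSubgroup L} (h : sm y H ≤ H) (n : ℕ) :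
    (sm (y ^ n) H).relIndex H = (sm y H).relIndex H ^ n := by
  induction n with
  | zero => rw [pow_zero, sm_one, pow_zero, AddSubgroup.relIndex_self]
  | succ n ih =>
    rw [pow_succ, sm_mul, ← AddSubgroup.relIndex_mul_relIndex (GS.sm (y ^ n) (GS.sm y H))
      (GS.sm (y ^ n) H) H (sm_mono _ h) (sm_pow_le h n), ih, relIndex_sm (pow_ne_zero _ hy), pow_succ']

lemma Few.sm_pow {n : ℕ} {y : L} (hy : y ≠ 0) {H : AddSubgroup L} (h : GS.sm y H ≤ H)
    (hf : Few n (GS.sm y H) H) (m : ℕ) : Few (n ^ m) (GS.sm (y ^ m) H) H := by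
  rw [few_iff] at *
  rw [relIndex_sm_pow hy h]
  exact ⟨pow_ne_zero _ hf.1, Nat.pow_le_pow_left hf.2 m⟩

lemma Few.of_sm_pow {n m : ℕ} (hm : m ≠ 0) {y : L} (hy : y ≠ 0) {H : AddSubgroup L}
    (h : GS.sm y H ≤ H) (hf : Few (n ^ m) (GS.sm (y ^ m) H) H) : Few n (GS.sm y H) H := by
  rw [few_iff] at *
  rw [relIndex_sm_pow hy h] at hf
  exact ⟨fun h0 => hf.1 (by rw [h0, zero_pow hm]), (Nat.pow_le_pow_iff_left hm).1 hf.2⟩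

/-- Commensurable groups have the same index of multiples. -/
lemma Few.commensurable {n l : ℕ} {y : L} (hy : y ≠ 0) {P Q : AddSubgroup L} (hQP : Q ≤ P)
    (hP : GS.sm y P ≤ P) (hQ : GS.sm y Q ≤ Q) (hfin : Few l Q P) (h : Few n (GS.sm y P) P) :
    Few n (GS.sm y Q) Q := by
  rw [few_iff] at *
  have h1 := AddSubgroup.relIndex_mul_relIndex (GS.sm y Q) Q P hQ hQP
  have h2 := AddSubgroup.relIndex_mul_relIndex (GS.sm y Q) (GS.sm y P) P (sm_mono _ hQP) hP
  rw [relIndex_sm hy, ← h1, mul_comm] at h2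
  rw [← mul_right_cancel₀ hfin.1 h2]
  exact h

/-- The sums `∑ e < r, p e * z ^ e` with `p e ∈ H e`. -/
def Sm (r : ℕ) (z : L) (H : ℕ → AddSubgroup L) : AddSubgroup L where
  carrier := {f | ∃ p : ℕ → L, (∀ e < r, p e ∈ H e) ∧ f = ∑ e ∈ Finset.range r, p e * z ^ e}
  zero_mem' := ⟨fun _ => 0, fun e _ => zero_mem _, by simp⟩
  add_mem' := by
    rintro _ _ ⟨p, hp, rfl⟩ ⟨p', hp', rfl⟩
    exact ⟨fun e => p e + p' e, fun e he => add_mem (hp e he) (hp' e he), by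
      rw [← Finset.sum_add_distrib]; exact Finset.sum_congr rfl fun e _ => by ring⟩
  neg_mem' := by
    rintro _ ⟨p, hp, rfl⟩
    exact ⟨fun e => - p e, fun e he => neg_mem (hp e he), by
      rw [← Finset.sum_neg_distrib]; exact Finset.sum_congr rfl fun e _ => by ring⟩

lemma mem_Sm {r : ℕ} {z f : L} {H : ℕ → AddSubgroup L} : f ∈ Sm r z H ↔
    ∃ p : ℕ → L, (∀ e < r, p e ∈ H e) ∧ f = ∑ e ∈ Finset.range r, p e * z ^ e := Iff.rfl

lemma single_mem_Sm {r e : ℕ} (he : e < r) {z f : L} {H : ℕ → AddSubgroup L} (hf : f ∈ H e) :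
    f * z ^ e ∈ Sm r z H := by
  refine ⟨fun i => if i = e then f else 0, fun i _ => ?_, ?_⟩
  · dsimp only
    split_ifs with h
    · rwa [h]
    · exact zero_mem _
  · rw [Finset.sum_eq_single e]
    · simp
    · intro b _ hb; simp [hb]
    · intro h; exact absurd (Finset.mem_range.2 he) h

lemma few_Sm {r : ℕ} (z : L) {H H' : ℕ → AddSubgroup L} {n : ℕ → ℕ}
    (h : ∀ e < r, Few (n e) (H e) (H' e)) :
    Few (∏ e ∈ Finset.range r, n e) (Sm r z H) (Sm r z H') := by
  choose φ hφ using fun e : Fin r => h e e.2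
  refine Few.of_fintype (ι := ∀ e : Fin r, Fin (n e)) ?_
    (fun i => ∑ e : Fin r, φ e (i e) * z ^ (e : ℕ)) ?_
  · rw [Fintype.card_pi, ← Fin.prod_univ_eq_prod_range]
    simp
  · rintro f ⟨p, hp, rfl⟩
    choose i hi using fun e : Fin r => hφ e (p e) (hp e e.2)
    refine ⟨i, ?_⟩
    rw [← Fin.sum_univ_eq_sum_range (fun e => p e * z ^ e), ← Finset.sum_sub_distrib]
    refine sum_mem fun e _ => ?_
    rw [← sub_mul]
    exact single_mem_Sm e.2 (hi e)

lemma sm_Sm (y z : L) {r : ℕ} (H : ℕ → AddSubgroup L) (hy : y ≠ 0) :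
    sm y (Sm r z H) = Sm r z fun e => sm y (H e) := by
  ext f
  rw [mem_sm, mem_Sm, mem_Sm]
  constructor
  · rintro ⟨p, hp, h⟩
    refine ⟨fun e => y * p e, fun e he => (mul_mem_sm hy).2 (hp e he), ?_⟩
    rw [← mul_inv_cancel_left₀ hy f, h, Finset.mul_sum]
    exact Finset.sum_congr rfl fun e _ => by ring
  · rintro ⟨p, hp, rfl⟩
    refine ⟨fun e => y⁻¹ * p e, fun e he => hp e he, ?_⟩
    rw [Finset.mul_sum]
    exact Finset.sum_congr rfl fun e _ => by ring

end Few

namespace Tower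

variable {F L : Type*} [Field F] [Fintype F] [Field L] [Algebra F L] [Algebra (RatFunc F) L]
  [IsScalarTower F (RatFunc F) L] {r : ℕ} {t : Tower F L r} {V : ValuationSubring L}

/-- Reduction of an element of the bottom field modulo a polynomial. -/
lemma exists_mod_base {Q : Polynomial F} (hQ : Q.Monic) {f : L} (hf : f ∈ t.K 0)
    (hreg : ∀ V ∈ t.Pos, V.valuation (Polynomial.aeval (t.x 0) Q) < 1 → f ∈ V) :
    ∃ P : Polynomial F, P.degree < Q.degree ∧ ∀ V ∈ t.Pos,
      V.valuation (Polynomial.aeval (t.x 0) Q) < 1 →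
      V.valuation (f - Polynomial.aeval (t.x 0) P) ≤ V.valuation (Polynomial.aeval (t.x 0) Q) := by
  obtain ⟨p, g, hg, hco, rfl⟩ := t.K_zero_repr hf
  have hco2 : IsCoprime g Q := by
    classical
    rw [← EuclideanDomain.gcd_isUnit_iff]
    by_contra hu
    have hne : EuclideanDomain.gcd g Q ≠ 0 := fun h => hg (EuclideanDomain.gcd_eq_zero_iff.1 h).1
    have hd : (EuclideanDomain.gcd g Q).natDegree ≠ 0 := fun h =>
      hu (Polynomial.isUnit_iff_degree_eq_zero.2 (by rw [Polynomial.degree_eq_natDegree hne, h]; rfl))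
    obtain ⟨V, hV, hlt⟩ := t.exists_val_poly hd
    have hsmall : ∀ h, EuclideanDomain.gcd g Q ∣ h → V.valuation (Polynomial.aeval (t.x 0) h) < 1 := by
      rintro _ ⟨u, rfl⟩
      rw [map_mul, map_mul, mul_comm]
      exact mul_lt_one_val ((V.valuation_le_one_iff _).2 (aeval_mem V (y := t.x 0) hV u)) hlt
    have h2 := hreg V hV (hsmall Q (EuclideanDomain.gcd_dvd_right _ _))
    have hg1 := hsmall g (EuclideanDomain.gcd_dvd_left _ _)
    rw [← V.valuation_le_one_iff, map_div₀,
      div_le_one₀ ((Valuation.pos_iff _).2 (t.aeval_x_zero_ne hg))] at h2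
    obtain ⟨a, b, hab⟩ := hco
    have h1 := congrArg (Polynomial.aeval (t.x 0)) hab
    rw [map_add, map_mul, map_mul, map_one] at h1
    have ha := (V.valuation_le_one_iff _).2 (aeval_mem V (y := t.x 0) hV a)
    have hb := (V.valuation_le_one_iff _).2 (aeval_mem V (y := t.x 0) hV b)
    have h3 : V.valuation (1 : L) < 1 := by
      rw [← h1]
      refine Valuation.map_add_lt _ ?_ ?_
      · rw [map_mul]; exact mul_lt_one_val ha (h2.trans_lt hg1)
      · rw [map_mul]; exact mul_lt_one_val hb hg1
    simp at h3
  obtain ⟨a, b, hab⟩ := hco2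
  refine ⟨(p * a) %ₘ Q, Polynomial.degree_modByMonic_lt _ hQ, fun V hV hlt => ?_⟩
  have h1 := congrArg (Polynomial.aeval (t.x 0)) hab
  have h2 := congrArg (Polynomial.aeval (t.x 0)) (Polynomial.modByMonic_add_div (p * a) Q)
  rw [map_add, map_mul, map_mul, map_one] at h1
  rw [map_add, map_mul, map_mul] at h2
  have hfV := hreg V hV hlt
  have hg0 := t.aeval_x_zero_ne hg
  set f := Polynomial.aeval (t.x 0) p / Polynomial.aeval (t.x 0) g with hfdef
  have h3 : Polynomial.aeval (t.x 0) p = f * Polynomial.aeval (t.x 0) g := by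
    rw [hfdef, div_mul_cancel₀ _ hg0]
  have e : f - Polynomial.aeval (t.x 0) ((p * a) %ₘ Q) =
      (Polynomial.aeval (t.x 0) b * f + Polynomial.aeval (t.x 0) ((p * a) /ₘ Q)) *
        Polynomial.aeval (t.x 0) Q := by
    linear_combination -f * h1 - h2 - Polynomial.aeval (t.x 0) a * h3
  rw [e, map_mul]
  refine mul_le_of_le_one_left zero_le ((V.valuation_le_one_iff _).2 ?_)
  exact add_mem (mul_mem (aeval_mem V (y := t.x 0) hV _) hfV) (aeval_mem V (y := t.x 0) hV _)

variable [IsAlgClosed L] [Algebra.IsAlgebraic (RatFunc F) L]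

/-- The coefficients of an element are bounded by its conjugates. -/
lemma exists_coeffs_bound {k : ℕ} {f : L} (hf : f ∈ t.K (k + 1)) :
    ∃ p : ℕ → L, (∀ e, p e ∈ t.K k) ∧ f = ∑ e ∈ Finset.range r, p e * t.x (k + 1) ^ e ∧
      ∀ (V : ValuationSubring L) (γ Z : V.ValueGroup), 1 ≤ Z → V.valuation (t.x (k + 1)) ≤ Z →
        (∀ σ, t.Fixes k σ → V.valuation (σ f) ≤ γ) → ∀ e < r, V.valuation (p e) ≤ γ * Z ^ (r * r) := by
  have hz : t.x (k + 1) - t.x (k + 1) ∈ t.K k := by rw [sub_self]; exact zero_mem _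
  obtain ⟨p, hp, rfl⟩ := t.exists_coeffs hz hf
  refine ⟨p, hp, rfl, fun V γ Z hZ1 hZ hγ => ?_⟩
  refine coeff_le_of_conj V.valuation t.card_Lam p _ hZ1 hZ fun a ha => ?_
  obtain ⟨σ, h1, h2⟩ := t.exists_aut k ha
  rw [← t.aut_sum h1 h2 hp hz]
  exact hγ σ h1

lemma exists_coeffs_mem {k : ℕ} {S : Set (ValuationSubring L)} (hS : t.Stable k S)
    (hx : ∀ V ∈ S, t.x (k + 1) ∈ V) {f : L} (hf : f ∈ t.O S (k + 1)) :
    ∃ p : ℕ → L, (∀ e < r, p e ∈ t.O S k) ∧ f = ∑ e ∈ Finset.range r, p e * t.x (k + 1) ^ e := by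
  obtain ⟨p, hp, h, hb⟩ := exists_coeffs_bound hf.1
  refine ⟨p, fun e he => ⟨hp e, fun V hV => ?_⟩, h⟩
  have := hb V 1 1 le_rfl ((V.valuation_le_one_iff _).2 (hx V hV)) (fun σ hσ =>
    (V.valuation_le_one_iff _).2 (conj_mem_of_stable hS hf.2 hσ hV)) e he
  rwa [one_pow, mul_one, V.valuation_le_one_iff] at this

lemma Zs_T_succ {i : ℕ} (hV : V ∈ t.Zs i) : V.valuation (T r (t.x (i + 1))) ≤
    V.valuation (T r (t.x 0)) ∧ V.valuation (T r (t.x (i + 1))) < 1 := by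
  have h := hV i le_rfl
  have h1 := tau_lt_one_of_Zs hV
  rw [val_T_succ_of_lt_one h, Zs_val hV le_rfl, ← pow_mul]
  have : r ^ i * r ≠ 0 := mul_ne_zero (pow_ne_zero _ t.r_ne) t.r_ne
  exact ⟨pow_le_of_le_one zero_le h1.le this, pow_lt_one₀ zero_le h1 this⟩

lemma Zs_x_succ_mem {i : ℕ} (hV : V ∈ t.Zs i) : t.x (i + 1) ∈ V :=
  (V.valuation_le_one_iff _).1 (val_le_one_of_T _ t.two_le (Zs_T_succ hV).2.le)

lemma exists_mod_succ {i : ℕ}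
    (hres : ∀ f ∈ t.O (t.Zs i) i, ∃ c : F, ∀ V ∈ t.Zs i,
      V.valuation (f - algebraMap F L c) ≤ V.valuation (T r (t.x 0)))
    {Q Q' : Polynomial F} (hQ : Q.Monic) (hQQ : Q * Q' = Polynomial.X ^ r + Polynomial.X)
    (hco : IsCoprime Q Q') {f : L} (hf : f ∈ t.K (i + 1))
    (hreg : ∀ V ∈ t.Zs i, V.valuation (Polynomial.aeval (t.x (i + 1)) Q) < 1 → f ∈ V) :
    ∃ P : Polynomial F, P.degree < Q.degree ∧ ∀ V ∈ t.Zs i,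
      V.valuation (Polynomial.aeval (t.x (i + 1)) Q) < 1 →
      V.valuation (f - Polynomial.aeval (t.x (i + 1)) P) ≤ V.valuation (T r (t.x 0)) := by
  obtain ⟨B, hB⟩ := exists_pole_bound (i + 1) f hf
  set y := t.x (i + 1) with hy
  set ev := Polynomial.aeval (R := F) y with hev
  have hTy : ev Q * ev Q' = T r y := by
    rw [← map_mul, hQQ, hev]; simp [T]
  have hyV : ∀ V ∈ t.Zs i, ∀ P, ev P ∈ V := fun V hV P => aeval_mem V (Zs_x_succ_mem hV) P
  have hF : f * ev Q' ^ B ∈ t.O (t.Zs i) (i + 1) := by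
    refine ⟨mul_mem hf (pow_mem (t.aeval_mem_K _ _ (t.x_mem_self _)) _), fun V hV => ?_⟩
    by_cases hlt : V.valuation (ev Q) < 1
    · exact mul_mem (hreg V hV hlt) (pow_mem (hyV V hV _) _)
    · have h1 := le_antisymm ((V.valuation_le_one_iff _).2 (hyV V hV Q)) (not_lt.1 hlt)
      have h2 := congrArg V.valuation hTy
      rw [map_mul, h1, one_mul] at h2
      rw [← V.valuation_le_one_iff, map_mul, map_pow, h2]
      refine le_trans ?_ (hB V (t.Zs_subset_Pos i hV) (tau_lt_one_of_Zs hV))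
      exact mul_le_mul_right (pow_le_pow_left₀ zero_le (Zs_T_succ hV).1 _) _
  obtain ⟨p, hp, hFp⟩ := exists_coeffs_mem (stable_Zs le_rfl) (fun V hV => Zs_x_succ_mem hV) hF
  choose! c hc using hres
  set P₀ : Polynomial F := ∑ e ∈ Finset.range r, Polynomial.C (c (p e)) * Polynomial.X ^ e with hP₀
  have h0 : ∀ V ∈ t.Zs i, V.valuation (f * ev Q' ^ B - ev P₀) ≤ V.valuation (T r (t.x 0)) := by
    intro V hV
    have : f * ev Q' ^ B - ev P₀ =
        ∑ e ∈ Finset.range r, (p e - algebraMap F L (c (p e))) * y ^ e := by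
      rw [hFp, hP₀, map_sum, ← Finset.sum_sub_distrib]
      refine Finset.sum_congr rfl fun e _ => ?_
      simp [hev, sub_mul, hy]
    rw [this]
    refine Valuation.map_sum_le _ fun e he => ?_
    rw [map_mul]
    exact (mul_le_of_le_one_right zero_le ((V.valuation_le_one_iff _).2
      (pow_mem (Zs_x_succ_mem hV) e))).trans (hc _ (hp e (Finset.mem_range.1 he)) V hV)
  obtain ⟨b, a, hab⟩ := hco.pow_right (n := B)
  refine ⟨(P₀ * a) %ₘ Q, Polynomial.degree_modByMonic_lt _ hQ, fun V hV hlt => ?_⟩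
  have hQ1 : V.valuation (ev Q) ≤ V.valuation (T r (t.x 0)) := by
    obtain ⟨u, v, huv⟩ := hco
    have h1 := congrArg ev huv
    rw [map_add, map_mul, map_mul, map_one] at h1
    have h2 : V.valuation (ev Q') = 1 := by
      refine le_antisymm ((V.valuation_le_one_iff _).2 (hyV V hV Q')) ?_
      by_contra! h3
      have h4 : V.valuation (1 : L) < 1 := by
        rw [← h1]
        refine Valuation.map_add_lt _ ?_ ?_
        · rw [map_mul]; exact mul_lt_one_val ((V.valuation_le_one_iff _).2 (hyV V hV _)) hlt
        · rw [map_mul]; exact mul_lt_one_val ((V.valuation_le_one_iff _).2 (hyV V hV _)) h3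
      simp at h4
    have h5 := congrArg V.valuation hTy
    rw [map_mul, h2, mul_one] at h5
    rw [h5]; exact (Zs_T_succ hV).1
  have h1 := congrArg ev hab
  have h2 := congrArg ev (Polynomial.modByMonic_add_div (P₀ * a) Q)
  rw [map_add, map_mul, map_mul, map_one, map_pow] at h1
  rw [map_add, map_mul, map_mul] at h2
  have hfV := hreg V hV hlt
  have e : f - ev ((P₀ * a) %ₘ Q) =
      ev a * (f * ev Q' ^ B - ev P₀) + (ev b * f + ev ((P₀ * a) /ₘ Q)) * ev Q := by
    linear_combination -f * h1 - h2
  rw [e]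
  refine (V.valuation.map_add _ _).trans (max_le ?_ ?_)
  · rw [map_mul]
    exact (mul_le_of_le_one_left zero_le ((V.valuation_le_one_iff _).2 (hyV V hV _))).trans (h0 V hV)
  · rw [map_mul]
    refine (mul_le_of_le_one_left zero_le ((V.valuation_le_one_iff _).2 ?_)).trans hQ1
    exact add_mem (mul_mem (hyV V hV _) hfV) (hyV V hV _)

variable (F) in
lemma coprime_X_w (hr : 2 ≤ r) :
    IsCoprime (Polynomial.X : Polynomial F) (Polynomial.X ^ (r - 1) + 1) :=
  ⟨-Polynomial.X ^ (r - 2), 1, by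
    have : r - 1 = r - 2 + 1 := by omega
    rw [this, pow_succ]; ring⟩

variable (F) in
lemma X_mul_w (hr : 2 ≤ r) : (Polynomial.X : Polynomial F) * (Polynomial.X ^ (r - 1) + 1) =
    Polynomial.X ^ r + Polynomial.X := by
  have : r = r - 1 + 1 := by omega
  rw [mul_add, mul_one, ← pow_succ', ← this]

/-- The residue field at the common zero of `x 0, …, x i` is the constant field. -/
lemma exists_residue_Zs (i : ℕ) : ∀ f ∈ t.O (t.Zs i) i, ∃ c : F, ∀ V ∈ t.Zs i,
    V.valuation (f - algebraMap F L c) ≤ V.valuation (T r (t.x 0)) := by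
  induction i with
  | zero =>
    intro f hf
    have hZ : ∀ V : ValuationSubring L, V.valuation (t.x 0) < 1 → V ∈ t.Zs 0 := by
      intro V h l hl
      obtain rfl : l = 0 := by omega
      exact h
    obtain ⟨P, hP, h⟩ := exists_mod_base Polynomial.monic_X hf.1 (fun V _ hlt => hf.2 V (hZ V (by
      rwa [Polynomial.aeval_X] at hlt)))
    rw [Polynomial.degree_X] at hP
    obtain ⟨c, rfl⟩ : ∃ c, P = Polynomial.C c :=
      ⟨_, Polynomial.eq_C_of_degree_le_zero (Nat.WithBot.lt_one_iff_le_zero.1 hP)⟩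
    refine ⟨c, fun V hV => ?_⟩
    have := h V (t.Zs_subset_Pos 0 hV) (by rw [Polynomial.aeval_X]; exact hV 0 le_rfl)
    rwa [Polynomial.aeval_X, Polynomial.aeval_C, ← val_T_of_lt_one _ t.two_le (hV 0 le_rfl)] at this
  | succ i ih =>
    intro f hf
    have hlift : ∀ V ∈ t.Zs i, V.valuation (t.x (i + 1)) < 1 → V ∈ t.Zs (i + 1) := by
      intro V hV h l hl
      rcases Nat.lt_or_ge i l with h1 | h1
      · obtain rfl : l = i + 1 := by omega
        exact h
      · exact hV l h1
    obtain ⟨P, hP, h⟩ := exists_mod_succ ih Polynomial.monic_X (X_mul_w F t.two_le)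
      (coprime_X_w F t.two_le) hf.1 (fun V hV hlt => hf.2 V (hlift V hV (by
        rwa [Polynomial.aeval_X] at hlt)))
    rw [Polynomial.degree_X] at hP
    obtain ⟨c, rfl⟩ : ∃ c, P = Polynomial.C c :=
      ⟨_, Polynomial.eq_C_of_degree_le_zero (Nat.WithBot.lt_one_iff_le_zero.1 hP)⟩
    refine ⟨c, fun V hV => ?_⟩
    have := h V (fun l hl => hV l (by omega)) (by rw [Polynomial.aeval_X]; exact hV _ le_rfl)
    rwa [Polynomial.aeval_C] at this

lemma exists_mod_Ty (j : ℕ) {f : L} (hf : f ∈ t.O (t.Ty j) j) :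
    ∃ P : Polynomial F, P.degree < ((r - 1 : ℕ) : WithBot ℕ) ∧ ∀ V ∈ t.Ty j,
      V.valuation (f - Polynomial.aeval (t.x j) P) ≤ V.valuation (T r (t.x 0)) := by
  have hr := t.two_le
  have hmon : (Polynomial.X ^ (r - 1) + 1 : Polynomial F).Monic :=
    Polynomial.monic_X_pow_add (n := r - 1) (by
      rw [Polynomial.degree_one]; exact_mod_cast (by omega : 0 < r - 1))
  have hdeg : (Polynomial.X ^ (r - 1) + 1 : Polynomial F).degree = ((r - 1 : ℕ) : WithBot ℕ) := by
    have := Polynomial.degree_X_pow_add_C (n := r - 1) (by omega) (1 : F)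
    rwa [Polynomial.C_1] at this
  have haev : ∀ i, Polynomial.aeval (t.x i) (Polynomial.X ^ (r - 1) + 1 : Polynomial F) = t.w i := by
    intro i; simp [w]
  cases j with
  | zero =>
    have hT : ∀ V : ValuationSubring L, V.valuation (t.w 0) < 1 → V ∈ t.Ty 0 :=
      fun V h => ⟨fun i hi => by omega, h⟩
    obtain ⟨P, hP, h⟩ := exists_mod_base hmon hf.1 (fun V _ hlt => hf.2 V (hT V (by
      rwa [haev] at hlt)))
    refine ⟨P, hdeg ▸ hP, fun V hV => ?_⟩
    have h1 := h V (x_zero_le_of_Ty hV) (by rw [haev]; exact hV.2)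
    rwa [haev, Ty_val_w hV, pow_zero, pow_one] at h1
  | succ i =>
    obtain ⟨P, hP, h⟩ := exists_mod_succ (exists_residue_Zs i) hmon
      (by rw [mul_comm]; exact X_mul_w F hr) (coprime_X_w F hr).symm hf.1
      (fun V hV hlt => hf.2 V ⟨fun l hl => hV l (by omega), by rwa [haev] at hlt⟩)
    refine ⟨P, hdeg ▸ hP, fun V hV => ?_⟩
    exact h V (t.Ty_subset_Zs (Nat.lt_succ_self i) hV) (by rw [haev]; exact hV.2)

end Tower

lemma Few.mono_left {L : Type*} [Field L] {n : ℕ} {H H' K : AddSubgroup L} (h : Few n H K)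
    (hH : H ≤ H') : Few n H' K := by
  obtain ⟨φ, hφ⟩ := h
  exact ⟨φ, fun f hf => (hφ f hf).imp fun i hi => hH hi⟩

lemma Sm_mono {L : Type*} [Field L] {r : ℕ} {z : L} {H H' : ℕ → AddSubgroup L}
    (h : ∀ e < r, H e ≤ H' e) : Sm r z H ≤ Sm r z H' := by
  rintro _ ⟨p, hp, rfl⟩
  exact ⟨p, fun e he => h e he (hp e he), rfl⟩

namespace Tower

variable {F L : Type*} [Field F] [Fintype F] [Field L] [Algebra F L] [Algebra (RatFunc F) L]
  [IsScalarTower F (RatFunc F) L] {r : ℕ} {t : Tower F L r} {V : ValuationSubring L}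

/-- The additive group of the elements of the `k`-th field regular on `S`. -/
def R (t : Tower F L r) (S : Set (ValuationSubring L)) (k : ℕ) : AddSubgroup L :=
  (t.O S k).toAddSubgroup

lemma mem_R {S : Set (ValuationSubring L)} {k : ℕ} {f : L} :
    f ∈ t.R S k ↔ f ∈ t.K k ∧ ∀ V ∈ S, f ∈ V := Iff.rfl

lemma mem_sm_R {S : Set (ValuationSubring L)} {k : ℕ} {y f : L} (hy : y ∈ t.K k) (hy0 : y ≠ 0) :
    f ∈ sm y (t.R S k) ↔ f ∈ t.K k ∧ ∀ V ∈ S, V.valuation f ≤ V.valuation y := by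
  rw [mem_sm, mem_R]
  refine and_congr ⟨fun h => ?_, fun h => mul_mem (inv_mem hy) h⟩
    (forall₂_congr fun V _ => by rw [val_le_iff_div_mem V hy0, div_eq_inv_mul])
  have := mul_mem hy h
  rwa [mul_inv_cancel_left₀ hy0] at this

lemma sm_R_le {S : Set (ValuationSubring L)} {k : ℕ} {y : L} (hy : y ∈ t.K k) (hy0 : y ≠ 0)
    (h1 : ∀ V ∈ S, V.valuation y ≤ 1) : sm y (t.R S k) ≤ t.R S k := by
  intro f hf
  rw [mem_sm_R hy hy0] at hf
  exact ⟨hf.1, fun V hV => (V.valuation_le_one_iff _).1 ((hf.2 V hV).trans (h1 V hV))⟩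

lemma T_zero_mem (k : ℕ) : T r (t.x 0) ∈ t.K k := t.T_mem (t.x_mem (Nat.zero_le k))

lemma aeval_eq_sum_of_degree_lt {n : ℕ} (hn : n ≠ 0) {P : Polynomial F}
    (h : P.degree < (n : WithBot ℕ)) (y : L) :
    Polynomial.aeval y P = ∑ e : Fin n, algebraMap F L (P.coeff e) * y ^ (e : ℕ) := by
  have hd : P.natDegree < n := by
    by_cases hP : P = 0
    · subst hP; simpa using Nat.pos_of_ne_zero hn
    · exact (Polynomial.natDegree_lt_iff_degree_lt hP).2 h
  rw [Polynomial.aeval_eq_sum_range' hd, ← Fin.sum_univ_eq_sum_range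
    (fun i => P.coeff i • y ^ i)]
  exact Finset.sum_congr rfl fun e _ => Algebra.smul_def _ _

lemma few_of_mod {n : ℕ} (hn : n ≠ 0) (t : Tower F L r) {H K : AddSubgroup L} (y : L)
    (h : ∀ f ∈ K, ∃ P : Polynomial F, P.degree < (n : WithBot ℕ) ∧ f - Polynomial.aeval y P ∈ H) :
    Few ((r ^ 2) ^ n) H K := by
  refine Few.of_fintype (ι := Fin n → F) (by simp [t.card])
    (fun c => ∑ e : Fin n, algebraMap F L (c e) * y ^ (e : ℕ)) fun f hf => ?_
  obtain ⟨P, hP, h1⟩ := h f hf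
  refine ⟨fun e => P.coeff e, ?_⟩
  rwa [← aeval_eq_sum_of_degree_lt hn hP]

variable [IsAlgClosed L] [Algebra.IsAlgebraic (RatFunc F) L]

lemma few_succ {k : ℕ} {S : Set (ValuationSubring L)} (hS : t.Stable k S) (hSP : S ⊆ t.Pos) {N : ℕ}
    (hN : ∀ V ∈ S, V.valuation (t.x (k + 1)) * V.valuation (T r (t.x 0)) ^ N ≤ 1) {w : L}
    (hw : w ∈ t.K k) (hw0 : w ≠ 0) (hw1 : ∀ V ∈ S, V.valuation w ≤ 1) {l m : ℕ}
    (hl : Few l (sm (T r (t.x 0)) (t.R S k)) (t.R S k)) (hm : Few m (sm w (t.R S k)) (t.R S k)) :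
    Few (m ^ r) (sm w (t.R S (k + 1))) (t.R S (k + 1)) := by
  have hτ0 := t.T_ne 0
  have hτK := T_zero_mem (t := t) k
  have hτ1 : ∀ V ∈ S, V.valuation (T r (t.x 0)) ≤ 1 := fun V hV => tau_le_one (hSP hV)
  set τ := T r (t.x 0) with hτ
  set M := N * (r * r) with hM
  have hM0 : (τ ^ M)⁻¹ ≠ 0 := inv_ne_zero (pow_ne_zero _ hτ0)
  have hMK : (τ ^ M)⁻¹ ∈ t.K k := inv_mem (pow_mem hτK _)
  set D := sm (τ ^ M)⁻¹ (t.R S k) with hD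
  have hDle : ∀ y ∈ t.K k, y ≠ 0 → (∀ V ∈ S, V.valuation y ≤ 1) → sm y D ≤ D := by
    intro y hy hy0 hy1
    rw [hD, ← sm_mul, mul_comm, sm_mul]
    exact sm_mono _ (sm_R_le hy hy0 hy1)
  have hPle : ∀ y ∈ t.K k, y ≠ 0 → (∀ V ∈ S, V.valuation y ≤ 1) →
      sm y (Sm r (t.x (k + 1)) fun _ => D) ≤ Sm r (t.x (k + 1)) fun _ => D := by
    intro y hy hy0 hy1
    rw [sm_Sm _ _ _ hy0]
    exact Sm_mono fun e _ => hDle y hy hy0 hy1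
  have hfew : ∀ {y : L} {n : ℕ}, y ≠ 0 → Few n (sm y (t.R S k)) (t.R S k) →
      Few (n ^ r) (sm y (Sm r (t.x (k + 1)) fun _ => D)) (Sm r (t.x (k + 1)) fun _ => D) := by
    intro y n hy hn
    rw [sm_Sm _ _ _ hy]
    have : n ^ r = ∏ e ∈ Finset.range r, n := by simp
    rw [this]
    refine few_Sm _ fun e _ => ?_
    rw [hD, ← sm_mul, mul_comm y, sm_mul]
    exact hn.sm hM0
  refine Few.commensurable hw0 (P := Sm r (t.x (k + 1)) fun _ => D) (l := (l ^ r) ^ (M + N * r))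
    ?_ (hPle w hw hw0 hw1) (sm_R_le (t.K_le_succ k hw) hw0 hw1) ?_ (hfew hw0 hm)
  · intro f hf
    obtain ⟨p, hp, h, hb⟩ := exists_coeffs_bound hf.1
    refine ⟨p, fun e he => (mem_sm_R hMK hM0).2 ⟨hp e, fun V hV => ?_⟩, h⟩
    have hpos : 0 < V.valuation τ ^ N := pow_pos ((Valuation.pos_iff _).2 hτ0) N
    have := hb V 1 (V.valuation τ ^ N)⁻¹ ((one_le_inv₀ hpos).2 (pow_le_one' (hτ1 V hV) _))
      (by rw [← one_div, le_div_iff₀ hpos]; exact hN V hV) (fun σ hσ =>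
        (V.valuation_le_one_iff _).2 (conj_mem_of_stable hS hf.2 hσ hV)) e he
    rwa [one_mul, inv_pow, ← pow_mul, ← hM, ← map_pow, ← map_inv₀] at this
  · refine ((hfew hτ0 hl).sm_pow hτ0 (hPle _ hτK hτ0 hτ1) (M + N * r)).mono_left ?_
    rw [sm_Sm _ _ _ (pow_ne_zero _ hτ0)]
    rintro _ ⟨p, hp, rfl⟩
    refine sum_mem fun e he => ?_
    have he := (Finset.mem_range.1 he).le
    have h1 := hp e (Finset.mem_range.1 ‹_›)
    have e1 : τ ^ (M + N * r) * (τ ^ M)⁻¹ = τ ^ (N * r) := by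
      rw [pow_add, mul_comm, inv_mul_cancel_left₀ (pow_ne_zero _ hτ0)]
    rw [hD, ← sm_mul, e1, mem_sm_R (pow_mem hτK _) (pow_ne_zero _ hτ0)] at h1
    refine ⟨mul_mem (t.K_le_succ k h1.1) (pow_mem (t.x_mem_self _) _), fun V hV => ?_⟩
    rw [← V.valuation_le_one_iff, map_mul, map_pow]
    have h2 := h1.2 V hV
    rw [map_pow, pow_mul] at h2
    have h3 : (V.valuation τ ^ N) ^ r ≤ (V.valuation τ ^ N) ^ e :=
      pow_anti_val (pow_le_one' (hτ1 V hV) _) he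
    calc _ ≤ (V.valuation τ ^ N) ^ e * V.valuation (t.x (k + 1)) ^ e :=
          mul_le_mul_left (h2.trans h3) _
      _ = (V.valuation (t.x (k + 1)) * V.valuation τ ^ N) ^ e := by rw [mul_comm, mul_pow]
      _ ≤ 1 := pow_le_one' (hN V hV) _

lemma few_Ty (j i : ℕ) : Few (((r ^ 2) ^ (r - 1)) ^ r ^ i)
    (sm (T r (t.x 0)) (t.R (t.Ty j) (j + i))) (t.R (t.Ty j) (j + i)) := by
  have hr := t.two_le
  induction i with
  | zero =>
    rw [pow_zero, pow_one, add_zero]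
    refine few_of_mod (by omega) t (t.x j) fun f hf => ?_
    obtain ⟨P, hP, h⟩ := exists_mod_Ty j hf
    refine ⟨P, hP, (mem_sm_R (T_zero_mem j) (t.T_ne 0)).2 ⟨?_, h⟩⟩
    exact sub_mem hf.1 (t.aeval_mem_K _ _ (t.x_mem_self j))
  | succ i ih =>
    rw [pow_succ r i, pow_mul]
    refine few_succ (N := r ^ j) (stable_Ty (Nat.le_add_right j i)) (fun V hV => x_zero_le_of_Ty hV)
      (fun V hV => ?_) (T_zero_mem _) (t.T_ne 0) (fun V hV => (tau_lt_one_of_Ty hV).le) ih ih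
    obtain ⟨h1, h2⟩ := Ty_big hV i
    rw [← Ty_val_T hV]
    refine (mul_le_mul_left (le_self_pow₀ h1.le (pow_ne_zero (i + 1) t.r_ne)) _).trans ?_
    rw [h2, inv_mul_cancel₀ (t.val_T_pos j).ne']

lemma few_Ty_t (j i : ℕ) : Few ((r ^ 2) ^ ((r - 1) * r ^ j))
    (sm (T r (t.x (j + (j + i) + 1)))⁻¹ (t.R (t.Ty j) (j + (j + i)))) (t.R (t.Ty j) (j + (j + i))) := by
  have hr := t.two_le
  have ht0 : (T r (t.x (j + (j + i) + 1)))⁻¹ ≠ 0 := inv_ne_zero (t.T_ne _)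
  have htK : (T r (t.x (j + (j + i) + 1)))⁻¹ ∈ t.K (j + (j + i)) := inv_mem (t.T_x_succ_mem _)
  have hval : ∀ V ∈ t.Ty j, V.valuation ((T r (t.x (j + (j + i) + 1)))⁻¹) ^ r ^ i =
      V.valuation (T r (t.x 0)) := by
    intro V hV
    have := Ty_val_t hV (j + i)
    rw [pow_add, mul_comm, pow_mul] at this
    exact (pow_left_inj₀ zero_le zero_le (pow_ne_zero j t.r_ne)).1 this
  refine Few.of_sm_pow (pow_ne_zero i t.r_ne) ht0 (sm_R_le htK ht0 fun V hV => ?_) ?_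
  · refine (pow_le_one_iff (pow_ne_zero i t.r_ne)).1 ?_
    rw [hval V hV]
    exact (tau_lt_one_of_Ty hV).le
  · have h := few_Ty (t := t) j (j + i)
    have e1 : ((r ^ 2) ^ (r - 1)) ^ r ^ (j + i) = ((r ^ 2) ^ ((r - 1) * r ^ j)) ^ r ^ i := by
      rw [pow_add, pow_mul, pow_mul (r ^ 2)]
    rw [← e1]
    refine h.mono_left fun f hf => ?_
    rw [mem_sm_R (T_zero_mem _) (t.T_ne 0)] at hf
    rw [mem_sm_R (pow_mem htK _) (pow_ne_zero _ ht0)]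
    refine ⟨hf.1, fun V hV => ?_⟩
    rw [map_pow, hval V hV]
    exact hf.2 V hV

/-- The regular elements of the `k`-th field that are divisible by `1 / T (x (k + 1))` at the rings
of type less than `J`. -/
def A (t : Tower F L r) (k J : ℕ) : AddSubgroup L where
  carrier := {f | f ∈ t.R t.Pos k ∧ ∀ j < J, ∀ V ∈ t.Ty j,
    V.valuation f ≤ V.valuation (T r (t.x (k + 1)))⁻¹}
  zero_mem' := ⟨zero_mem _, fun j _ V _ => by rw [map_zero]; exact zero_le⟩
  add_mem' h1 h2 := ⟨add_mem h1.1 h2.1, fun j hj V hV =>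
    (V.valuation.map_add _ _).trans (max_le (h1.2 j hj V hV) (h2.2 j hj V hV))⟩
  neg_mem' h1 := ⟨neg_mem h1.1, fun j hj V hV => by rw [Valuation.map_neg]; exact h1.2 j hj V hV⟩

lemma few_A (k : ℕ) : ∀ J, J ≤ k / 2 + 1 →
    Few ((r ^ 2) ^ (r ^ J - 1)) (t.A k J) (t.R t.Pos k) := by
  have hr := t.two_le
  intro J
  induction J with
  | zero =>
    intro _
    exact ((few_self (t.R t.Pos k)).mono_left (H' := t.A k 0)
      (fun f hf => ⟨hf, fun j hj => by omega⟩)).mono (by simp)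
  | succ J ih =>
    intro hJ
    have h1 := ih (by omega)
    have h2 := few_Ty_t (t := t) J (k - 2 * J)
    rw [show J + (J + (k - 2 * J)) = k by omega] at h2
    have e : r ^ (J + 1) - 1 = (r ^ J - 1) + (r - 1) * r ^ J := by
      have : 1 ≤ r ^ J := Nat.one_le_pow _ _ (by omega)
      obtain ⟨s, rfl⟩ : ∃ s, r = s + 1 := ⟨r - 1, by omega⟩
      rw [Nat.add_sub_cancel, pow_succ, mul_add, mul_one, mul_comm s]
      omega
    rw [e, pow_add]
    refine (h1.inf (h2.anti (K' := t.R t.Pos k) (O_anti (fun V hV => x_zero_le_of_Ty hV) k))).mono_left ?_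
    intro f hf
    refine ⟨hf.1.1, fun j hj V hV => ?_⟩
    rcases Nat.lt_or_ge j J with hjJ | hjJ
    · exact hf.1.2 j hjJ V hV
    · obtain rfl : j = J := by omega
      exact ((mem_sm_R (inv_mem (t.T_x_succ_mem k)) (inv_ne_zero (t.T_ne _))).1 hf.2).2 V hV

lemma few_Pos (k : ℕ) : Few ((r ^ 2) ^ (r * r ^ k)) (sm (T r (t.x 0)) (t.R t.Pos k)) (t.R t.Pos k) := by
  have hr := t.two_le
  induction k with
  | zero =>
    rw [pow_zero, mul_one]
    refine few_of_mod t.r_ne t (t.x 0) fun f hf => ?_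
    obtain ⟨p, rfl⟩ := O_zero_repr hf
    have hdeg : (Polynomial.X : Polynomial F).degree < (r : WithBot ℕ) := by
      rw [Polynomial.degree_X]; exact_mod_cast hr
    have hmon : (Polynomial.X ^ r + Polynomial.X : Polynomial F).Monic :=
      Polynomial.monic_X_pow_add hdeg
    have hQ : (Polynomial.X ^ r + Polynomial.X : Polynomial F).degree = (r : WithBot ℕ) := by
      rw [Polynomial.degree_add_eq_left_of_degree_lt, Polynomial.degree_X_pow]
      rwa [Polynomial.degree_X_pow]
    refine ⟨p %ₘ (Polynomial.X ^ r + Polynomial.X), ?_, ?_⟩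
    · rw [← hQ]; exact Polynomial.degree_modByMonic_lt _ hmon
    · have h1 := congrArg (Polynomial.aeval (t.x 0))
        (Polynomial.modByMonic_add_div p (Polynomial.X ^ r + Polynomial.X))
      rw [map_add, map_mul] at h1
      have e : Polynomial.aeval (t.x 0) (Polynomial.X ^ r + Polynomial.X : Polynomial F) =
        T r (t.x 0) := by simp [T]
      rw [e] at h1
      rw [← h1, add_sub_cancel_left, mul_mem_sm (t.T_ne 0)]
      exact aeval_mem_O ⟨t.x_mem_self 0, fun V hV => hV⟩ _
  | succ k ih =>
    rw [pow_succ r k, ← mul_assoc, pow_mul]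
    obtain ⟨N, hN⟩ := exists_pole_bound (k + 1) _ (t.x_mem_self (k + 1))
    refine few_succ (N := N) (stable_Pos k) le_rfl (fun V hV => ?_) (T_zero_mem _) (t.T_ne 0)
      (fun V hV => tau_le_one hV) ih ih
    by_cases hlt : V.valuation (T r (t.x 0)) < 1
    · exact hN V hV hlt
    · rw [(unit_val hV hlt _).1, (unit_val hV hlt _).2, one_pow, one_mul]

end Tower

section Few

variable {L : Type*} [Field L]

lemma Few.trans {n m : ℕ} {H' H K : AddSubgroup L} (h : Few n H K) (h' : Few m H' H) :
    Few (n * m) H' K := by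
  obtain ⟨φ, hφ⟩ := h
  obtain ⟨ψ, hψ⟩ := h'
  refine Few.of_fintype (ι := Fin n × Fin m) (by simp) (fun i => φ i.1 + ψ i.2) fun f hf => ?_
  obtain ⟨i, hi⟩ := hφ f hf
  obtain ⟨j, hj⟩ := hψ _ hi
  exact ⟨(i, j), by rwa [← sub_sub]⟩

lemma mem_sm_inv {y f : L} {H : AddSubgroup L} : f ∈ sm y⁻¹ H ↔ y * f ∈ H := by
  rw [mem_sm, inv_inv]

lemma card_sm {y : L} (hy : y ≠ 0) (H : AddSubgroup L) : Nat.card (sm y H) = Nat.card H :=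
  Nat.card_congr
    { toFun := fun f => ⟨y⁻¹ * f, f.2⟩
      invFun := fun f => ⟨y * f, (mul_mem_sm hy).2 f.2⟩
      left_inv := fun _ => Subtype.ext (mul_inv_cancel_left₀ hy _)
      right_inv := fun _ => Subtype.ext (inv_mul_cancel_left₀ hy _) }

lemma card_Sm {r : ℕ} {z : L} {H : ℕ → AddSubgroup L}
    (h : ∀ p : ℕ → L, (∀ e < r, p e ∈ H e) → ∑ e ∈ Finset.range r, p e * z ^ e = 0 →
      ∀ e < r, p e = 0) :
    Nat.card (Sm r z H) = ∏ e ∈ Finset.range r, Nat.card (H e) := by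
  rw [← Fin.prod_univ_eq_prod_range (fun e => Nat.card (H e)), ← Nat.card_pi]
  symm
  let g : (∀ e : Fin r, H e) → L := fun p => ∑ e : Fin r, (p e : L) * z ^ (e : ℕ)
  have hg : ∀ p, g p ∈ Sm r z H := fun p => sum_mem fun e _ => single_mem_Sm e.2 (p e).2
  refine Nat.card_congr (Equiv.ofBijective (fun p => (⟨g p, hg p⟩ : Sm r z H)) ⟨?_, ?_⟩)
  · intro p p' hpp
    have h1 : g p = g p' := congrArg Subtype.val hpp
    funext e
    have := h (fun i => if hi : i < r then (p ⟨i, hi⟩ : L) - p' ⟨i, hi⟩ else 0)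
      (fun i hi => by
        dsimp only
        rw [dif_pos hi]
        exact sub_mem (p ⟨i, hi⟩).2 (p' ⟨i, hi⟩).2)
      (by
        refine Eq.trans ?_ (sub_eq_zero.2 h1)
        rw [← Finset.sum_sub_distrib, ← Fin.sum_univ_eq_sum_range
          (fun i => (if hi : i < r then (p ⟨i, hi⟩ : L) - p' ⟨i, hi⟩ else 0) * z ^ i)]
        exact Finset.sum_congr rfl fun e _ => by rw [dif_pos e.2, sub_mul]) e e.2
    rw [dif_pos e.2, sub_eq_zero] at this
    exact Subtype.ext this
  · rintro ⟨f, p, hp, rfl⟩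
    refine ⟨fun e => ⟨p e, hp e e.2⟩, Subtype.ext ?_⟩
    exact Fin.sum_univ_eq_sum_range (fun e => p e * z ^ e) r

end Few

/-- The bound `a k` for the deficiency of the dimension of the `k`-th field. -/
def ax (r : ℕ) : ℕ → ℕ
  | 0 => 0
  | k + 1 => r * ax r k + (r - 1) * (r ^ (k / 2 + 1) - 1)

lemma ax_add (r : ℕ) (hr : 2 ≤ r) (k : ℕ) :
    ax r k + (r ^ (k / 2 + 1) - 1) + r ^ ((k + 1) / 2) = r ^ (k + 1) := by
  induction k with
  | zero => simp [ax]; omega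
  | succ k ih =>
    have e : (k + 1 + 1) / 2 = k / 2 + 1 := by omega
    rw [ax, e]
    have h1 : 1 ≤ r ^ (k / 2 + 1) := Nat.one_le_pow _ _ (by omega)
    have h2 : 1 ≤ r ^ ((k + 1) / 2 + 1) := Nat.one_le_pow _ _ (by omega)
    zify [h1, h2, (by omega : 1 ≤ r)] at ih ⊢
    rw [pow_succ _ (k + 1), pow_succ _ ((k + 1) / 2), ← ih]
    ring

lemma ax_le (r : ℕ) (hr : 2 ≤ r) (k : ℕ) : ax r k + (r ^ (k / 2 + 1) - 1) ≤ r ^ (k + 1) := by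
  have := ax_add r hr k
  omega

namespace Tower

variable {F L : Type*} [Field F] [Fintype F] [Field L] [Algebra F L] [Algebra (RatFunc F) L]
  [IsScalarTower F (RatFunc F) L] {r : ℕ} {t : Tower F L r} {V : ValuationSubring L}

/-- The regular elements of the `k`-th field with value less than that of `x k ^ m` at `Vi`. -/
def W (t : Tower F L r) (Vi : ValuationSubring L) (k m : ℕ) : AddSubgroup L where
  carrier := {f | f ∈ t.R t.Pos k ∧ Vi.valuation f < Vi.valuation (t.x k) ^ m}
  zero_mem' := ⟨zero_mem _, by
    rw [map_zero, ← map_pow]; exact (Valuation.pos_iff _).2 (pow_ne_zero _ (t.x_ne k))⟩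
  add_mem' h1 h2 := ⟨add_mem h1.1 h2.1, Valuation.map_add_lt _ h1.2 h2.2⟩
  neg_mem' h1 := ⟨neg_mem h1.1, by rw [Valuation.map_neg]; exact h1.2⟩

variable [IsAlgClosed L] [Algebra.IsAlgebraic (RatFunc F) L]

lemma exists_val_zpow {Vi : ValuationSubring L} (hVi : 1 < Vi.valuation (t.x 0)) {k : ℕ} {f : L}
    (hf : f ∈ t.K k) (hf0 : f ≠ 0) {m : ℕ} (h : Vi.valuation f < Vi.valuation (t.x k) ^ m) :
    ∃ n : ℤ, n + 1 ≤ m ∧ Vi.valuation f = Vi.valuation (t.x k) ^ n := by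
  obtain ⟨n, hn⟩ := t.inf_value hVi k f hf hf0
  refine ⟨n, ?_, hn⟩
  rw [hn, ← zpow_natCast, zpow_lt_zpow_iff_right₀ (t.inf_one_lt hVi k)] at h
  omega

variable {Vi : ValuationSubring L} (hVi : 1 < Vi.valuation (t.x 0))
include hVi

lemma W_zero (k : ℕ) : t.W Vi k 0 = ⊥ := by
  rw [eq_bot_iff]
  intro f hf
  rw [AddSubgroup.mem_bot]
  by_contra h
  have := hf.2
  rw [pow_zero] at this
  exact absurd (inf_ge_one hVi k f hf.1 h) (not_le.2 this)

lemma few_W (k m : ℕ) : Few (r ^ 2) (t.W Vi k m) (t.W Vi k (m + 1)) := by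
  set U : AddSubgroup L :=
    { carrier := {f | Vi.valuation f < Vi.valuation (t.x k) ^ m}
      zero_mem' := by
        rw [Set.mem_ofPred_eq, map_zero, ← map_pow]
        exact (Valuation.pos_iff _).2 (pow_ne_zero _ (t.x_ne k))
      add_mem' := fun h1 h2 => by
        rw [Set.mem_ofPred_eq] at h1 h2 ⊢
        exact Valuation.map_add_lt _ h1 h2
      neg_mem' := fun {f} h1 => by
        rw [Set.mem_ofPred_eq, Valuation.map_neg]; exact h1 } with hU
  have h1 : Few (r ^ 2) U (t.W Vi k (m + 1)) := by
    refine Few.of_fintype (ι := F) t.card (fun c => algebraMap F L c * t.x k ^ m) fun f hf => ?_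
    have hx0 : t.x k ^ m ≠ 0 := pow_ne_zero _ (t.x_ne k)
    have hxp : 0 < Vi.valuation (t.x k) ^ m := pow_pos (t.inf_pos hVi k) m
    have hle : Vi.valuation (f / t.x k ^ m) ≤ 1 := by
      rcases eq_or_ne f 0 with rfl | hf0
      · simp
      obtain ⟨n, hn, hv⟩ := exists_val_zpow hVi hf.1.1 hf0 hf.2
      rw [map_div₀, map_pow, div_le_one₀ hxp, hv, ← zpow_natCast,
        zpow_le_zpow_iff_right₀ (t.inf_one_lt hVi k)]
      push_cast at hn
      omega
    obtain ⟨c, hc⟩ := t.inf_residue hVi k _ (div_mem hf.1.1 (pow_mem (t.x_mem_self k) m)) hle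
    refine ⟨c, ?_⟩
    have e : f - algebraMap F L c * t.x k ^ m =
      (f / t.x k ^ m - algebraMap F L c) * t.x k ^ m := by field_simp
    change Vi.valuation _ < _
    rw [e, map_mul, map_pow]
    exact (mul_lt_mul_of_pos_right hc hxp).trans_eq (one_mul _)
  have h2 : Few 1 (t.R t.Pos k) (t.W Vi k (m + 1)) := (few_self _).anti fun f hf => hf.1
  exact ((h2.inf h1).mono (by rw [one_mul])).mono_left fun f hf => ⟨hf.1, hf.2⟩

lemma few_W_add (k m j : ℕ) : Few ((r ^ 2) ^ j) (t.W Vi k m) (t.W Vi k (m + j)) := by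
  induction j with
  | zero => simpa using few_self _
  | succ j ih =>
    rw [pow_succ, mul_comm]
    exact (few_W hVi k (m + j)).trans ih

lemma finite_W (k m : ℕ) : Finite (t.W Vi k m) := by
  have := few_W_add hVi k 0 m
  rw [zero_add, W_zero hVi, few_iff, AddSubgroup.relIndex_bot_left] at this
  exact (Nat.card_ne_zero.1 this.1).2

lemma W_mono (k : ℕ) {m n : ℕ} (h : m ≤ n) : t.W Vi k m ≤ t.W Vi k n := fun _ hf =>
  ⟨hf.1, hf.2.trans_le (pow_le_pow_right₀ (t.inf_one_lt hVi k).le h)⟩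

lemma card_W_add (k m j : ℕ) :
    Nat.card (t.W Vi k (m + j)) ≤ (r ^ 2) ^ j * Nat.card (t.W Vi k m) := by
  have := (few_W_add hVi k m j).card_le
  rwa [inf_eq_left.2 (W_mono hVi k (Nat.le_add_right m j))] at this

lemma card_W_zero (m : ℕ) : (r ^ 2) ^ m ≤ Nat.card (t.W Vi 0 m) := by
  have := finite_W hVi 0 m
  have hcard : Nat.card (Polynomial.degreeLT F m) = (r ^ 2) ^ m := by
    rw [Nat.card_congr (Polynomial.degreeLTEquiv F m).toEquiv, Nat.card_eq_fintype_card]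
    simp [t.card]
  rw [← hcard]
  have hmem : ∀ p : Polynomial.degreeLT F m, Polynomial.aeval (t.x 0) (p : Polynomial F) ∈ t.W Vi 0 m := by
    intro p
    refine ⟨aeval_mem_O ⟨t.x_mem_self 0, fun V hV => hV⟩ _, ?_⟩
    by_cases hp : (p : Polynomial F) = 0
    · rw [hp, map_zero, map_zero]
      exact pow_pos (t.inf_pos hVi 0) m
    · rw [val_aeval_of_one_lt _ hVi hp]
      refine pow_lt_pow_right₀ hVi ?_
      exact (Polynomial.natDegree_lt_iff_degree_lt hp).2 (Polynomial.mem_degreeLT.1 p.2)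
  refine Nat.card_le_card_of_injective (fun p => (⟨_, hmem p⟩ : t.W Vi 0 m)) fun p p' h => ?_
  have h1 : Polynomial.aeval (t.x 0) ((p : Polynomial F) - (p' : Polynomial F)) = 0 := by
    rw [map_sub, sub_eq_zero]
    exact congrArg Subtype.val h
  by_contra hne
  exact t.aeval_x_zero_ne (sub_ne_zero.2 fun h => hne (Subtype.ext h)) h1

lemma inf_zero (k : ℕ) : Vi.valuation (t.x 0) = Vi.valuation (t.x k) ^ r ^ k := by
  induction k with
  | zero => simp
  | succ k ih => rw [ih, t.inf_succ hVi k, ← pow_mul, pow_succ']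

omit hVi in
lemma center_mul_mem {k : ℕ} {c : L} (hcK : c ∈ t.K k)
    (hc : ∀ V ∈ t.Pos, (∀ j ≤ k, k < 2 * j → V ∉ t.Ty j) → c ∈ V)
    (hz : ∀ j ≤ k, k < 2 * j → ∀ V ∈ t.Ty j, t.x (k + 1) - c ∈ V) {a : L} {e : ℕ} (he : e ≤ r)
    (ha : a ∈ t.A k (k / 2 + 1)) : a * (t.x (k + 1) - c) ^ e ∈ t.R t.Pos (k + 1) := by
  refine ⟨mul_mem (t.K_le_succ k ha.1.1)
    (pow_mem (sub_mem (t.x_mem_self _) (t.K_le_succ k hcK)) _), fun V hV => ?_⟩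
  have haV := ha.1.2 V hV
  by_cases hj : ∃ j ≤ k, V ∈ t.Ty j
  · obtain ⟨j, hjk, hVj⟩ := hj
    rcases Nat.lt_or_ge k (2 * j) with h | h
    · exact mul_mem haV (pow_mem (hz j hjk h V hVj) _)
    · have hcV : c ∈ V := hc V hV fun i _ hi hVi => by
        rcases Nat.lt_or_ge j i with hji | hji
        · exact Ty_disjoint hji hVj hVi
        · omega
      have hbig : 1 < V.valuation (t.x (k + 1)) := by
        have := (Ty_big hVj (k - j)).1
        rwa [show j + (k - j) + 1 = k + 1 by omega] at this
      have hzv : V.valuation (t.x (k + 1) - c) ≤ V.valuation (t.x (k + 1)) :=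
        (V.valuation.map_sub _ _).trans
          (max_le le_rfl (((V.valuation_le_one_iff _).2 hcV).trans hbig.le))
      rw [← V.valuation_le_one_iff, map_mul, map_pow]
      have h1 := ha.2 j (by omega) V hVj
      rw [map_inv₀, val_T_of_one_lt _ t.two_le hbig] at h1
      have hpos : 0 < V.valuation (t.x (k + 1)) ^ r := pow_pos (zero_lt_one.trans hbig) _
      calc _ ≤ (V.valuation (t.x (k + 1)) ^ r)⁻¹ * V.valuation (t.x (k + 1)) ^ r :=
            mul_le_mul' h1 ((pow_le_pow_left₀ zero_le hzv e).trans
              (pow_le_pow_right₀ hbig.le he))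
        _ = 1 := inv_mul_cancel₀ hpos.ne'
  · push Not at hj
    have hcV : c ∈ V := hc V hV fun j hjk _ => hj j hjk
    have hxV : t.x (k + 1) ∈ V := by
      by_cases hτ : V.valuation (T r (t.x 0)) < 1
      · rcases classify hV hτ k with ⟨j, hjk, h⟩ | h
        · exact absurd h (hj j hjk)
        · exact Zs_x_succ_mem h
      · rw [← V.valuation_le_one_iff]
        exact (unit_val hV hτ _).1.le
    exact mul_mem haV (pow_mem (sub_mem hxV hcV) _)

omit hVi in
lemma Sm_A_le {k : ℕ} {c : L} (hcK : c ∈ t.K k)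
    (hc : ∀ V ∈ t.Pos, (∀ j ≤ k, k < 2 * j → V ∉ t.Ty j) → c ∈ V)
    (hz : ∀ j ≤ k, k < 2 * j → ∀ V ∈ t.Ty j, t.x (k + 1) - c ∈ V) :
    Sm r (t.x (k + 1) - c) (fun e => if e = 0 then t.R t.Pos k else t.A k (k / 2 + 1)) ≤
      t.R t.Pos (k + 1) := by
  rintro _ ⟨p, hp, rfl⟩
  refine sum_mem fun e he => ?_
  rw [Finset.mem_range] at he
  have h := hp e he
  dsimp only at h
  split_ifs at h with h0
  · rw [h0, pow_zero, mul_one, ← h0]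
    exact O_mono_K (Nat.le_succ k) h
  · exact center_mul_mem hcK hc hz he.le h

omit hVi in
/-- Changing the centre of an expansion, when the coefficients have bounded denominators. -/
lemma Sm_le_of_center (t : Tower F L r) {k n : ℕ} {w c x : L}
    (hwc : w * c ∈ t.R t.Pos k) :
    Sm n x (fun e => sm (w ^ (n - 1 - e))⁻¹ (t.R t.Pos k)) ≤
      Sm n (x - c) fun e => sm (w ^ (n - 1 - e))⁻¹ (t.R t.Pos k) := by
  rintro _ ⟨p, hp, rfl⟩
  refine sum_mem fun i hi => ?_
  rw [Finset.mem_range] at hi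
  have h := hp i hi
  rw [mem_sm_inv] at h
  have e1 : x ^ i = ((x - c) + c) ^ i := by rw [sub_add_cancel]
  rw [e1, _root_.add_pow, Finset.mul_sum]
  refine sum_mem fun m hm => ?_
  rw [Finset.mem_range] at hm
  have e2 : p i * ((x - c) ^ m * c ^ (i - m) * (i.choose m : L)) =
    (p i * c ^ (i - m) * (i.choose m : L)) * (x - c) ^ m := by ring
  rw [e2]
  refine single_mem_Sm (H := fun e => sm (w ^ (n - 1 - e))⁻¹ (t.R t.Pos k)) (by omega) ?_
  rw [mem_sm_inv]
  have e3 : w ^ (n - 1 - m) * (p i * c ^ (i - m) * (i.choose m : L)) =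
    w ^ (n - 1 - i) * p i * (w * c) ^ (i - m) * (i.choose m : L) := by
    rw [show n - 1 - m = (n - 1 - i) + (i - m) by omega, pow_add, mul_pow]
    ring
  rw [e3]
  exact (t.O t.Pos k).mul_mem ((t.O t.Pos k).mul_mem h ((t.O t.Pos k).pow_mem hwc _))
    (natCast_mem _ _)

lemma card_W_succ {k : ℕ} (ih : ∀ m, (r ^ 2) ^ m ≤ (r ^ 2) ^ ax r k * Nat.card (t.W Vi k m))
    (M : ℕ) : (r ^ 2) ^ (r * M) ≤ (r ^ 2) ^ ax r (k + 1) * Nat.card (t.W Vi (k + 1) (r * M)) := by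
  have hr := t.two_le
  obtain ⟨c, hcK, hc, hz⟩ := t.exists_center k
  obtain ⟨B, hB⟩ := exists_pole_bound k c hcK
  have hw0 : T r (t.x 0) ^ B ≠ 0 := pow_ne_zero _ (t.T_ne 0)
  have hwK : T r (t.x 0) ^ B ∈ t.K k := pow_mem (T_zero_mem k) _
  have hwO : T r (t.x 0) ^ B ∈ t.O t.Pos k := ⟨hwK, fun V hV =>
    pow_mem ((V.valuation_le_one_iff _).1 (tau_le_one hV)) _⟩
  have hwc : T r (t.x 0) ^ B * c ∈ t.R t.Pos k := by
    refine ⟨mul_mem hwK hcK, fun V hV => ?_⟩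
    by_cases hτ : V.valuation (T r (t.x 0)) < 1
    · rw [← V.valuation_le_one_iff, map_mul, map_pow, mul_comm]
      exact hB V hV hτ
    · exact mul_mem (hwO.2 V hV) (hc V hV fun j _ _ hj => hτ (tau_lt_one_of_Ty hj))
  have hτle : sm (T r (t.x 0)) (t.R t.Pos k) ≤ t.R t.Pos k :=
    sm_R_le (T_zero_mem k) (t.T_ne 0) fun V hV => tau_le_one hV
  set ρ := r * r ^ k * B with hρ
  have hwv : Vi.valuation (T r (t.x 0) ^ B) = Vi.valuation (t.x k) ^ ρ := by
    rw [map_pow, val_T_of_one_lt _ hr hVi, inf_zero hVi k, ← pow_mul, ← pow_mul, hρ]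
    congr 1
    ring
  have hwfew : Few ((r ^ 2) ^ ρ) (sm (T r (t.x 0) ^ B) (t.R t.Pos k)) (t.R t.Pos k) := by
    have := (few_Pos (t := t) k).sm_pow (t.T_ne 0) hτle B
    rwa [← pow_mul] at this
  have hwle : sm (T r (t.x 0) ^ B) (t.R t.Pos k) ≤ t.R t.Pos k := sm_pow_le hτle B
  set w := T r (t.x 0) ^ B with hw
  set δ := r ^ (k / 2 + 1) - 1 with hδ
  set P := Sm r (t.x (k + 1))
    fun e => sm (w ^ (r - 1 - e))⁻¹ (t.W Vi k (M + (r - 1 - e) * ρ)) with hP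
  have hPcard : Nat.card P =
      ∏ e ∈ Finset.range r, Nat.card (t.W Vi k (M + (r - 1 - e) * ρ)) := by
    rw [hP, card_Sm]
    · exact Finset.prod_congr rfl fun e _ => card_sm (inv_ne_zero (pow_ne_zero _ hw0)) _
    · intro p hp h e he
      have hpK : ∀ e < r, p e ∈ t.K k := fun e he => by
        have := mul_mem (inv_mem (pow_mem hwK (r - 1 - e))) (mem_sm_inv.1 (hp e he)).1.1
        rwa [inv_mul_cancel_left₀ (pow_ne_zero _ hw0)] at this
      have := t.coeff_eq_zero hVi (k := k) (p := fun e => if e < r then p e else 0)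
        (fun e => by
          split_ifs with h
          · exact hpK e h
          · exact zero_mem _)
        (by
          rw [← h]
          exact Finset.sum_congr rfl fun e he => by rw [if_pos (Finset.mem_range.1 he)]) he
      rwa [if_pos he] at this
  have hPval : ∀ f ∈ P, Vi.valuation f < Vi.valuation (t.x (k + 1)) ^ (r * M) := by
    rintro _ ⟨p, hp, rfl⟩
    have hXp := t.inf_pos hVi (k + 1)
    refine Valuation.map_sum_lt _ (pow_pos hXp _).ne' fun e he => ?_
    rw [Finset.mem_range] at he
    have h := mem_sm_inv.1 (hp e he)
    have hpK : p e ∈ t.K k := by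
      have := mul_mem (inv_mem (pow_mem hwK (r - 1 - e))) h.1.1
      rwa [inv_mul_cancel_left₀ (pow_ne_zero _ hw0)] at this
    have h1 : Vi.valuation (p e) < Vi.valuation (t.x k) ^ M := by
      have := h.2
      rw [map_mul, map_pow, hwv, ← pow_mul, add_comm M, pow_add, mul_comm ρ] at this
      exact (mul_lt_mul_iff_right₀ (pow_pos (t.inf_pos hVi k) _)).1 this
    rcases eq_or_ne (p e) 0 with h0 | h0
    · rw [h0, zero_mul, map_zero]; exact pow_pos hXp _
    obtain ⟨n, hn, hv⟩ := exists_val_zpow hVi hpK h0 h1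
    rw [map_mul, map_pow, hv, t.inf_succ hVi k, ← zpow_natCast _ r, ← zpow_mul, ← zpow_natCast _ e,
      ← zpow_natCast _ (r * M), ← zpow_add₀ hXp.ne', zpow_lt_zpow_iff_right₀ (t.inf_one_lt hVi _)]
    push_cast
    nlinarith
  have hPfew : Few (∏ e ∈ Finset.range r, (r ^ 2) ^ ((r - 1 - e) * ρ + if e = 0 then 0 else δ))
      (t.W Vi (k + 1) (r * M) ⊓ P) P := by
    refine Few.mono_left ((few_Sm (t.x (k + 1) - c) (H := fun e => if e = 0 then t.R t.Pos k else
      t.A k (k / 2 + 1)) (H' := fun e => sm (w ^ (r - 1 - e))⁻¹ (t.R t.Pos k))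
      fun e he => ?_).anti ?_).inf_right ?_
    · have h1 := (hwfew.sm_pow hw0 hwle (r - 1 - e)).sm
        (inv_ne_zero (pow_ne_zero (r - 1 - e) hw0))
      rw [← sm_mul, inv_mul_cancel₀ (pow_ne_zero _ hw0), sm_one, ← pow_mul, mul_comm ρ] at h1
      split_ifs with h0
      · rwa [add_zero]
      · rw [pow_add]
        exact h1.trans (few_A k _ le_rfl)
    · refine le_trans (Sm_mono fun e _ => ?_) (Sm_le_of_center t hwc)
      exact sm_mono _ fun f hf => hf.1
    · intro f hf
      exact ⟨⟨Sm_A_le hcK hc hz hf.1, hPval f hf.2⟩, hf.2⟩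
  have hWfin := finite_W hVi (k + 1) (r * M)
  have h1 := hPfew.card_le
  rw [inf_assoc, inf_idem] at h1
  have h2 : Nat.card (t.W Vi (k + 1) (r * M) ⊓ P : AddSubgroup L) ≤
      Nat.card (t.W Vi (k + 1) (r * M)) := AddSubgroup.card_le_of_le inf_le_left
  have h3 : ∏ e ∈ Finset.range r, (r ^ 2) ^ (M + (r - 1 - e) * ρ) ≤
      ∏ e ∈ Finset.range r, ((r ^ 2) ^ ax r k * Nat.card (t.W Vi k (M + (r - 1 - e) * ρ))) :=
    Finset.prod_le_prod' fun e _ => ih _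
  rw [Finset.prod_mul_distrib, ← hPcard, Finset.prod_pow_eq_pow_sum, Finset.sum_add_distrib,
    Finset.prod_const, Finset.sum_const, Finset.card_range, smul_eq_mul, pow_add] at h3
  rw [Finset.prod_pow_eq_pow_sum, Finset.sum_add_distrib, pow_add] at h1
  have e1 : ∑ e ∈ Finset.range r, (if e = 0 then 0 else δ) = (r - 1) * δ := by
    obtain ⟨s, rfl⟩ : ∃ s, r = s + 1 := ⟨r - 1, by omega⟩
    rw [Finset.sum_range_succ']
    simp
  rw [e1] at h1
  have hpos : 0 < (r ^ 2) ^ ∑ e ∈ Finset.range r, (r - 1 - e) * ρ := by positivity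
  have e2 : (r ^ 2) ^ ax r (k + 1) = ((r ^ 2) ^ ax r k) ^ r * (r ^ 2) ^ ((r - 1) * δ) := by
    rw [ax, pow_add (r ^ 2), mul_comm r, pow_mul (r ^ 2) (ax r k)]
  refine Nat.le_of_mul_le_mul_right ?_ hpos
  calc _ ≤ ((r ^ 2) ^ ax r k) ^ r * Nat.card P := h3
    _ ≤ ((r ^ 2) ^ ax r k) ^ r * _ := Nat.mul_le_mul_left _ (h1.trans (Nat.mul_le_mul_left _ h2))
    _ = _ := by rw [e2]; ring

lemma card_W (k : ℕ) : ∀ m, (r ^ 2) ^ m ≤ (r ^ 2) ^ ax r k * Nat.card (t.W Vi k m) := by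
  have hr := t.two_le
  induction k with
  | zero => intro m; simpa [ax] using card_W_zero hVi m
  | succ k ih =>
    intro m
    have h1 := card_W_succ hVi ih m
    obtain ⟨j, hj⟩ := Nat.exists_eq_add_of_le (Nat.le_mul_of_pos_left m (by omega : 0 < r))
    have h2 := card_W_add hVi (k + 1) m j
    rw [hj] at h1
    refine Nat.le_of_mul_le_mul_right ?_ (show 0 < (r ^ 2) ^ j by positivity)
    rw [← pow_add]
    calc _ ≤ _ := h1
      _ ≤ _ := Nat.mul_le_mul_left _ h2
      _ = _ := by ring

/-- The space of functions of the code. -/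
lemma le_card_A_inf_W (k m : ℕ) : (r ^ 2) ^ m ≤ (r ^ 2) ^ r ^ (k + 1) *
    Nat.card (t.A k (k / 2 + 1) ⊓ t.W Vi k m : AddSubgroup L) := by
  have hr := t.two_le
  have h1 := ((few_A (t := t) k _ le_rfl).anti (K' := t.W Vi k m) fun f hf => hf.1).card_le
  calc (r ^ 2) ^ m ≤ _ := card_W hVi k m
    _ ≤ _ := Nat.mul_le_mul_left _ h1
    _ = (r ^ 2) ^ (ax r k + (r ^ (k / 2 + 1) - 1)) * _ := by rw [pow_add (r ^ 2), mul_assoc]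
    _ ≤ _ := Nat.mul_le_mul_right _
      (Nat.pow_le_pow_right (by positivity) (ax_le r hr k))

end Tower

namespace Tower

variable {F L : Type*} [Field F] [Fintype F] [Field L] [Algebra F L] [Algebra (RatFunc F) L]
  [IsScalarTower F (RatFunc F) L] {r : ℕ} {t : Tower F L r} {V : ValuationSubring L}

variable (t) in
/-- The valuation rings at which `x 0` takes the value `a`. -/
def Sp (a : F) : Set (ValuationSubring L) := {V | V.valuation (t.x 0 - algebraMap F L a) < 1}

lemma stable_Sp (a : F) (k : ℕ) : t.Stable k (t.Sp a) := fun σ hσ V hV => by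
  change (pull σ V).valuation (t.x 0 - algebraMap F L a) < 1
  rw [pull_lt_one_iff, hσ _ (sub_mem (t.x_mem (Nat.zero_le k)) (t.const_mem_K k a))]
  exact hV

lemma Sp_subset_Pos (a : F) : t.Sp a ⊆ t.Pos := fun V hV => by
  have h1 : t.x 0 - algebraMap F L a ∈ V := (V.valuation_le_one_iff _).1 hV.le
  have := add_mem h1 (const_mem V a)
  rwa [sub_add_cancel] at this

lemma val_T_eq_one_of_sub {y : L} {b : F} (hb : T r b ≠ 0)
    (h : V.valuation (y - algebraMap F L b) < 1) (t : Tower F L r) : V.valuation (T r y) = 1 := by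
  have h1 : V.valuation (T r y - algebraMap F L (T r b)) < 1 := by
    rw [← T_algebraMap, ← t.T_sub, val_T_of_lt_one _ t.two_le h]; exact h
  have h2 : T r y = (T r y - algebraMap F L (T r b)) + algebraMap F L (T r b) := by ring
  have h3 := val_const V.valuation hb
  rw [h2, Valuation.map_add_eq_of_lt_right _ (by rwa [h3]), h3]

lemma Sp_unit {a : F} (ha : T r a ≠ 0) (hV : V ∈ t.Sp a) (i : ℕ) :
    V.valuation (t.x i) = 1 ∧ V.valuation (T r (t.x i)) = 1 :=
  unit_val (Sp_subset_Pos a hV) (by rw [val_T_eq_one_of_sub ha hV t]; exact lt_irrefl _) i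

section Points

variable (t) in
include t in
lemma exists_T_next (b : F) : ∃ a, T r a = b ^ (r + 1) / T r b := by
  refine t.exists_T_base ?_
  rw [div_pow, t.T_pow_base, ← pow_mul, add_mul, one_mul, pow_add, ← sq, ← t.card,
    FiniteField.pow_card, ← pow_succ']

variable (t) in
/-- A value of the next coordinate of a rational point. -/
noncomputable def next (b : F) : F := (exists_T_next t b).choose

variable (t) in
lemma T_next (b : F) : T r (next t b) = b ^ (r + 1) / T r b := (exists_T_next t b).choose_spec

variable (t) in
/-- The coordinates of the rational point with first coordinate `a` and choices `l`. -/
noncomputable def point (a : F) (l : ℕ → F) : ℕ → F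
  | 0 => a
  | i + 1 => next t (point a l i) + l i

lemma exists_next {a : F} (ha : T r a ≠ 0) (hV : V ∈ t.Sp a) {i : ℕ} {b : F}
    (h : V.valuation (t.x i - algebraMap F L b) < 1) :
    ∃ l ∈ Lam F r, V.valuation (t.x (i + 1) - algebraMap F L (next t b + l)) < 1 := by
  have hu := Sp_unit ha hV i
  have hb : T r b ≠ 0 := by
    intro hb
    have h1 := val_T_of_lt_one _ t.two_le h
    rw [t.T_sub, T_algebraMap, hb, map_zero, sub_zero, hu.2] at h1
    rw [← h1] at h
    exact lt_irrefl _ h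
  have hb' : algebraMap F L (T r b) ≠ 0 := (map_ne_zero _).2 hb
  have h1 := val_aeval_sub ((V.valuation_le_one_iff _).1 hu.1.le) b
    (Polynomial.X ^ (r + 1) * Polynomial.C (T r b) -
      Polynomial.C (b ^ (r + 1)) * (Polynomial.X ^ r + Polynomial.X))
  have h2 : Polynomial.eval b (Polynomial.X ^ (r + 1) * Polynomial.C (T r b) -
      Polynomial.C (b ^ (r + 1)) * (Polynomial.X ^ r + Polynomial.X)) = 0 := by
    simp only [Polynomial.eval_sub, Polynomial.eval_mul, Polynomial.eval_pow, Polynomial.eval_X,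
      Polynomial.eval_C, Polynomial.eval_add]
    rw [T, sub_self]
  rw [h2, map_zero, sub_zero] at h1
  have h3 : V.valuation (T r (t.x (i + 1) - algebraMap F L (next t b))) < 1 := by
    have e : T r (t.x (i + 1) - algebraMap F L (next t b)) = (Polynomial.aeval (t.x i)
        (Polynomial.X ^ (r + 1) * Polynomial.C (T r b) -
          Polynomial.C (b ^ (r + 1)) * (Polynomial.X ^ r + Polynomial.X))) /
        (T r (t.x i) * algebraMap F L (T r b)) := by
      rw [t.T_sub, T_algebraMap, T_next t, t.T_x_succ, map_div₀,
        div_sub_div _ _ (t.T_ne i) hb']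
      simp only [map_sub, map_mul, map_pow, map_add, Polynomial.aeval_X, Polynomial.aeval_C]
      rw [mul_comm (T r (t.x i)) (algebraMap F L b ^ (r + 1))]
      rfl
    rw [e, map_div₀, map_mul, hu.2, val_const _ hb, mul_one, div_one]
    exact h1.trans_lt h
  obtain ⟨l, hl, h4⟩ := exists_root_of_val_T h3 t
  refine ⟨l, hl, ?_⟩
  rwa [map_add, ← sub_sub]

/-- Every valuation ring over an admissible value of `x 0` is centred at a rational point. -/
lemma exists_point {a : F} (ha : T r a ≠ 0) (hV : V ∈ t.Sp a) : ∃ l : ℕ → F,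
    (∀ i, l i ∈ Lam F r) ∧ ∀ i, V.valuation (t.x i - algebraMap F L (point t a l i)) < 1 := by
  choose! l hl hl' using fun (i : ℕ) (b : F)
    (h : V.valuation (t.x i - algebraMap F L b) < 1) => exists_next ha hV h
  let b : ℕ → F := fun i => Nat.rec a (fun i b => next t b + l i b) i
  have hb : ∀ i, V.valuation (t.x i - algebraMap F L (b i)) < 1 := by
    intro i
    induction i with
    | zero => exact hV
    | succ i ih => exact hl' i _ ih
  have he : ∀ i, point t a (fun i => l i (b i)) i = b i := by
    intro i
    induction i with
    | zero => rfl
    | succ i ih => rw [point, ih]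
  exact ⟨fun i => l i (b i), fun i => hl i _ (hb i), fun i => by rw [he]; exact hb i⟩

end Points

lemma exists_const_base {a : F} {f : L} (hf : f ∈ t.O (t.Sp a) 0) : ∃ c : F, ∀ V ∈ t.Sp a,
    V.valuation (f - algebraMap F L c) ≤ V.valuation (t.x 0 - algebraMap F L a) := by
  have e : Polynomial.aeval (t.x 0) (Polynomial.X - Polynomial.C a) =
      t.x 0 - algebraMap F L a := by
    rw [map_sub, Polynomial.aeval_X, Polynomial.aeval_C]
  obtain ⟨P, hP, h⟩ := exists_mod_base (Polynomial.monic_X_sub_C a) hf.1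
    (fun V _ hlt => hf.2 V (by rwa [e] at hlt))
  rw [Polynomial.degree_X_sub_C] at hP
  obtain ⟨c, rfl⟩ : ∃ c, P = Polynomial.C c :=
    ⟨_, Polynomial.eq_C_of_degree_le_zero (Nat.WithBot.lt_one_iff_le_zero.1 hP)⟩
  refine ⟨c, fun V hV => ?_⟩
  have := h V (Sp_subset_Pos a hV) (by rw [e]; exact hV)
  rwa [e, Polynomial.aeval_C] at this

variable [IsAlgClosed L] [Algebra.IsAlgebraic (RatFunc F) L]

/-- Values of regular functions at rational points. -/
lemma exists_value {b : ℕ → F} (hb : T r (b 0) ≠ 0) (k : ℕ) : ∀ f ∈ t.O (t.Sp (b 0)) k,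
    ∃ c : F, ∀ V : ValuationSubring L, (∀ i ≤ k, V.valuation (t.x i - algebraMap F L (b i)) < 1) →
      V.valuation (f - algebraMap F L c) < 1 := by
  induction k with
  | zero =>
    intro f hf
    obtain ⟨c, hc⟩ := exists_const_base hf
    exact ⟨c, fun V hV => (hc V (hV 0 le_rfl)).trans_lt (hV 0 le_rfl)⟩
  | succ k ih =>
    intro f hf
    obtain ⟨p, hp, rfl⟩ := exists_coeffs_mem (stable_Sp (b 0) k)
      (fun V hV => (V.valuation_le_one_iff _).1 (Sp_unit hb hV (k + 1)).1.le) hf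
    choose! c hc using fun e (he : e < r) => ih (p e) (hp e he)
    refine ⟨∑ e ∈ Finset.range r, c e * b (k + 1) ^ e, fun V hV => ?_⟩
    have hS : V ∈ t.Sp (b 0) := hV 0 (Nat.zero_le _)
    have hx := (Sp_unit hb hS (k + 1)).1
    rw [map_sum, ← Finset.sum_sub_distrib]
    refine Valuation.map_sum_lt _ one_ne_zero fun e he => ?_
    rw [Finset.mem_range] at he
    have e1 : p e * t.x (k + 1) ^ e - algebraMap F L (c e * b (k + 1) ^ e) =
        (p e - algebraMap F L (c e)) * t.x (k + 1) ^ e + algebraMap F L (c e) *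
          (Polynomial.aeval (t.x (k + 1)) (Polynomial.X ^ e : Polynomial F) -
            algebraMap F L ((Polynomial.X ^ e : Polynomial F).eval (b (k + 1)))) := by
      simp only [map_mul, map_pow, Polynomial.aeval_X, Polynomial.eval_pow, Polynomial.eval_X]
      ring
    rw [e1]
    refine Valuation.map_add_lt _ ?_ ?_
    · rw [map_mul, map_pow, hx, one_pow, mul_one]
      exact hc e he V fun i hi => hV i (by omega)
    · rw [map_mul]
      exact mul_lt_one_val (val_const_le _ _) ((val_aeval_sub
        ((V.valuation_le_one_iff _).1 hx.le) _ _).trans_lt (hV (k + 1) le_rfl))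

/-- `x 0 - a` is a local parameter at the points above an admissible value `a`. -/
lemma val_le_of_vanishing {a : F} (ha : T r a ≠ 0) (k : ℕ) : ∀ f ∈ t.K k,
    (∀ V ∈ t.Sp a, V.valuation f < 1) →
    ∀ V ∈ t.Sp a, V.valuation f ≤ V.valuation (t.x 0 - algebraMap F L a) := by
  induction k with
  | zero =>
    intro f hf h V hV
    obtain ⟨c, hc⟩ := exists_const_base ⟨hf, fun V hV => (V.valuation_le_one_iff _).1 (h V hV).le⟩
    have hc0 : c = 0 := by
      by_contra hc0
      have h1 := (hc V hV).trans_lt hV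
      have h2 := h V hV
      have h3 := V.valuation.map_sub f (f - algebraMap F L c)
      rw [sub_sub_cancel, val_const _ hc0] at h3
      exact absurd (h3.trans_lt (max_lt h2 h1)) (lt_irrefl _)
    have := hc V hV
    rwa [hc0, map_zero, sub_zero] at this
  | succ k ih =>
    intro f hf h V hV
    have hz : t.x (k + 1) - t.x (k + 1) ∈ t.K k := by rw [sub_self]; exact zero_mem _
    obtain ⟨p, hp, rfl⟩ := t.exists_coeffs hz hf
    have hlt : ∀ e < r, ∀ V ∈ t.Sp a, V.valuation (p e) < 1 := by
      intro e he V hV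
      have hx := (Sp_unit ha hV (k + 1)).1
      have hne : (Lam F r).Nonempty := by
        rw [← Finset.card_pos, t.card_Lam]
        have := t.two_le
        omega
      have hconj : ∀ b ∈ Lam F r, V.valuation (∑ i ∈ Finset.range r, p i *
          (t.x (k + 1) + algebraMap F L b) ^ i) < 1 := by
        intro b hb
        obtain ⟨σ, h1, h2⟩ := t.exists_aut k hb
        rw [← t.aut_sum h1 h2 hp hz, ← pull_lt_one_iff]
        exact h _ (stable_Sp a k σ h1 V hV)
      have hγ := coeff_le_of_conj (γ := (Lam F r).sup' hne fun b => V.valuation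
        (∑ i ∈ Finset.range r, p i * (t.x (k + 1) + algebraMap F L b) ^ i))
        V.valuation t.card_Lam p (t.x (k + 1)) le_rfl hx.le
        (fun b hb => Finset.le_sup' (fun b => V.valuation (∑ i ∈ Finset.range r, p i *
          (t.x (k + 1) + algebraMap F L b) ^ i)) hb) e he
      rw [one_pow, mul_one] at hγ
      exact hγ.trans_lt ((Finset.sup'_lt_iff hne).2 hconj)
    refine Valuation.map_sum_le _ fun e he => ?_
    rw [Finset.mem_range] at he
    rw [map_mul, map_pow, (Sp_unit ha hV (k + 1)).1, one_pow, mul_one]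
    exact ih (p e) (hp e) (hlt e he) V hV

end Tower

namespace Tower

variable {F L : Type*} [Field F] [Fintype F] [Field L] [Algebra F L] [Algebra (RatFunc F) L]
  [IsScalarTower F (RatFunc F) L] {r : ℕ} {t : Tower F L r} {V : ValuationSubring L}

variable (F r) in
/-- The values of `x 0` at the rational points of the code. -/
noncomputable def Nz : Finset F := by
  classical
  exact Finset.univ.filter fun a => T r a ≠ 0

omit [Fintype F] in
lemma mem_Nz [Fintype F] {a : F} : a ∈ Nz F r ↔ T r a ≠ 0 := by
  classical
  simp [Nz]

include t in
lemma card_Nz : (Nz F r).card = r ^ 2 - r := by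
  classical
  have h1 := t.card_Lam
  have h2 : Nz F r = (Lam F r)ᶜ := by
    ext a
    rw [mem_Nz, Finset.mem_compl, mem_Lam]
  rw [h2, Finset.card_compl, h1, t.card]

/-- The product of the local parameters at the points of the code. -/
noncomputable def prodNz (t : Tower F L r) : L :=
  ∏ a ∈ Nz F r, (t.x 0 - algebraMap F L a)

lemma val_sub_le_one (hV : V ∈ t.Pos) (a : F) : V.valuation (t.x 0 - algebraMap F L a) ≤ 1 :=
  (V.valuation_le_one_iff _).2 (sub_mem hV (const_mem V a))

lemma val_prodNz_of_not (hV : V ∈ t.Pos) (h : ∀ a ∈ Nz F r, V ∉ t.Sp a) :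
    V.valuation t.prodNz = 1 := by
  rw [prodNz, map_prod]
  exact Finset.prod_eq_one fun a ha => le_antisymm (val_sub_le_one hV a) (not_lt.1 (h a ha))

lemma val_prodNz {a : F} (ha : a ∈ Nz F r) (hV : V ∈ t.Sp a) :
    V.valuation t.prodNz = V.valuation (t.x 0 - algebraMap F L a) := by
  classical
  rw [prodNz, map_prod, Finset.prod_eq_single_of_mem a ha]
  intro b _ hba
  refine le_antisymm (val_sub_le_one (Sp_subset_Pos a hV) b) (not_lt.1 fun hb => ?_)
  have h1 := V.valuation.map_sub_lt hb hV
  rw [sub_sub_sub_cancel_left, ← map_sub, val_const _ (sub_ne_zero.2 hba.symm)] at h1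
  exact lt_irrefl _ h1

lemma prodNz_mem_K (k : ℕ) : t.prodNz ∈ t.K k :=
  prod_mem fun a _ => sub_mem (t.x_mem (Nat.zero_le k)) (t.const_mem_K k a)

lemma Ty_zero_Sp (hV : V ∈ t.Ty 0) {a : F} (ha : a ∈ Nz F r) : V ∉ t.Sp a := fun h => by
  have h1 := (Sp_unit (mem_Nz.1 ha) h 0).2
  exact (tau_lt_one_of_Ty hV).ne h1

variable [IsAlgClosed L] [Algebra.IsAlgebraic (RatFunc F) L]
variable {Vi : ValuationSubring L} (hVi : 1 < Vi.valuation (t.x 0))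
include hVi

lemma inf_prodNz (k : ℕ) :
    Vi.valuation t.prodNz = Vi.valuation (t.x k) ^ (r ^ k * (r ^ 2 - r)) := by
  rw [prodNz, map_prod, Finset.prod_congr rfl (g := fun _ => Vi.valuation (t.x 0)),
    Finset.prod_const, card_Nz (t := t), inf_zero hVi k, ← pow_mul]
  intro a _
  exact Valuation.map_sub_eq_of_lt_left _ ((val_const_le _ a).trans_lt hVi)

/-- An element of the code not in a small subset is separated from it at some point. -/
lemma exists_separating {k m s : ℕ} (hs : s * m < (r ^ 2 - 1) * r ^ k) {f : L}
    (hf : f ∈ t.A k (k / 2 + 1) ⊓ t.W Vi k (m + 1)) {B : Finset L}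
    (hB : ∀ g ∈ B, g ∈ t.A k (k / 2 + 1) ⊓ t.W Vi k (m + 1)) (hB0 : B.Nonempty) (hBs : B.card ≤ s)
    (hfB : f ∉ B) : ∃ a, T r a ≠ 0 ∧ ∃ V ∈ t.Sp a, ∀ g ∈ B, ¬ V.valuation (f - g) < 1 := by
  have hr := t.two_le
  classical
  by_contra! hcon
  set P := ∏ g ∈ B, (f - g) with hP
  have hmem : ∀ g ∈ B, f - g ∈ t.A k (k / 2 + 1) ⊓ t.W Vi k (m + 1) := fun g hg =>
    sub_mem hf (hB g hg)
  have hne : ∀ g ∈ B, f - g ≠ 0 := fun g hg h => hfB (by rwa [sub_eq_zero.1 h])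
  have hP0 : P ≠ 0 := Finset.prod_ne_zero_iff.2 hne
  have hPO : P ∈ t.O t.Pos k := prod_mem fun g hg => (hmem g hg).1.1
  have hlt : ∀ a, T r a ≠ 0 → ∀ V ∈ t.Sp a, V.valuation P < 1 := by
    intro a ha V hV
    obtain ⟨g, hg, hlt⟩ := hcon a ha V hV
    rw [hP, ← Finset.prod_erase_mul _ _ hg, map_mul]
    refine mul_lt_one_val ?_ hlt
    rw [map_prod]
    exact Finset.prod_le_one' fun g' hg' => (V.valuation_le_one_iff _).2
      ((hmem g' (Finset.mem_of_mem_erase hg')).1.1.2 V (Sp_subset_Pos a hV))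
  have hπ0 : t.prodNz ≠ 0 := by
    rw [← map_ne_zero Vi.valuation, inf_prodNz hVi k]
    exact pow_ne_zero _ (t.inf_pos hVi k).ne'
  have hG : P / t.prodNz ∈ t.O t.Pos k := by
    refine ⟨div_mem hPO.1 (prodNz_mem_K k), fun V hV => ?_⟩
    rw [← val_le_iff_div_mem V hπ0]
    by_cases h : ∃ a ∈ Nz F r, V ∈ t.Sp a
    · obtain ⟨a, ha, hVa⟩ := h
      rw [val_prodNz ha hVa]
      exact val_le_of_vanishing (mem_Nz.1 ha) k P hPO.1 (hlt a (mem_Nz.1 ha)) V hVa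
    · push Not at h
      rw [val_prodNz_of_not hV h]
      exact (V.valuation_le_one_iff _).2 (hPO.2 V hV)
  have hvan : ∀ V ∈ t.Ty 0, V.valuation (P / t.prodNz) < 1 := by
    intro V hV
    have hVP : V ∈ t.Pos := x_zero_le_of_Ty hV
    rw [map_div₀, val_prodNz_of_not hVP fun a ha => Ty_zero_Sp hV ha, div_one, hP]
    have hone : ∀ g ∈ B, V.valuation (f - g) < 1 := by
      intro g hg
      refine ((hmem g hg).1.2 0 (Nat.succ_pos _) V hV).trans_lt ?_
      have h1 := Ty_val_t hV k
      rw [zero_add, pow_zero, pow_one] at h1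
      by_contra h2
      have h3 := one_le_pow₀ (n := r ^ k) (not_lt.1 h2)
      rw [h1] at h3
      exact absurd (tau_lt_one_of_Ty hV) (not_lt.2 h3)
    obtain ⟨g, hg⟩ := hB0
    rw [← Finset.prod_erase_mul _ _ hg, map_mul]
    refine mul_lt_one_val ?_ (hone g hg)
    rw [map_prod]
    exact Finset.prod_le_one' fun g' hg' => (hone g' (Finset.mem_of_mem_erase hg')).le
  have h1 := inf_ge_of_vanishing hVi k _ hG (div_ne_zero hP0 hπ0) hvan
  have hX := t.inf_one_lt hVi k
  have h2 : Vi.valuation P ≤ Vi.valuation (t.x k) ^ (m * s) := by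
    rw [hP, map_prod]
    calc _ ≤ ∏ g ∈ B, Vi.valuation (t.x k) ^ m := by
          refine Finset.prod_le_prod' fun g hg => ?_
          obtain ⟨n, hn, hn'⟩ := exists_val_zpow hVi (hmem g hg).2.1.1 (hne g hg) (hmem g hg).2.2
          rw [hn', ← zpow_natCast]
          exact zpow_le_zpow_right₀ hX.le (by omega)
      _ = (Vi.valuation (t.x k) ^ m) ^ B.card := by rw [Finset.prod_const]
      _ ≤ _ := by rw [pow_mul]; exact pow_le_pow_right₀ (one_le_pow₀ hX.le) hBs
  have h3 : Vi.valuation (t.x k) ^ ((r - 1) * r ^ k + r ^ k * (r ^ 2 - r)) ≤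
      Vi.valuation (t.x k) ^ (m * s) := by
    refine le_trans ?_ h2
    rw [pow_add, ← inf_prodNz hVi k]
    calc _ ≤ Vi.valuation (P / t.prodNz) * Vi.valuation t.prodNz := mul_le_mul_left h1 _
      _ = _ := by rw [← map_mul, div_mul_cancel₀ _ hπ0]
  rw [pow_le_pow_iff_right₀ hX] at h3
  have h4 : (r - 1) * r ^ k + r ^ k * (r ^ 2 - r) = (r ^ 2 - 1) * r ^ k := by
    rw [mul_comm (r ^ k), ← add_mul]
    congr 1
    have : r ≤ r ^ 2 := Nat.le_self_pow (by norm_num) r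
    omega
  rw [h4, mul_comm m] at h3
  omega

end Tower

namespace Tower

section Evaluation

variable {F L : Type*} [Field F] [Fintype F] [Field L] [Algebra F L] [Algebra (RatFunc F) L]
  [IsScalarTower F (RatFunc F) L] {r : ℕ} {t : Tower F L r} {V : ValuationSubring L}

lemma point_congr (t : Tower F L r) (a : F) {l l' : ℕ → F} {i : ℕ} (h : ∀ j < i, l j = l' j) :
    point t a l i = point t a l' i := by
  induction i with
  | zero => rfl
  | succ i ih =>
    rw [point, point, ih fun j hj => h j (by omega), h i (by omega)]

variable (F r) in
/-- The coordinates of the code. -/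
abbrev Idx (k : ℕ) : Type _ := {a : F // a ∈ Nz F r} × (Fin k → {l : F // l ∈ Lam F r})

lemma card_Idx (t : Tower F L r) (k : ℕ) : Nat.card (Idx F r k) = (r ^ 2 - r) * r ^ k := by
  rw [Nat.card_prod, Nat.card_fun]
  simp [card_Nz (t := t), t.card_Lam]

variable [IsAlgClosed L] [Algebra.IsAlgebraic (RatFunc F) L]
variable {Vi : ValuationSubring L} (hVi : 1 < Vi.valuation (t.x 0))
include hVi

lemma exists_evaluation {k m s : ℕ} (hs : s * m < (r ^ 2 - 1) * r ^ k) :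
    ∃ ev : (t.A k (k / 2 + 1) ⊓ t.W Vi k (m + 1) : AddSubgroup L) → Idx F r k → F,
      ∀ f (B : Finset (t.A k (k / 2 + 1) ⊓ t.W Vi k (m + 1) : AddSubgroup L)),
        B.Nonempty → B.card ≤ s → f ∉ B → ∃ i, ∀ g ∈ B, ev f i ≠ ev g i := by
  classical
  let ext : Idx F r k → ℕ → F := fun i j => if h : j < k then (i.2 ⟨j, h⟩ : F) else 0
  have hval : ∀ (f : (t.A k (k / 2 + 1) ⊓ t.W Vi k (m + 1) : AddSubgroup L)) (i : Idx F r k),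
      ∃ c : F, ∀ V : ValuationSubring L,
        (∀ j ≤ k, V.valuation (t.x j - algebraMap F L (point t i.1 (ext i) j)) < 1) →
        V.valuation ((f : L) - algebraMap F L c) < 1 := by
    intro f i
    refine exists_value (b := point t i.1 (ext i)) (mem_Nz.1 i.1.2) k (f : L)
      ⟨f.2.1.1.1, fun V hV => f.2.1.1.2 V (Sp_subset_Pos _ hV)⟩
  choose ev hev using hval
  refine ⟨ev, fun f B hB hBs hfB => ?_⟩
  obtain ⟨a, ha, V, hV, hsep⟩ := exists_separating hVi hs f.2 (B := B.image Subtype.val)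
    (fun g hg => by
      obtain ⟨g', -, rfl⟩ := Finset.mem_image.1 hg
      exact g'.2) (hB.image _) (Finset.card_image_le.trans hBs) (fun h => by
      obtain ⟨g, hg, he⟩ := Finset.mem_image.1 h
      exact hfB (by rwa [← Subtype.ext he]))
  obtain ⟨l, hl, hlV⟩ := exists_point ha hV
  let i : Idx F r k := ⟨⟨a, mem_Nz.2 ha⟩, fun j => ⟨l j, hl j⟩⟩
  have hi : ∀ j ≤ k, V.valuation (t.x j - algebraMap F L (point t i.1 (ext i) j)) < 1 := by
    intro j hj
    rw [point_congr t a (l' := l) (i := j)]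
    · exact hlV j
    · intro n hn
      exact dif_pos (show n < k by omega)
  refine ⟨i, fun g hg he => hsep g (Finset.mem_image_of_mem _ hg) ?_⟩
  have h1 := hev f i V hi
  have h2 := hev g i V hi
  rw [he] at h1
  have := V.valuation.map_sub_lt h1 h2
  rwa [sub_sub_sub_cancel_right] at this

end Evaluation

end Tower

lemma exists_frameproof {X I F : Type*} [Finite X] [Finite I] [Finite F] {n q s : ℕ}
    (hI : Nat.card I = n) (hF : Nat.card F = q) (hn : n ≠ 0) (hs : s ≠ 0) (ev : X → I → F)
    (sep : ∀ f (B : Finset X), B.Nonempty → B.card ≤ s → f ∉ B → ∃ i, ∀ g ∈ B, ev f i ≠ ev g i) :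
    ∃ C : Set (Fin n → Fin q), IsFrameproof s C ∧ C.ncard = Nat.card X := by
  classical
  have := Fintype.ofFinite X
  subst hI hF
  let eI := (Finite.equivFin I).symm
  let eF := Finite.equivFin F
  let Φ : X → Fin (Nat.card I) → Fin (Nat.card F) := fun f j => eF (ev f (eI j))
  have hΦ : ∀ {f g i}, Φ f (eI.symm i) = Φ g (eI.symm i) → ev f i = ev g i := by
    intro f g i h
    have h1 := eF.injective h
    rwa [Equiv.apply_symm_apply] at h1
  have hinj : Function.Injective Φ := by
    intro f g hfg
    by_contra hne
    obtain ⟨i, hi⟩ := sep f {g} (Finset.singleton_nonempty g)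
      (by rw [Finset.card_singleton]; omega) (by simpa using hne)
    exact hi g (Finset.mem_singleton_self g) (hΦ (congrFun hfg _))
  refine ⟨Set.range Φ, fun A hA hAs => ?_, Set.ncard_range_of_injective hinj⟩
  refine Set.Subset.antisymm ?_ fun x hx => ⟨fun i => ⟨x, hx, rfl⟩, hA hx⟩
  rintro _ ⟨hx, f, rfl⟩
  by_contra hfA
  obtain ⟨a, ha, -⟩ := hx ⟨0, Nat.pos_of_ne_zero hn⟩
  obtain ⟨g, rfl⟩ := hA ha
  let B : Finset X := Finset.univ.filter fun g => Φ g ∈ A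
  have hB : B.card ≤ s := by
    rw [← Finset.card_image_of_injective B hinj, ← Set.ncard_coe_finset]
    refine (Set.ncard_le_ncard ?_ (Set.toFinite A)).trans hAs
    intro y hy
    obtain ⟨g, hg, rfl⟩ := Finset.mem_image.1 (Finset.mem_coe.1 hy)
    exact (Finset.mem_filter.1 hg).2
  obtain ⟨i, hi⟩ := sep f B ⟨g, Finset.mem_filter.2 ⟨Finset.mem_univ _, ha⟩⟩ hB
    (fun h => hfA (Finset.mem_filter.1 h).2)
  obtain ⟨_, ha', he⟩ := hx (eI.symm i)
  obtain ⟨g', rfl⟩ := hA ha'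
  exact hi g' (Finset.mem_filter.2 ⟨Finset.mem_univ _, ha'⟩) (hΦ he)

lemma ncard_le_pow {n q : ℕ} (C : Set (Fin n → Fin q)) : C.ncard ≤ q ^ n := by
  refine (Set.ncard_le_card C).trans ?_
  rw [Nat.card_eq_fintype_card]
  simp

lemma Mfp_le (q n s : ℕ) : Mfp q n s ≤ q ^ n := by
  refine csSup_le' ?_
  rintro _ ⟨C, -, rfl⟩
  exact ncard_le_pow C

lemma ncard_le_Mfp {q n s : ℕ} {C : Set (Fin n → Fin q)} (h : IsFrameproof s C) :
    C.ncard ≤ Mfp q n s := by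
  refine le_csSup ⟨q ^ n, ?_⟩ ⟨C, h, rfl⟩
  rintro _ ⟨C, -, rfl⟩
  exact ncard_le_pow C

lemma pow_le_mul_Mfp {r : ℕ} (hr : IsPrimePow r) {k m s : ℕ} (hs0 : s ≠ 0)
    (hs : s * m < (r ^ 2 - 1) * r ^ k) :
    (r ^ 2) ^ (m + 1) ≤ (r ^ 2) ^ r ^ (k + 1) * Mfp (r ^ 2) ((r ^ 2 - r) * r ^ k) s := by
  have hr2 : 2 ≤ r := hr.two_le
  obtain ⟨F, hF, hcard⟩ : ∃ (F : Type) (_ : Field F), Nat.card F = r ^ 2 := by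
    obtain ⟨p, n, hp, hn, he⟩ := (isPrimePow_nat_iff _).1 (hr.pow (show 2 ≠ 0 by norm_num))
    have : Fact p.Prime := ⟨hp⟩
    exact ⟨GaloisField p n, inferInstance, (GaloisField.card p n hn.ne').trans he⟩
  have hfin : Finite F := Nat.finite_of_card_ne_zero (by rw [hcard]; positivity)
  have := Fintype.ofFinite F
  obtain ⟨t⟩ := exists_tower F hr (by rw [← Nat.card_eq_fintype_card, hcard])
  obtain ⟨Vi, hVi⟩ := t.exists_inf
  have hWf := Tower.finite_W hVi k (m + 1)
  have hXf : Finite (t.A k (k / 2 + 1) ⊓ t.W Vi k (m + 1) : AddSubgroup _) :=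
    Finite.of_injective (fun f => (⟨f.1, f.2.2⟩ : t.W Vi k (m + 1))) fun f g h =>
      Subtype.ext (congrArg (fun y : t.W Vi k (m + 1) => (y : AlgebraicClosure (RatFunc F))) h)
  obtain ⟨ev, hev⟩ := Tower.exists_evaluation hVi hs
  have hn : (r ^ 2 - r) * r ^ k ≠ 0 := by
    have : r < r ^ 2 := by nlinarith
    exact Nat.mul_ne_zero (by omega) (pow_ne_zero _ (by omega))
  obtain ⟨C, hC, hCc⟩ := exists_frameproof (t.card_Idx k) hcard hn hs0 ev hev
  refine (Tower.le_card_A_inf_W hVi k (m + 1)).trans (Nat.mul_le_mul_left _ ?_)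
  rw [← hCc]
  exact ncard_le_Mfp hC

lemma le_logb_Mfp_div {r : ℕ} (hr : IsPrimePow r) (k : ℕ) {s : ℕ} (hs0 : s ≠ 0) :
    ((r : ℝ) + 1) / (r * s) - 1 / ((r : ℝ) - 1) ≤
      Real.logb ((r ^ 2 : ℕ) : ℝ) (Mfp (r ^ 2) ((r ^ 2 - r) * r ^ k) s) /
        (((r ^ 2 - r) * r ^ k : ℕ) : ℝ) := by
  have hr2 : 2 ≤ r := hr.two_le
  set D := (r ^ 2 - 1) * r ^ k with hD
  have hDpos : 0 < D := Nat.mul_pos (by have : r < r ^ 2 := by nlinarith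
                                        omega) (by positivity)
  set m := (D - 1) / s with hm
  have hm1 : s * m < D := (Nat.mul_div_le _ _).trans_lt (by omega)
  have hm2 : D ≤ s * (m + 1) := by
    have := Nat.lt_mul_div_succ (D - 1) (Nat.pos_of_ne_zero hs0)
    rw [← hm] at this
    omega
  have h := pow_le_mul_Mfp hr hs0 hm1
  set M := Mfp (r ^ 2) ((r ^ 2 - r) * r ^ k) s with hM
  have hq : (1 : ℝ) < ((r ^ 2 : ℕ) : ℝ) := by
    exact_mod_cast Nat.one_lt_pow (by norm_num) (by omega)
  have hM0 : M ≠ 0 := by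
    intro h0
    rw [h0, mul_zero] at h
    have : 0 < (r ^ 2) ^ (m + 1) := by positivity
    omega
  have hMpos : (0 : ℝ) < M := by exact_mod_cast Nat.pos_of_ne_zero hM0
  have hlog : (m : ℝ) + 1 ≤ (r : ℝ) ^ (k + 1) + Real.logb ((r ^ 2 : ℕ) : ℝ) M := by
    have h1 : (((r ^ 2 : ℕ) : ℝ)) ^ (m + 1) ≤ ((r ^ 2 : ℕ) : ℝ) ^ r ^ (k + 1) * M := by
      exact_mod_cast h
    have h2 := Real.logb_le_logb_of_le hq (by positivity) h1
    rw [Real.logb_mul (by positivity) hMpos.ne', Real.logb_pow, Real.logb_pow,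
      Real.logb_self_eq_one hq, mul_one, mul_one] at h2
    exact_mod_cast h2
  have hrR : (2 : ℝ) ≤ r := by exact_mod_cast hr2
  have hsR : (0 : ℝ) < s := by exact_mod_cast Nat.pos_of_ne_zero hs0
  have hDR : ((r : ℝ) ^ 2 - 1) * (r : ℝ) ^ k ≤ s * (m + 1) := by
    have h1 : ((D : ℕ) : ℝ) ≤ ((s * (m + 1) : ℕ) : ℝ) := by exact_mod_cast hm2
    rw [hD] at h1
    push_cast [Nat.cast_sub (Nat.one_le_pow 2 r (by omega))] at h1
    exact h1
  have hN : (((r ^ 2 - r) * r ^ k : ℕ) : ℝ) = ((r : ℝ) ^ 2 - r) * (r : ℝ) ^ k := by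
    push_cast [Nat.cast_sub (Nat.le_self_pow (by norm_num) r : r ≤ r ^ 2)]
    rfl
  have hρ : (0 : ℝ) < (r : ℝ) ^ k := by positivity
  have hr1 : (0 : ℝ) < (r : ℝ) - 1 := by linarith
  have hN0 : 0 < ((r : ℝ) ^ 2 - r) * (r : ℝ) ^ k := by
    have : (r : ℝ) ^ 2 - r = r * (r - 1) := by ring
    rw [this]; positivity
  rw [hN, le_div_iff₀ hN0]
  have e : (((r : ℝ) + 1) / (r * s) - 1 / ((r : ℝ) - 1)) * (((r : ℝ) ^ 2 - r) * (r : ℝ) ^ k) =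
      (((r : ℝ) ^ 2 - 1) * (r : ℝ) ^ k) / s - (r : ℝ) ^ (k + 1) := by
    field_simp
    ring
  rw [e]
  have : (((r : ℝ) ^ 2 - 1) * (r : ℝ) ^ k) / s ≤ m + 1 := by
    rw [div_le_iff₀ hsR]; linarith
  linarith

lemma le_Rfp {r : ℕ} (hr : IsPrimePow r) {s : ℕ} (hs0 : s ≠ 0) :
    ((r : ℝ) + 1) / (r * s) - 1 / ((r : ℝ) - 1) ≤ Rfp (r ^ 2) s := by
  have hr2 : 2 ≤ r := hr.two_le
  refine le_limsup_of_frequently_le ?_ ⟨1, ?_⟩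
  · rw [frequently_atTop]
    intro n
    refine ⟨(r ^ 2 - r) * r ^ n, ?_, le_logb_Mfp_div hr n hs0⟩
    have h1 : r < r ^ 2 := by nlinarith
    exact (Nat.lt_pow_self hr2).le.trans (Nat.le_mul_of_pos_left _ (by omega))
  · rw [eventually_map]
    refine Eventually.of_forall fun n => ?_
    rcases Nat.eq_zero_or_pos n with rfl | hn
    · simp
    rw [div_le_one (by exact_mod_cast hn)]
    have hq : (1 : ℝ) < ((r ^ 2 : ℕ) : ℝ) := by
      exact_mod_cast Nat.one_lt_pow (by norm_num) (by omega)
    rcases Nat.eq_zero_or_pos (Mfp (r ^ 2) n s) with h0 | hM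
    · rw [h0]; simp
    · have h1 : ((Mfp (r ^ 2) n s : ℕ) : ℝ) ≤ ((r ^ 2 : ℕ) : ℝ) ^ n := by
        exact_mod_cast Mfp_le (r ^ 2) n s
      have h2 := Real.logb_le_logb_of_le hq (by exact_mod_cast hM) h1
      rwa [Real.logb_pow, Real.logb_self_eq_one hq, mul_one] at h2

lemma one_le_mul_logb {r s : ℕ} (hr : 2 ≤ r) (hs : 2 ≤ s) :
    1 ≤ 2 * r * Real.logb ((r ^ 2 : ℕ) : ℝ) s := by
  have hlr : 0 < Real.log r := Real.log_pos (by exact_mod_cast hr)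
  have h1 : Real.log r ≤ r * Real.log s := by
    rw [← Real.log_pow]
    refine Real.log_le_log (by exact_mod_cast (show 0 < r by omega)) ?_
    exact_mod_cast (Nat.lt_pow_self hs).le
  rw [Real.logb, Nat.cast_pow, Real.log_pow]
  have e : 2 * (r : ℝ) * (Real.log s / ((2 : ℕ) * Real.log r)) = r * Real.log s / Real.log r := by
    push_cast
    field_simp
  rw [e, le_div_iff₀ hlr]
  linarith

end GS

/-- For a square prime power `q = r^2` and an integer `2 ≤ s ≤ √q − 1 = r − 1`,
`R_q(s) ≥ 1/s − 1/(√q − 1) + (1 − 2 log_q s)/(s(√q − 1))`. -/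
theorem stmt12 (q r s : ℕ) (hq : IsPrimePow q) (hr : q = r ^ 2)
    (hs : 2 ≤ s) (hsr : s ≤ r - 1) :
    1 / (s : ℝ) - 1 / ((r : ℝ) - 1) +
        (1 - 2 * Real.logb q s) / ((s : ℝ) * ((r : ℝ) - 1)) ≤ Rfp q s := by
  subst hr
  have hrp : IsPrimePow r := (isPrimePow_pow_iff (by norm_num)).1 hq
  have hr2 := hrp.two_le
  refine le_trans ?_ (GS.le_Rfp hrp (by omega))
  have hlog := GS.one_le_mul_logb hr2 hs
  set l := Real.logb ((r ^ 2 : ℕ) : ℝ) s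
  have hrR : (2 : ℝ) ≤ r := by exact_mod_cast hr2
  have hsR : (0 : ℝ) < s := by exact_mod_cast (show 0 < s by omega)
  have hr1 : (0 : ℝ) < (r : ℝ) - 1 := by linarith
  have e : ((r : ℝ) + 1) / (r * s) = 1 / s + 1 / (r * s) := by field_simp
  have h : (1 - 2 * l) / ((s : ℝ) * ((r : ℝ) - 1)) ≤ 1 / (r * s) := by
    rw [div_le_div_iff₀ (by positivity) (by positivity)]
    nlinarith
  rw [e]
  linarith
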